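/- Let d ≥ 2 and let x₁ < x₂ < … < x_{2d−2} be distinct real numbers, and let u_d = (1/d)·binom(2d−2, d−1). Then the number of equivalence classes of rational functions of degree d whose set of critical points in the Riemann sphere is exactly {x₁, …, x_{2d−2}} equals u_d, and every such equivalence class contains a rational function with real coefficients. -/

import Mathlib

open Polynomial OnePoint

/-- The value of the rational function `f₁/f₀` at the point `∞` of the Riemann sphere. -/
noncomputable def ratAtInf (f₁ f₀ : ℂ[X]) : OnePoint ℂ :=
  if f₀.degree < f₁.degree then ∞
  else ((f₁.coeff f₀.natDegree / f₀.leadingCoeff : ℂ) : OnePoint ℂ)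

/-- The extension of the rational function `f₁/f₀` (ratio of two polynomials) to a self-map
of the Riemann sphere `ℂ̂ = ℂ ∪ {∞}`, realized as the one-point compactification of `ℂ`. -/
noncomputable def ratExt (f₁ f₀ : ℂ[X]) : OnePoint ℂ → OnePoint ℂ
  | ∞ => ratAtInf f₁ f₀
  | (z : ℂ) => if f₀.eval z = 0 then ∞ else ((f₁.eval z / f₀.eval z : ℂ) : OnePoint ℂ)

/-- A point `p` of the Riemann sphere is a critical point of `f` if `f` fails to be
locally injective at `p`. -/
def IsCritPt (f : OnePoint ℂ → OnePoint ℂ) (p : OnePoint ℂ) : Prop :=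
  ¬ ∃ U ∈ nhds p, Set.InjOn f U

/-- `(f₁, f₀)` represents a rational function of degree `d`: the two polynomials are
coprime and `max(deg f₁, deg f₀) = d`. -/
def IsRatOfDeg (d : ℕ) (f₁ f₀ : ℂ[X]) : Prop :=
  IsCoprime f₁ f₀ ∧ max f₁.degree f₀.degree = (d : ℕ)

/-- `f₁/f₀` and `g₁/g₀` are equivalent rational functions, i.e. `f₁/f₀ = ℓ∘(g₁/g₀)` for
a fractional-linear transformation `ℓ(w) = (aw+b)/(cw+e)` with `ae − bc ≠ 0`; in terms of
the representing pairs this reads `f₁·(c g₁ + e g₀) = f₀·(a g₁ + b g₀)`. -/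
def RatEquiv (f₁ f₀ g₁ g₀ : ℂ[X]) : Prop :=
  ∃ a b c e : ℂ, a * e - b * c ≠ 0 ∧ f₁ * (c • g₁ + e • g₀) = f₀ * (a • g₁ + b • g₀)

/-- `u_d = (1/d)·C(2d−2, d−1)`, the `d`-th Catalan number. -/
def ud (d : ℕ) : ℕ := (2 * d - 2).choose (d - 1) / d

namespace Gaudin

open Finset

section Lattice

variable {α : Type*} [DecidableEq α]

/-- The operator summing a function on finsets over all ways of adding one element of `U`. -/
def addOne (U : Finset α) (ψ : Finset α → ℂ) : Finset α → ℂ :=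
  fun J => ∑ j ∈ U \ J, ψ (insert j J)

/-- The operator summing a function on finsets over all ways of removing one element. -/
def removeOne (ψ : Finset α → ℂ) : Finset α → ℂ :=
  fun K => ∑ i ∈ K, ψ (K.erase i)

lemma addOne_removeOne (U : Finset α) (ψ : Finset α → ℂ) {I : Finset α} (hI : I ⊆ U) :
    addOne U (removeOne ψ) I =
      ((#U : ℂ) - #I) * ψ I + ∑ i ∈ I, ∑ j ∈ U \ I, ψ (insert j (I.erase i)) := by
  unfold addOne removeOne
  have h1 : ∀ j ∈ U \ I, ∑ i ∈ insert j I, ψ ((insert j I).erase i) =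
      ψ I + ∑ i ∈ I, ψ (insert j (I.erase i)) := by
    intro j hj
    have hjI : j ∉ I := (mem_sdiff.1 hj).2
    rw [sum_insert hjI, erase_insert hjI]
    congr 1
    refine sum_congr rfl fun i hi => ?_
    rw [erase_insert_of_ne]
    rintro rfl; exact hjI hi
  rw [sum_congr rfl h1, sum_add_distrib, sum_const, sum_comm, card_sdiff_of_subset hI,
    nsmul_eq_mul, Nat.cast_sub (card_le_card hI)]

lemma removeOne_addOne (U : Finset α) (ψ : Finset α → ℂ) {I : Finset α} (hI : I ⊆ U) :
    removeOne (addOne U ψ) I =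
      (#I : ℂ) * ψ I + ∑ i ∈ I, ∑ j ∈ U \ I, ψ (insert j (I.erase i)) := by
  unfold addOne removeOne
  have h1 : ∀ i ∈ I, ∑ j ∈ U \ I.erase i, ψ (insert j (I.erase i)) =
      ψ I + ∑ j ∈ U \ I, ψ (insert j (I.erase i)) := by
    intro i hi
    have : U \ I.erase i = insert i (U \ I) := by
      ext a; by_cases h : a = i
      · subst h; simp [hI hi]
      · simp [h]
    rw [this, sum_insert (by simp [hi]), insert_erase hi]
  rw [sum_congr rfl h1, sum_add_distrib, sum_const, nsmul_eq_mul]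

lemma addOne_removeOne_sub (U : Finset α) (ψ : Finset α → ℂ) {I : Finset α} (hI : I ⊆ U) :
    addOne U (removeOne ψ) I = removeOne (addOne U ψ) I + ((#U : ℂ) - 2 * #I) * ψ I := by
  rw [addOne_removeOne U ψ hI, removeOne_addOne U ψ hI]; ring

lemma sum_mul_removeOne (U : Finset α) (r : ℕ) (φ ψ : Finset α → ℂ) :
    ∑ K ∈ U.powersetCard (r + 1), φ K * removeOne ψ K =
      ∑ I ∈ U.powersetCard r, addOne U φ I * ψ I := by
  unfold addOne removeOne
  simp_rw [mul_sum, sum_mul]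
  rw [sum_sigma', sum_sigma']
  refine sum_bij' (fun p _ => ⟨p.1.erase p.2, p.2⟩) (fun p _ => ⟨insert p.2 p.1, p.2⟩)
    ?_ ?_ ?_ ?_ ?_
  · rintro ⟨K, i⟩ h
    simp only [mem_sigma, mem_powersetCard, mem_sdiff, mem_erase, ne_eq, not_true_eq_false,
      false_and, not_false_eq_true, and_true] at h ⊢
    exact ⟨⟨(erase_subset _ _).trans h.1.1, by rw [card_erase_of_mem h.2, h.1.2]; rfl⟩, h.1.1 h.2⟩
  · rintro ⟨I, i⟩ h
    simp only [mem_sigma, mem_powersetCard, mem_sdiff, mem_insert, true_or, and_true] at h ⊢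
    exact ⟨insert_subset h.2.1 h.1.1, by rw [card_insert_of_notMem h.2.2, h.1.2]⟩
  · rintro ⟨K, i⟩ h
    simp only [mem_sigma] at h
    simp [insert_erase h.2]
  · rintro ⟨I, i⟩ h
    simp only [mem_sigma, mem_sdiff] at h
    simp [erase_insert h.2.2]
  · rintro ⟨K, i⟩ h
    simp only [mem_sigma] at h
    simp [insert_erase h.2]

lemma addOne_star (U : Finset α) (ψ : Finset α → ℂ) :
    addOne U (fun I => star (ψ I)) = fun I => star (addOne U ψ I) := by
  ext I; simp [addOne, star_sum]

lemma removeOne_star (ψ : Finset α → ℂ) :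
    removeOne (fun I => star (ψ I)) = fun I => star (removeOne ψ I) := by
  ext I; simp [removeOne, star_sum]

lemma sum_normSq_eq_zero {ι : Type*} {s : Finset ι} {φ : ι → ℂ}
    (h : ∑ i ∈ s, star (φ i) * φ i = 0) : ∀ i ∈ s, φ i = 0 := by
  have h1 : ∑ i ∈ s, ‖φ i‖ ^ 2 = 0 := by
    have : ((∑ i ∈ s, ‖φ i‖ ^ 2 : ℝ) : ℂ) = ∑ i ∈ s, star (φ i) * φ i := by
      push_cast
      refine sum_congr rfl fun i _ => ?_
      rw [mul_comm]; exact (Complex.mul_conj' (φ i)).symm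
    rw [h] at this; exact_mod_cast this
  intro i hi
  have := (sum_eq_zero_iff_of_nonneg (fun i _ => sq_nonneg ‖φ i‖)).1 h1 i hi
  simpa using this

/-- The norm identity `‖removeOne ψ‖² = ‖addOne ψ‖² + (|U| - 2 r) ‖ψ‖²` between two levels. -/
lemma sum_normSq_removeOne (U : Finset α) (r : ℕ) (ψ : Finset α → ℂ) :
    ∑ K ∈ U.powersetCard (r + 1), star (removeOne ψ K) * removeOne ψ K =
      ∑ I ∈ U.powersetCard r, star (removeOne (addOne U ψ) I) * ψ I +
        ((#U : ℂ) - 2 * r) * ∑ I ∈ U.powersetCard r, star (ψ I) * ψ I := by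
  rw [sum_mul_removeOne U r (fun K => star (removeOne ψ K)) ψ, addOne_star, mul_sum,
    ← sum_add_distrib]
  refine sum_congr rfl fun I hI => ?_
  rw [mem_powersetCard] at hI
  simp only
  rw [addOne_removeOne_sub U ψ hI.1, hI.2, star_add, star_mul']
  simp; ring

/-- `ψ` is annihilated by `addOne` on the `r`-subsets of `U`. -/
def IsSing (U : Finset α) (r : ℕ) (ψ : Finset α → ℂ) : Prop :=
  ∀ J ⊆ U, #J + 1 = r → addOne U ψ J = 0

lemma IsSing.removeOne_addOne {U : Finset α} {r : ℕ} {ψ : Finset α → ℂ} (h : IsSing U r ψ)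
    {I : Finset α} (hI : I ⊆ U) (hr : #I = r) : removeOne (addOne U ψ) I = 0 := by
  unfold removeOne
  refine sum_eq_zero fun i hi => h _ ((erase_subset _ _).trans hI) ?_
  rw [card_erase_of_mem hi, hr]
  have : 0 < #I := card_pos.2 ⟨i, hi⟩
  omega

lemma IsSing.sum_normSq_removeOne {U : Finset α} {r : ℕ} {ψ : Finset α → ℂ} (h : IsSing U r ψ) :
    ∑ K ∈ U.powersetCard (r + 1), star (removeOne ψ K) * removeOne ψ K =
      ((#U : ℂ) - 2 * r) * ∑ I ∈ U.powersetCard r, star (ψ I) * ψ I := by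
  rw [Gaudin.sum_normSq_removeOne]
  rw [sum_eq_zero, zero_add]
  intro I hI
  rw [mem_powersetCard] at hI
  rw [h.removeOne_addOne hI.1 hI.2]; simp

lemma sum_normSq_eq_ofReal {ι : Type*} (s : Finset ι) (φ : ι → ℂ) :
    ∑ i ∈ s, star (φ i) * φ i = ((∑ i ∈ s, ‖φ i‖ ^ 2 : ℝ) : ℂ) := by
  push_cast
  refine sum_congr rfl fun i _ => ?_
  rw [mul_comm]; exact (Complex.mul_conj' (φ i))

lemma IsSing.two_mul_le {U : Finset α} {r : ℕ} {ψ : Finset α → ℂ} (h : IsSing U r ψ)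
    (hne : ∃ I ⊆ U, #I = r ∧ ψ I ≠ 0) : 2 * r ≤ #U := by
  by_contra! hlt
  have h1 := h.sum_normSq_removeOne
  rw [sum_normSq_eq_ofReal, sum_normSq_eq_ofReal] at h1
  have h2 : (∑ K ∈ U.powersetCard (r + 1), ‖removeOne ψ K‖ ^ 2 : ℝ) =
      ((#U : ℝ) - 2 * r) * ∑ I ∈ U.powersetCard r, ‖ψ I‖ ^ 2 := by exact_mod_cast h1
  have h3 : 0 ≤ ∑ K ∈ U.powersetCard (r + 1), ‖removeOne ψ K‖ ^ 2 :=
    sum_nonneg fun _ _ => sq_nonneg _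
  obtain ⟨I, hIU, hIr, hI⟩ := hne
  have h4 : 0 < ∑ I ∈ U.powersetCard r, ‖ψ I‖ ^ 2 :=
    sum_pos' (fun _ _ => sq_nonneg _) ⟨I, mem_powersetCard.2 ⟨hIU, hIr⟩, by positivity⟩
  have h5 : (#U : ℝ) - 2 * r < 0 := by
    have : (#U : ℝ) < 2 * r := by exact_mod_cast hlt
    linarith
  nlinarith [mul_neg_of_neg_of_pos h5 h4]

lemma IsSing.removeOne_eq_zero {U : Finset α} {r : ℕ} {ψ : Finset α → ℂ} (h : IsSing U r ψ)
    (hU : #U = 2 * r) {K : Finset α} (hK : K ⊆ U) (hKr : #K = r + 1) : removeOne ψ K = 0 := by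
  have h1 := h.sum_normSq_removeOne
  rw [hU] at h1
  push_cast at h1
  rw [sub_self, zero_mul] at h1
  exact sum_normSq_eq_zero h1 K (mem_powersetCard.2 ⟨hK, hKr⟩)

/-- `removeOne` is injective below the middle level. -/
lemma eq_zero_of_removeOne_eq_zero {U : Finset α} {r : ℕ} {ψ : Finset α → ℂ}
    (hU : 2 * r < #U) (h : ∀ K ∈ U.powersetCard (r + 1), removeOne ψ K = 0) :
    ∀ I ∈ U.powersetCard r, ψ I = 0 := by
  have h1 := Gaudin.sum_normSq_removeOne U r ψ
  rw [sum_eq_zero (fun K hK => by rw [h K hK]; simp)] at h1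
  have h2 : ∃ c : ℝ, 0 ≤ c ∧
      ∑ I ∈ U.powersetCard r, star (removeOne (addOne U ψ) I) * ψ I = (c : ℂ) := by
    cases r with
    | zero =>
      refine ⟨0, le_rfl, ?_⟩
      simp [removeOne]
    | succ r =>
      refine ⟨∑ J ∈ U.powersetCard r, ‖addOne U ψ J‖ ^ 2, sum_nonneg fun _ _ => sq_nonneg _, ?_⟩
      rw [← sum_normSq_eq_ofReal]
      have h3 := sum_mul_removeOne U r ψ (fun I => star (addOne U ψ I))
      rw [removeOne_star] at h3
      rw [sum_congr rfl (fun I _ => mul_comm _ _), h3]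
      exact sum_congr rfl (fun I _ => mul_comm _ _)
  obtain ⟨c, hc, h2⟩ := h2
  rw [h2, sum_normSq_eq_ofReal] at h1
  have h3 : (0 : ℝ) = c + ((#U : ℝ) - 2 * r) * ∑ I ∈ U.powersetCard r, ‖ψ I‖ ^ 2 := by
    exact_mod_cast h1
  have h5 : 0 < (#U : ℝ) - 2 * r := by
    have : 2 * (r : ℝ) < #U := by exact_mod_cast hU
    linarith
  have h4 : 0 ≤ ∑ I ∈ U.powersetCard r, ‖ψ I‖ ^ 2 := sum_nonneg fun _ _ => sq_nonneg _
  have h6 : ∑ I ∈ U.powersetCard r, ‖ψ I‖ ^ 2 = 0 := by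
    by_contra hne
    have : 0 < ∑ I ∈ U.powersetCard r, ‖ψ I‖ ^ 2 := lt_of_le_of_ne h4 (Ne.symm hne)
    have := mul_pos h5 this
    linarith
  intro I hI
  have := (sum_eq_zero_iff_of_nonneg (fun i _ => sq_nonneg ‖ψ i‖)).1 h6 I hI
  simpa using this

lemma map_swap_of_iff {i j : α} {I : Finset α} (h : i ∈ I ↔ j ∈ I) :
    I.map (Equiv.swap i j).toEmbedding = I := by
  ext a
  rw [mem_map_equiv, Equiv.symm_swap]
  by_cases h1 : a = i
  · subst h1; simp [h]
  by_cases h2 : a = j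
  · subst h2; simp [h]
  rw [Equiv.swap_apply_of_ne_of_ne h1 h2]

lemma map_swap_of_mem_notMem {i j : α} {I : Finset α} (hi : i ∈ I) (hj : j ∉ I) :
    I.map (Equiv.swap i j).toEmbedding = insert j (I.erase i) := by
  have hij : i ≠ j := by rintro rfl; exact hj hi
  ext a
  rw [mem_map_equiv, Equiv.symm_swap]
  by_cases h1 : a = i
  · subst h1; simp [hj, hij]
  by_cases h2 : a = j
  · subst h2; simp [hi]
  rw [Equiv.swap_apply_of_ne_of_ne h1 h2]
  simp [h1, h2]

lemma map_swap_comm (i j : α) (I : Finset α) :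
    I.map (Equiv.swap i j).toEmbedding = I.map (Equiv.swap j i).toEmbedding := by
  rw [Equiv.swap_comm]

/-- The sum of all exchanges of two sites of `U`. -/
lemma sum_sum_swap (U : Finset α) (ψ : Finset α → ℂ) {I : Finset α} (hI : I ⊆ U) :
    ∑ i ∈ U, ∑ j ∈ U, ψ (I.map (Equiv.swap i j).toEmbedding) =
      ((#I : ℂ) ^ 2 + ((#U : ℂ) - #I) ^ 2 - 2 * #I) * ψ I + 2 * removeOne (addOne U ψ) I := by
  have key : ∀ F : α → ℂ, ∑ i ∈ U, F i = ∑ i ∈ I, F i + ∑ i ∈ U \ I, F i := by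
    intro F; rw [add_comm, sum_sdiff hI]
  rw [key]
  simp_rw [key]
  rw [sum_add_distrib, sum_add_distrib]
  have c1 : ∑ i ∈ I, ∑ j ∈ I, ψ (I.map (Equiv.swap i j).toEmbedding) = (#I : ℂ) ^ 2 * ψ I := by
    rw [sum_congr rfl fun i hi => sum_congr rfl fun j hj => by
      rw [map_swap_of_iff (iff_of_true hi hj)]]
    simp; ring
  have c2 : ∑ i ∈ U \ I, ∑ j ∈ U \ I, ψ (I.map (Equiv.swap i j).toEmbedding) =
      ((#U : ℂ) - #I) ^ 2 * ψ I := by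
    rw [sum_congr rfl fun i hi => sum_congr rfl fun j hj => by
      rw [map_swap_of_iff (iff_of_false (mem_sdiff.1 hi).2 (mem_sdiff.1 hj).2)]]
    simp only [sum_const, nsmul_eq_mul, card_sdiff_of_subset hI, Nat.cast_sub (card_le_card hI)]
    ring
  have c3 : ∑ i ∈ I, ∑ j ∈ U \ I, ψ (I.map (Equiv.swap i j).toEmbedding) =
      ∑ i ∈ I, ∑ j ∈ U \ I, ψ (insert j (I.erase i)) :=
    sum_congr rfl fun i hi => sum_congr rfl fun j hj => by
      rw [map_swap_of_mem_notMem hi (mem_sdiff.1 hj).2]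
  have c4 : ∑ i ∈ U \ I, ∑ j ∈ I, ψ (I.map (Equiv.swap i j).toEmbedding) =
      ∑ i ∈ I, ∑ j ∈ U \ I, ψ (insert j (I.erase i)) := by
    rw [sum_comm]
    exact sum_congr rfl fun i hi => sum_congr rfl fun j hj => by
      rw [map_swap_comm, map_swap_of_mem_notMem hi (mem_sdiff.1 hj).2]
  rw [c1, c2, c3, c4, Gaudin.removeOne_addOne U ψ hI]
  ring

end Lattice

end Gaudin

namespace Gaudin

open Finset

variable {ι : Type*} [Fintype ι] [DecidableEq ι]

/-- The exchange Hamiltonian at the site `i` with coupling constants `A i j`. -/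
noncomputable def hamiltonian (A : ι → ι → ℝ) (i : ι) (ψ : Finset ι → ℂ) : Finset ι → ℂ :=
  fun I => ∑ j, (A i j : ℂ) * (ψ I - ψ (I.map (Equiv.swap i j).toEmbedding))

/-- The coupling constants of the Gaudin model with sites `x`. -/
noncomputable def gaudin (x : ι → ℝ) : ι → ι → ℝ := fun i j => (x i - x j)⁻¹

section Bethe

variable {m : ℕ}

/-- The enumerations of a finset by `Fin m`. -/
def enums (m : ℕ) (I : Finset ι) : Finset (Fin m → ι) :=
  univ.filter fun σ => Function.Injective σ ∧ univ.image σ = I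

lemma mem_enums {I : Finset ι} {σ : Fin m → ι} :
    σ ∈ enums m I ↔ Function.Injective σ ∧ univ.image σ = I := by
  simp [enums]

/-- The weight of an enumeration. -/
noncomputable def weight (x : ι → ℂ) (t : Fin m → ℂ) (σ : Fin m → ι) : ℂ :=
  ∏ l, (t l - x (σ l))⁻¹

/-- The Bethe vector. -/
noncomputable def bethe (x : ι → ℂ) (t : Fin m → ℂ) (I : Finset ι) : ℂ :=
  ∑ σ ∈ enums m I, weight x t σ

lemma mem_enums_swap {I : Finset ι} {σ : Fin m → ι} (i j : ι) :
    Equiv.swap i j ∘ σ ∈ enums m (I.map (Equiv.swap i j).toEmbedding) ↔ σ ∈ enums m I := by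
  rw [mem_enums, mem_enums, (Equiv.swap i j).injective.of_comp_iff, ← image_image, map_eq_image]
  refine and_congr_right fun _ => ?_
  exact (image_injective (Equiv.swap i j).injective).eq_iff

lemma bethe_map_swap (x : ι → ℂ) (t : Fin m → ℂ) (I : Finset ι) (i j : ι) :
    bethe x t (I.map (Equiv.swap i j).toEmbedding) =
      ∑ σ ∈ enums m I, weight x t (Equiv.swap i j ∘ σ) := by
  unfold bethe
  refine (sum_bij' (fun σ _ => Equiv.swap i j ∘ σ) (fun σ _ => Equiv.swap i j ∘ σ)
    ?_ ?_ ?_ ?_ ?_).symm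
  · intro σ hσ; exact (mem_enums_swap i j).2 hσ
  · intro σ hσ
    have h : ⇑(Equiv.swap i j) ∘ ⇑(Equiv.swap i j) = id := by ext; simp
    rw [← mem_enums_swap i j, ← Function.comp_assoc, h, Function.id_comp]
    exact hσ
  · intro σ _; ext; simp
  · intro σ _; ext; simp
  · intro σ _; rfl

lemma weight_swap_of_notMem {x : ι → ℂ} {t : Fin m → ℂ} {σ : Fin m → ι} {i j : ι} {k : Fin m}
    (hσ : Function.Injective σ) (hk : σ k = i) (hj : j ∉ univ.image σ)
    (ht : t k ≠ x i) :
    weight x t (Equiv.swap i j ∘ σ) = weight x t σ * ((t k - x i) * (t k - x j)⁻¹) := by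
  unfold weight
  have hki : t k - x i ≠ 0 := sub_ne_zero.2 ht
  rw [← mul_prod_erase univ _ (mem_univ k), ← mul_prod_erase univ _ (mem_univ k)]
  have : ∀ l ∈ univ.erase k, (t l - x ((Equiv.swap i j ∘ σ) l))⁻¹ = (t l - x (σ l))⁻¹ := by
    intro l hl
    have h1 : σ l ≠ i := by
      rw [← hk]; exact fun h => (mem_erase.1 hl).1 (hσ h)
    have h2 : σ l ≠ j := by
      rintro rfl; exact hj (mem_image_of_mem _ (mem_univ l))
    rw [Function.comp_apply, Equiv.swap_apply_of_ne_of_ne h1 h2]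
  rw [prod_congr rfl this, Function.comp_apply, hk, Equiv.swap_apply_left]
  field_simp

lemma weight_swap_domain {x : ι → ℂ} {t : Fin m → ℂ} {σ : Fin m → ι} {k l : Fin m}
    (hkl : k ≠ l) :
    weight x t (σ ∘ Equiv.swap k l) = (t k - x (σ l))⁻¹ * ((t l - x (σ k))⁻¹ *
      ∏ a ∈ (univ.erase k).erase l, (t a - x (σ a))⁻¹) := by
  unfold weight
  rw [← mul_prod_erase univ _ (mem_univ k),
    ← mul_prod_erase (univ.erase k) _ (mem_erase.2 ⟨hkl.symm, mem_univ l⟩)]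
  congr 2
  · simp
  · simp
  · refine prod_congr rfl fun a ha => ?_
    simp only [mem_erase] at ha
    rw [Function.comp_apply, Equiv.swap_apply_of_ne_of_ne ha.2.1 ha.1]

lemma mem_enums_comp {I : Finset ι} {σ : Fin m → ι} (hσ : σ ∈ enums m I) (e : Equiv.Perm (Fin m)) :
    σ ∘ e ∈ enums m I := by
  rw [mem_enums] at hσ ⊢
  refine ⟨hσ.1.comp e.injective, ?_⟩
  rw [← image_image, image_univ_equiv, hσ.2]

/-- The Bethe ansatz equations. -/
def IsBetheRoot (x : ι → ℂ) (t : Fin m → ℂ) : Prop :=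
  Function.Injective t ∧ (∀ l i, t l ≠ x i) ∧
    ∀ k, ∑ l ∈ univ.erase k, 2 * (t k - t l)⁻¹ = ∑ i, (t k - x i)⁻¹

lemma bethe_cancel {x : ι → ℂ} {t : Fin m → ℂ} (ht : Function.Injective t)
    (htx : ∀ l i, t l ≠ x i) (I : Finset ι) (i : ι) :
    ∑ σ ∈ enums m I, ∑ k, ∑ l, (if σ k = i ∧ l ≠ k then
      weight x t σ * (2 * (t k - t l)⁻¹ - (t k - x (σ l))⁻¹ + (t l - x i)⁻¹) else 0) = 0 := by
  have e : ∀ f : (Fin m → ι) → Fin m → Fin m → ℂ, ∑ σ ∈ enums m I, ∑ k, ∑ l, f σ k l =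
      ∑ p ∈ enums m I ×ˢ (univ ×ˢ univ), f p.1 p.2.1 p.2.2 := by
    intro f
    rw [sum_product]
    exact sum_congr rfl fun σ _ => by rw [sum_product]
  rw [e]
  refine sum_involution (fun p _ => (p.1 ∘ Equiv.swap p.2.1 p.2.2, p.2.2, p.2.1)) ?_ ?_ ?_ ?_
  · rintro ⟨σ, k, l⟩ hp
    simp only [Function.comp_apply, Equiv.swap_apply_right, Equiv.swap_apply_left]
    by_cases h : σ k = i ∧ l ≠ k
    · rw [if_pos h, if_pos ⟨h.1, h.2.symm⟩, weight_swap_domain h.2.symm]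
      obtain ⟨rfl, hlk⟩ := h
      have : weight x t σ = (t k - x (σ k))⁻¹ * ((t l - x (σ l))⁻¹ *
          ∏ a ∈ (univ.erase k).erase l, (t a - x (σ a))⁻¹) := by
        unfold weight
        rw [← mul_prod_erase univ _ (mem_univ k),
          ← mul_prod_erase (univ.erase k) _ (mem_erase.2 ⟨hlk, mem_univ l⟩)]
      rw [this]
      generalize ∏ a ∈ (univ.erase k).erase l, (t a - x (σ a))⁻¹ = R
      have h1 : t k - x (σ k) ≠ 0 := sub_ne_zero.2 (htx _ _)
      have h2 : t k - x (σ l) ≠ 0 := sub_ne_zero.2 (htx _ _)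
      have h3 : t l - x (σ k) ≠ 0 := sub_ne_zero.2 (htx _ _)
      have h4 : t l - x (σ l) ≠ 0 := sub_ne_zero.2 (htx _ _)
      have h5 : t k - t l ≠ 0 := sub_ne_zero.2 fun h => hlk (ht h).symm
      have h6 : t l - t k ≠ 0 := sub_ne_zero.2 fun h => hlk (ht h)
      have h7 : (t l - t k)⁻¹ = - (t k - t l)⁻¹ := by rw [← neg_sub, inv_neg]
      rw [h7]
      field_simp
      ring
    · rw [if_neg h, if_neg, add_zero]
      exact fun h' => h ⟨h'.1, h'.2.symm⟩
  · rintro ⟨σ, k, l⟩ hp hne heq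
    simp only [ne_eq, ite_eq_right_iff, not_forall] at hne
    simp only [Prod.mk.injEq] at heq
    exact hne.1.2 heq.2.1
  · rintro ⟨σ, k, l⟩ hp
    simp only [mem_product, mem_univ, and_true] at hp ⊢
    exact mem_enums_comp hp _
  · rintro ⟨σ, k, l⟩ hp
    simp only [Prod.mk.injEq, and_true]
    ext a
    simp [Equiv.swap_comm l k]

/-- Bethe roots give joint eigenvectors of the Gaudin Hamiltonians. -/
theorem hamiltonian_bethe {x : ι → ℝ} (hx : Function.Injective x) {t : Fin m → ℂ}
    (ht : IsBetheRoot (fun i => (x i : ℂ)) t) (i : ι) (I : Finset ι) :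
    hamiltonian (gaudin x) i (bethe (fun i => (x i : ℂ)) t) I =
      (∑ l, ((x i : ℂ) - t l)⁻¹) * bethe (fun i => (x i : ℂ)) t I := by
  obtain ⟨htinj, htx, hbae⟩ := ht
  set y : ι → ℂ := fun i => (x i : ℂ) with hy
  have hyinj : ∀ a b, a ≠ b → y a - y b ≠ 0 := by
    intro a b hab
    rw [sub_ne_zero]; simpa [hy] using fun h => hab (hx h)
  have htx' : ∀ l i, t l - y i ≠ 0 := fun l i => sub_ne_zero.2 (htx l i)
  have e1 : hamiltonian (gaudin x) i (bethe y t) I =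
      ∑ j, (y i - y j)⁻¹ * (bethe y t I - bethe y t (I.map (Equiv.swap i j).toEmbedding)) := by
    simp [hamiltonian, gaudin, hy]
  rw [e1]
  change _ = (∑ l, (y i - t l)⁻¹) * _
  by_cases hi : i ∈ I
  · have hsplit : ∀ j, (y i - y j)⁻¹ * (bethe y t I - bethe y t (I.map (Equiv.swap i j).toEmbedding))
        = ∑ σ ∈ enums m I, ∑ k, if σ k = i then
            (if j ∉ I then weight y t σ * (t k - y j)⁻¹ else 0) else 0 := by
      intro j
      by_cases hj : j ∈ I
      · rw [map_swap_of_iff (iff_of_true hi hj)]; simp [hj]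
      · rw [bethe_map_swap, bethe, ← sum_sub_distrib, mul_sum]
        refine sum_congr rfl fun σ hσ => ?_
        rw [mem_enums] at hσ
        have : i ∈ univ.image σ := by rw [hσ.2]; exact hi
        obtain ⟨k, -, hk⟩ := mem_image.1 this
        rw [sum_eq_single k]
        · rw [if_pos hk, if_pos hj, weight_swap_of_notMem hσ.1 hk (by rw [hσ.2]; exact hj) (htx k i)]
          have := hyinj i j (by rintro rfl; exact hj hi)
          have := htx' k j
          field_simp
          ring
        · intro l _ hl
          rw [if_neg]
          rw [← hk]; exact fun h => hl (hσ.1 h)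
        · simp
    rw [sum_congr rfl fun j _ => hsplit j, sum_comm, bethe, mul_sum, ← sub_eq_zero,
      ← sum_sub_distrib]
    refine Eq.trans ?_ (bethe_cancel htinj htx I i)
    refine sum_congr rfl fun σ hσ => ?_
    rw [mem_enums] at hσ
    have : i ∈ univ.image σ := by rw [hσ.2]; exact hi
    obtain ⟨k, -, hk⟩ := mem_image.1 this
    have hk' : ∀ l, l ≠ k → σ l ≠ i := fun l hl h => hl (hσ.1 (h.trans hk.symm))
    rw [sum_comm, sum_eq_single k (fun l _ hl => by simp [hk' l hl]) (by simp)]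
    rw [sum_eq_single (f := fun k' => ∑ l, if σ k' = i ∧ l ≠ k' then weight y t σ *
      (2 * (t k' - t l)⁻¹ - (t k' - y (σ l))⁻¹ + (t l - y i)⁻¹) else 0) k
      (fun l _ hl => by simp [hk' l hl]) (by simp)]
    simp only [hk, if_true, true_and]
    have e2 : ∑ j, (if j ∉ I then weight y t σ * (t k - y j)⁻¹ else 0) =
        weight y t σ * (∑ j, (t k - y j)⁻¹ - ∑ l, (t k - y (σ l))⁻¹) := by
      rw [← sum_filter, ← mul_sum]
      congr 1
      rw [eq_sub_iff_add_eq, ← sum_image (f := fun j => (t k - y j)⁻¹) (fun a _ b _ h => hσ.1 h),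
        hσ.2, ← sum_filter_add_sum_filter_not univ (fun j => j ∉ I)]
      congr 1
      refine sum_congr ?_ fun _ _ => rfl
      ext; simp
    have e3 : ∑ l, (if l ≠ k then weight y t σ * (2 * (t k - t l)⁻¹ - (t k - y (σ l))⁻¹ +
        (t l - y i)⁻¹) else 0) = weight y t σ * ((∑ l ∈ univ.erase k, 2 * (t k - t l)⁻¹) -
          ∑ l ∈ univ.erase k, (t k - y (σ l))⁻¹ + ∑ l ∈ univ.erase k, (t l - y i)⁻¹) := by
      rw [← sum_filter, ← mul_sum, ← sum_sub_distrib, ← sum_add_distrib]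
      congr 1
      refine sum_congr ?_ fun _ _ => rfl
      ext; simp
    rw [e2, e3, hbae k, ← add_sum_erase univ (fun l => (t k - y (σ l))⁻¹) (mem_univ k),
      ← add_sum_erase univ (fun l => (y i - t l)⁻¹) (mem_univ k)]
    have e4 : ∀ l, (y i - t l)⁻¹ = - (t l - y i)⁻¹ := fun l => by rw [← neg_sub, inv_neg]
    simp_rw [e4, sum_neg_distrib, hk]
    ring
  · simp_rw [bethe_map_swap, bethe, ← sum_sub_distrib, mul_sum]
    rw [sum_comm]
    refine sum_congr rfl fun σ hσ => ?_
    rw [mem_enums] at hσ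
    have hz : ∀ j, j ∉ univ.image σ → (y i - y j)⁻¹ * (weight y t σ -
        weight y t (Equiv.swap i j ∘ σ)) = 0 := by
      intro j hj
      have : Equiv.swap i j ∘ σ = σ := by
        ext a
        have h1 : σ a ≠ i := by
          rintro rfl; exact hi (hσ.2 ▸ mem_image_of_mem _ (mem_univ a))
        have h2 : σ a ≠ j := by
          rintro rfl; exact hj (mem_image_of_mem _ (mem_univ a))
        rw [Function.comp_apply, Equiv.swap_apply_of_ne_of_ne h1 h2]
      rw [this, sub_self, mul_zero]
    rw [← sum_subset (subset_univ (univ.image σ)) (fun j _ hj => hz j hj),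
      sum_image (fun a _ b _ h => hσ.1 h), sum_mul]
    refine sum_congr rfl fun l _ => ?_
    have hil : i ≠ σ l := by
      rintro rfl; exact hi (hσ.2 ▸ mem_image_of_mem _ (mem_univ l))
    rw [Equiv.swap_comm, weight_swap_of_notMem hσ.1 rfl (by rw [hσ.2]; exact hi) (htx l _)]
    have h1 := hyinj i (σ l) hil
    have h2 := htx' l i
    have h3 : y i - t l ≠ 0 := by rw [← neg_sub]; exact neg_ne_zero.2 h2
    have h4 : (t l - y i)⁻¹ = -(y i - t l)⁻¹ := by rw [← neg_sub, inv_neg]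
    rw [h4]
    field_simp
    ring

end Bethe

end Gaudin

namespace Gaudin

open Finset

variable {ι : Type*} [Fintype ι] [DecidableEq ι] {m : ℕ}

lemma bethe_eq_zero_of_card_ne (x : ι → ℂ) (t : Fin m → ℂ) {I : Finset ι} (hI : #I ≠ m) :
    bethe x t I = 0 := by
  unfold bethe
  refine sum_eq_zero fun σ hσ => ?_
  rw [mem_enums] at hσ
  exact absurd (by rw [← hσ.2, card_image_of_injective _ hσ.1]; simp) hI

lemma bethe_insert (x : ι → ℂ) (t : Fin (m + 1) → ℂ) {J : Finset ι} {i : ι} (hi : i ∉ J) :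
    bethe x t (insert i J) = ∑ l, (t l - x i)⁻¹ * bethe x (t ∘ l.succAbove) J := by
  have h1 : bethe x t (insert i J) =
      ∑ σ ∈ enums (m + 1) (insert i J), ∑ l, if σ l = i then weight x t σ else 0 := by
    unfold bethe
    refine sum_congr rfl fun σ hσ => ?_
    rw [mem_enums] at hσ
    have : i ∈ univ.image σ := by rw [hσ.2]; exact mem_insert_self i J
    obtain ⟨k, -, hk⟩ := mem_image.1 this
    rw [sum_eq_single k (fun l _ hl => if_neg fun h => hl (hσ.1 (h.trans hk.symm))) (by simp),
      if_pos hk]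
  rw [h1, sum_comm]
  refine sum_congr rfl fun l _ => ?_
  rw [← sum_filter, bethe, mul_sum]
  refine sum_bij' (fun σ _ => σ ∘ l.succAbove) (fun τ _ => l.insertNth (α := fun _ => ι) i τ)
    ?_ ?_ ?_ ?_ ?_
  · intro σ hσ
    rw [mem_filter, mem_enums] at hσ
    rw [mem_enums]
    refine ⟨hσ.1.1.comp Fin.succAbove_right_injective, ?_⟩
    have h2 : ∀ a, a ∈ insert i J ↔ ∃ k, σ k = a := by
      intro a; rw [← hσ.1.2]; simp
    ext a
    simp only [mem_image, mem_univ, true_and, Function.comp_apply]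
    constructor
    · rintro ⟨k, rfl⟩
      have h3 := (h2 (σ (l.succAbove k))).2 ⟨_, rfl⟩
      rw [mem_insert] at h3
      refine h3.resolve_left fun h => ?_
      rw [← hσ.2] at h
      exact Fin.succAbove_ne l k (hσ.1.1 h)
    · intro ha
      obtain ⟨k, hk⟩ := (h2 a).1 (mem_insert_of_mem ha)
      have : k ≠ l := by
        rintro rfl; rw [← hk, hσ.2] at ha; exact hi ha
      obtain ⟨k', rfl⟩ := Fin.exists_succAbove_eq this
      exact ⟨k', hk⟩
  · intro τ hτ
    rw [mem_enums] at hτ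
    rw [mem_filter, mem_enums]
    have h2 : ∀ k, τ k ∈ J := fun k => by rw [← hτ.2]; exact mem_image_of_mem _ (mem_univ k)
    refine ⟨⟨?_, ?_⟩, by simp⟩
    · intro a b
      refine Fin.succAboveCases l ?_ (fun a => ?_) a <;>
        refine Fin.succAboveCases l ?_ (fun b => ?_) b
      · simp
      · simp only [Fin.insertNth_apply_same, Fin.insertNth_apply_succAbove]
        intro h; exact absurd (h ▸ h2 b) hi
      · simp only [Fin.insertNth_apply_same, Fin.insertNth_apply_succAbove]
        intro h; exact absurd (h ▸ h2 a) hi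
      · simp only [Fin.insertNth_apply_succAbove]
        intro h; rw [hτ.1 h]
    · ext a
      simp only [mem_image, mem_univ, true_and, mem_insert]
      rw [Fin.exists_iff_succAbove l]
      simp only [Fin.insertNth_apply_same, Fin.insertNth_apply_succAbove]
      rw [← hτ.2]
      simp [eq_comm]
  · intro σ hσ
    rw [mem_filter] at hσ
    ext k
    refine Fin.succAboveCases l ?_ (fun k => ?_) k
    · simp [hσ.2]
    · simp
  · intro τ _
    ext k; simp
  · intro σ hσ
    rw [mem_filter] at hσ
    unfold weight
    rw [Fin.prod_univ_succAbove _ l, hσ.2]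
    rfl

theorem exists_bethe_ne_zero {x : ι → ℂ} (hx : Function.Injective x) :
    ∀ {m : ℕ} {t : Fin m → ℂ}, Function.Injective t → (∀ l i, t l ≠ x i) →
      2 * m ≤ Fintype.card ι + 1 → ∃ I, bethe x t I ≠ 0 := by
  intro m
  induction m with
  | zero =>
    intro t _ _ _
    refine ⟨∅, ?_⟩
    have : enums 0 (∅ : Finset ι) = univ := by
      ext σ
      simp only [mem_enums, mem_univ, iff_true]
      exact ⟨Function.injective_of_subsingleton _, by simp⟩
    rw [bethe, this]
    simp [weight]
  | succ m ih =>
    intro t ht htx hm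
    by_contra! hall
    obtain ⟨J, hJ⟩ := ih (t := t ∘ Fin.succAbove 0) (ht.comp Fin.succAbove_right_injective)
      (fun l i => htx _ i) (by omega)
    have hJm : #J = m := by
      by_contra h; exact hJ (bethe_eq_zero_of_card_ne _ _ h)
    set c : Fin (m + 1) → ℂ := fun l => bethe x (t ∘ l.succAbove) J with hc
    set P : ℂ[X] := ∑ l, C (c l) * ∏ k ∈ univ.erase l, (X - C (t k)) with hP
    have hdeg : P.natDegree < #(univ \ J) := by
      have h1 : P.natDegree ≤ m := by
        refine natDegree_sum_le_of_forall_le _ _ fun l _ => ?_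
        refine (natDegree_C_mul_le _ _).trans ?_
        refine (natDegree_prod_le _ _).trans ?_
        simp
      rw [card_sdiff_of_subset (subset_univ J), hJm, card_univ]
      omega
    have hP0 : P = 0 := by
      classical
      refine Polynomial.eq_zero_of_natDegree_lt_card_of_eval_eq_zero' P ((univ \ J).image x) ?_
        (by rwa [card_image_of_injective _ hx])
      intro a ha
      obtain ⟨i, hi, rfl⟩ := mem_image.1 ha
      have h1 := bethe_insert x t (mem_sdiff.1 hi).2
      rw [hall] at h1
      have hne : ∀ l, x i - t l ≠ 0 := fun l => sub_ne_zero.2 (htx l i).symm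
      rw [hP, eval_finsetSum]
      have h2 : ∀ l, (C (c l) * ∏ k ∈ univ.erase l, (X - C (t k))).eval (x i) =
          -((∏ k, (x i - t k)) * ((t l - x i)⁻¹ * c l)) := by
        intro l
        rw [eval_mul, eval_C, eval_prod, ← mul_prod_erase univ (fun k => x i - t k) (mem_univ l)]
        have h3 : (t l - x i)⁻¹ = - (x i - t l)⁻¹ := by rw [← neg_sub, inv_neg]
        rw [h3]
        have := hne l
        simp only [eval_sub, eval_X, eval_C]
        field_simp
      rw [sum_congr rfl fun l _ => h2 l, sum_neg_distrib, ← mul_sum, ← h1]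
      simp
    have h4 : P.eval (t 0) = c 0 * ∏ k ∈ univ.erase 0, (t 0 - t k) := by
      rw [hP, eval_finsetSum, sum_eq_single 0]
      · simp [eval_prod]
      · intro l _ hl
        rw [eval_mul, eval_prod, prod_eq_zero (mem_erase.2 ⟨hl.symm, mem_univ 0⟩) (by simp),
          mul_zero]
      · simp
    rw [hP0, eval_zero] at h4
    have h5 : ∏ k ∈ univ.erase 0, (t 0 - t k) ≠ 0 := by
      rw [prod_ne_zero_iff]
      intro k hk
      exact sub_ne_zero.2 fun h => (mem_erase.1 hk).1 (ht h).symm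
    exact (mul_ne_zero hJ h5) h4.symm

/-- The singular vectors in the middle level. -/
def IsVac (m : ℕ) (ψ : Finset ι → ℂ) : Prop :=
  (∀ I, #I ≠ m → ψ I = 0) ∧ IsSing univ m ψ

lemma IsVac.sum_sub_swap {ψ : Finset ι → ℂ} (h : IsVac m ψ) (hm : Fintype.card ι = 2 * m) (i : ι)
    {I : Finset ι} (hI : #I = m) :
    ∑ j, (ψ I - ψ (I.map (Equiv.swap i j).toEmbedding)) = (m + 1) * ψ I := by
  have hm' : #(univ : Finset ι) = 2 * m := by rw [card_univ, hm]
  rw [sum_sub_distrib, sum_const, hm', nsmul_eq_mul, ← sum_sdiff (subset_univ I)]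
  by_cases hi : i ∈ I
  · rw [sum_congr rfl fun j hj => by rw [map_swap_of_mem_notMem hi (mem_sdiff.1 hj).2],
      sum_congr (s₁ := I) rfl fun j hj => by rw [map_swap_of_iff (iff_of_true hi hj)]]
    have h1 := h.2 (I.erase i) (subset_univ _) (by
      rw [card_erase_of_mem hi, hI]
      have : 0 < #I := card_pos.2 ⟨i, hi⟩
      omega)
    unfold addOne at h1
    have h2 : univ \ I.erase i = insert i (univ \ I) := by
      ext a; by_cases h : a = i
      · subst h; simp
      · simp [h]
    rw [h2, sum_insert (by simp [hi]), insert_erase hi] at h1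
    rw [sum_const, hI, nsmul_eq_mul]
    push_cast
    linear_combination (-1 : ℂ) * h1
  · rw [sum_congr rfl fun j hj => by rw [map_swap_of_iff (iff_of_false hi (mem_sdiff.1 hj).2)],
      sum_congr (s₁ := I) rfl fun j hj => by rw [map_swap_comm, map_swap_of_mem_notMem hj hi]]
    have h1 := h.2.removeOne_eq_zero hm' (K := insert i I) (subset_univ _)
      (by rw [card_insert_of_notMem hi, hI])
    unfold removeOne at h1
    rw [sum_insert hi, erase_insert hi] at h1
    have h3 : ∀ j ∈ I, ψ ((insert i I).erase j) = ψ (insert i (I.erase j)) := by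
      intro j hj
      rw [erase_insert_of_ne]
      rintro rfl; exact hi hj
    rw [sum_congr rfl h3] at h1
    rw [sum_const, card_sdiff_of_subset (subset_univ I), hI, nsmul_eq_mul, hm',
      Nat.cast_sub (by omega)]
    push_cast
    linear_combination (-1 : ℂ) * h1

lemma sum_mul_hamiltonian_gaudin {x : ι → ℝ} (hx : Function.Injective x)
    (hm : Fintype.card ι = 2 * m) (ψ : Finset ι → ℂ) {I : Finset ι} (hI : #I = m) :
    ∑ i, (x i : ℂ) * hamiltonian (gaudin x) i ψ I =
      (m ^ 2 + m) * ψ I - removeOne (addOne univ ψ) I := by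
  have h1 := sum_sum_swap univ ψ (subset_univ I)
  have hm' : #(univ : Finset ι) = 2 * m := by rw [card_univ, hm]
  have h2 : ∑ i, ∑ j, (x i : ℂ) * ((gaudin x i j : ℂ) *
        (ψ I - ψ (I.map (Equiv.swap i j).toEmbedding))) +
      ∑ i, ∑ j, (x i : ℂ) * ((gaudin x i j : ℂ) *
        (ψ I - ψ (I.map (Equiv.swap i j).toEmbedding))) =
      ∑ i, ∑ j, (ψ I - ψ (I.map (Equiv.swap i j).toEmbedding)) := by
    nth_rw 2 [sum_comm]
    rw [← sum_add_distrib]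
    refine sum_congr rfl fun i _ => ?_
    rw [← sum_add_distrib]
    refine sum_congr rfl fun j _ => ?_
    by_cases hij : i = j
    · subst hij; simp
    · have : (x i : ℂ) - x j ≠ 0 := by
        rw [sub_ne_zero]; exact_mod_cast fun h => hij (hx h)
      have h3 : (x j : ℂ) - x i ≠ 0 := by
        rw [sub_ne_zero]; exact_mod_cast fun h => hij (hx h).symm
      rw [map_swap_comm j i]
      simp only [gaudin, Complex.ofReal_inv, Complex.ofReal_sub]
      have h4 : ((x j : ℂ) - x i)⁻¹ = - ((x i : ℂ) - x j)⁻¹ := by rw [← neg_sub, inv_neg]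
      rw [h4]
      field_simp
      ring
  simp only [sum_sub_distrib, sum_const, nsmul_eq_mul, hm', h1, hI] at h2
  simp only [hamiltonian, mul_sum]
  push_cast at h2
  linear_combination (1 / 2 : ℂ) * h2

lemma sum_hamiltonian_gaudin (x : ι → ℝ) (ψ : Finset ι → ℂ) (I : Finset ι) :
    ∑ i, hamiltonian (gaudin x) i ψ I = 0 := by
  have h2 : ∑ i, hamiltonian (gaudin x) i ψ I = - ∑ i, hamiltonian (gaudin x) i ψ I := by
    simp only [hamiltonian]
    nth_rw 2 [sum_comm]
    rw [← sum_neg_distrib]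
    refine sum_congr rfl fun i _ => ?_
    rw [← sum_neg_distrib]
    refine sum_congr rfl fun j _ => ?_
    rw [map_swap_comm j i]
    simp only [gaudin]
    have h4 : (x j - x i)⁻¹ = - (x i - x j)⁻¹ := by rw [← neg_sub, inv_neg]
    rw [h4]
    push_cast
    ring
  exact self_eq_neg.1 h2

lemma isVac_of_removeOne_addOne {ψ : Finset ι → ℂ} (h0 : ∀ I, #I ≠ m → ψ I = 0)
    (h : ∀ I, #I = m → removeOne (addOne univ ψ) I = 0) : IsVac m ψ := by
  refine ⟨h0, fun J _ hJ => ?_⟩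
  subst hJ
  have h1 := sum_mul_removeOne univ #J (fun I => star (ψ I)) (addOne univ ψ)
  rw [sum_eq_zero, addOne_star] at h1
  · exact sum_normSq_eq_zero h1.symm J (mem_powersetCard.2 ⟨subset_univ _, rfl⟩)
  · intro K hK
    rw [h K (mem_powersetCard.1 hK).2, mul_zero]

lemma IsBetheRoot.sum_mul {x : ι → ℂ} {t : Fin m → ℂ} (ht : IsBetheRoot x t)
    (hm : Fintype.card ι = 2 * m) :
    ∑ i, x i * ∑ l, (x i - t l)⁻¹ = m ^ 2 + m := by
  obtain ⟨hinj, htx, hbae⟩ := ht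
  have h1 : ∑ i, x i * ∑ l, (x i - t l)⁻¹ = ∑ l, ∑ i, (1 - t l * (t l - x i)⁻¹) := by
    simp_rw [mul_sum]
    rw [sum_comm]
    refine sum_congr rfl fun l _ => sum_congr rfl fun i _ => ?_
    have h2 : t l - x i ≠ 0 := sub_ne_zero.2 (htx l i)
    have h4 : (x i - t l)⁻¹ = - (t l - x i)⁻¹ := by rw [← neg_sub, inv_neg]
    rw [h4]
    field_simp
    ring
  have h3 : ∑ l, ∑ k ∈ univ.erase l, t l * (2 * (t l - t k)⁻¹) = m * (m - 1) := by
    have e : ∀ l, ∑ k ∈ univ.erase l, t l * (2 * (t l - t k)⁻¹) =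
        ∑ k, t l * (2 * (t l - t k)⁻¹) := by
      intro l
      rw [← add_sum_erase univ _ (mem_univ l)]; simp
    have e2 : ∑ l, ∑ k, t l * (2 * (t l - t k)⁻¹) + ∑ l, ∑ k, t l * (2 * (t l - t k)⁻¹) =
        ∑ l : Fin m, ∑ k, (if k = l then (0 : ℂ) else 2) := by
      nth_rw 2 [sum_comm]
      rw [← sum_add_distrib]
      refine sum_congr rfl fun i _ => ?_
      rw [← sum_add_distrib]
      refine sum_congr rfl fun j _ => ?_
      by_cases hij : j = i
      · subst hij; simp
      · have h5 : t i - t j ≠ 0 := sub_ne_zero.2 fun h => hij (hinj h).symm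
        have h4 : (t j - t i)⁻¹ = - (t i - t j)⁻¹ := by rw [← neg_sub, inv_neg]
        rw [h4, if_neg hij]
        field_simp
        ring
    have e3 : ∀ l : Fin m, ∑ k, (if k = l then (0 : ℂ) else 2) = 2 * (m - 1) := by
      intro l
      rw [← add_sum_erase univ _ (mem_univ l), if_pos rfl,
        sum_congr rfl fun k hk => if_neg (mem_erase.1 hk).1]
      have : 0 < m := Fin.pos l
      simp [Nat.cast_sub this]
      ring
    rw [sum_congr rfl fun l _ => e l]
    rw [sum_congr rfl fun l _ => e3 l, sum_const, card_univ, Fintype.card_fin, nsmul_eq_mul] at e2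
    linear_combination (1 / 2 : ℂ) * e2
  rw [h1]
  simp only [sum_sub_distrib, sum_const, card_univ, hm, ← mul_sum, Fintype.card_fin, nsmul_eq_mul]
  simp only [← mul_sum] at h3
  simp only [mul_sum] at hbae h3
  have h5 : ∑ l, t l * ∑ i, (t l - x i)⁻¹ = m * (m - 1) := by
    rw [← h3]
    refine sum_congr rfl fun l _ => ?_
    rw [← hbae l, mul_sum]
  rw [h5]
  push_cast
  ring

lemma isVac_bethe {x : ι → ℝ} (hx : Function.Injective x) (hm : Fintype.card ι = 2 * m)
    {t : Fin m → ℂ} (ht : IsBetheRoot (fun i => (x i : ℂ)) t) :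
    IsVac m (bethe (fun i => (x i : ℂ)) t) := by
  refine isVac_of_removeOne_addOne (fun I hI => bethe_eq_zero_of_card_ne _ _ hI) fun I hI => ?_
  have h1 := sum_mul_hamiltonian_gaudin hx hm (bethe (fun i => (x i : ℂ)) t) hI
  have h2 := ht.sum_mul hm
  simp_rw [hamiltonian_bethe hx ht, ← mul_assoc] at h1
  rw [← sum_mul, h2] at h1
  linear_combination h1

/-- The sites and Bethe roots after the coordinate change `z ↦ 1 / (z - p)`. -/
lemma inv_sub_inv_inv {a b p : ℂ} (ha : a ≠ p) (hb : b ≠ p) (hab : a ≠ b) :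
    ((a - p)⁻¹ - (b - p)⁻¹)⁻¹ = (a - p) - (a - p) ^ 2 * (a - b)⁻¹ := by
  have h1 := sub_ne_zero.2 ha
  have h2 := sub_ne_zero.2 hb
  have h3 := sub_ne_zero.2 hab
  have h4 : b - a ≠ 0 := sub_ne_zero.2 hab.symm
  rw [inv_sub_inv h1 h2, inv_div, show b - p - (a - p) = -(a - b) by ring]
  field_simp
  ring

theorem hamiltonian_bethe_inv {x : ι → ℝ} (hx : Function.Injective x)
    (hm : Fintype.card ι = 2 * m) {p : ℝ} (hp : ∀ i, x i ≠ p) {t : Fin m → ℂ}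
    (ht : Function.Injective t) (htx : ∀ l i, t l ≠ x i) (htp : ∀ l, t l ≠ p)
    (hbae : ∀ k, ∑ l ∈ univ.erase k, 2 * (t k - t l)⁻¹ + 2 * (t k - p)⁻¹ =
      ∑ i, (t k - x i)⁻¹) :
    IsVac m (bethe (fun i => ((x i : ℂ) - p)⁻¹) (fun l => (t l - p)⁻¹)) ∧
    (∃ I, bethe (fun i => ((x i : ℂ) - p)⁻¹) (fun l => (t l - p)⁻¹) I ≠ 0) ∧
    ∀ i I, hamiltonian (gaudin x) i
        (bethe (fun i => ((x i : ℂ) - p)⁻¹) (fun l => (t l - p)⁻¹)) I =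
      (((x i : ℂ) - p)⁻¹ + ∑ l, ((x i : ℂ) - t l)⁻¹) *
        bethe (fun i => ((x i : ℂ) - p)⁻¹) (fun l => (t l - p)⁻¹) I := by
  set s : Fin m → ℂ := fun l => (t l - p)⁻¹ with hs
  set y : ι → ℝ := fun i => (x i - p)⁻¹ with hy
  have hxy : (fun i => ((x i : ℂ) - p)⁻¹) = fun i => (y i : ℂ) := by
    ext i; simp [hy]
  rw [hxy]
  have hpC : ∀ i, (x i : ℂ) ≠ p := fun i => by exact_mod_cast hp i
  have hxC : ∀ i j, i ≠ j → (x i : ℂ) ≠ x j := fun i j hij => by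
    exact_mod_cast fun h => hij (hx h)
  have hyinj : Function.Injective y := by
    intro i j h
    exact hx (sub_left_injective (inv_injective h))
  have hsinj : Function.Injective s := by
    intro i j h
    exact ht (sub_left_injective (inv_injective h))
  have hsy : ∀ l i, s l ≠ y i := by
    intro l i h
    have : (y i : ℂ) = ((x i : ℂ) - p)⁻¹ := by simp [hy]
    rw [this] at h
    exact htx l i (sub_left_injective (inv_injective h))
  have hroot : IsBetheRoot (fun i => (y i : ℂ)) s := by
    refine ⟨hsinj, hsy, fun k => ?_⟩
    have e1 : ∀ l ∈ univ.erase k, 2 * (s k - s l)⁻¹ =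
        2 * (t k - p) - (t k - p) ^ 2 * (2 * (t k - t l)⁻¹) := by
      intro l hl
      rw [hs, inv_sub_inv_inv (htp k) (htp l) fun h => (mem_erase.1 hl).1 (ht h).symm]
      ring
    have e2 : ∀ i, (s k - y i)⁻¹ = (t k - p) - (t k - p) ^ 2 * (t k - x i)⁻¹ := by
      intro i
      have : (y i : ℂ) = ((x i : ℂ) - p)⁻¹ := by simp [hy]
      rw [this, hs, inv_sub_inv_inv (htp k) (hpC i) (htx k i)]
    have e3 : ∑ i, ((t k - p) - (t k - p) ^ 2 * (t k - x i)⁻¹) =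
        2 * m * (t k - p) - (t k - p) ^ 2 * ∑ i, (t k - x i)⁻¹ := by
      rw [sum_sub_distrib, mul_sum]
      simp [hm, mul_sub]
    have e4 : ∑ l ∈ univ.erase k, (2 * (t k - p) - (t k - p) ^ 2 * (2 * (t k - t l)⁻¹)) =
        (m - 1) * (2 * (t k - p)) - (t k - p) ^ 2 * ∑ l ∈ univ.erase k, 2 * (t k - t l)⁻¹ := by
      have : 1 ≤ m := Fin.pos k
      rw [sum_sub_distrib, mul_sum]
      simp [Nat.cast_sub this]
    rw [sum_congr rfl e1, sum_congr rfl fun i _ => e2 i, e3, e4, ← hbae k]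
    have h0 : t k - p ≠ 0 := sub_ne_zero.2 (htp k)
    field_simp
    ring
  have hvac := isVac_bethe hyinj hm hroot
  refine ⟨hvac, exists_bethe_ne_zero (fun i j h => hyinj (by simpa using h)) hsinj hsy (by omega), ?_⟩
  intro i I
  set ψ := bethe (fun i => (y i : ℂ)) s with hψ
  by_cases hI : #I = m
  · have h1 := hamiltonian_bethe hyinj hroot i I
    rw [← hψ] at h1
    have h2 : hamiltonian (gaudin y) i ψ I =
        ((x i : ℂ) - p) * ((m + 1) * ψ I) - ((x i : ℂ) - p) ^ 2 * hamiltonian (gaudin x) i ψ I := by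
      rw [← hvac.sum_sub_swap hm i hI]
      simp only [hamiltonian, mul_sum]
      rw [← sum_sub_distrib]
      refine sum_congr rfl fun j _ => ?_
      by_cases hij : i = j
      · subst hij; simp
      · have e : (gaudin y i j : ℂ) = ((x i : ℂ) - p) - ((x i : ℂ) - p) ^ 2 * gaudin x i j := by
          have := inv_sub_inv_inv (hpC i) (hpC j) (hxC i j hij)
          simp only [gaudin, hy]
          push_cast
          exact this
        rw [e]; ring
    have h3 : ∑ l, ((y i : ℂ) - s l)⁻¹ =
        m * ((x i : ℂ) - p) - ((x i : ℂ) - p) ^ 2 * ∑ l, ((x i : ℂ) - t l)⁻¹ := by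
      have e : ∀ l, ((y i : ℂ) - s l)⁻¹ =
          ((x i : ℂ) - p) - ((x i : ℂ) - p) ^ 2 * ((x i : ℂ) - t l)⁻¹ := by
        intro l
        rw [← inv_sub_inv_inv (hpC i) (htp l) (htx l i).symm]
        simp [hy, hs]
      rw [sum_congr rfl fun l _ => e l, sum_sub_distrib, mul_sum]
      simp [mul_sub]
    rw [h2, h3] at h1
    have h0 : (x i : ℂ) - p ≠ 0 := sub_ne_zero.2 (hpC i)
    have h5 : ((x i : ℂ) - p) ^ 2 * hamiltonian (gaudin x) i ψ I =
      ((x i : ℂ) - p) ^ 2 * ((((x i : ℂ) - p)⁻¹ + ∑ l, ((x i : ℂ) - t l)⁻¹) * ψ I) := by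
      have e : ((x i : ℂ) - p) ^ 2 * ((((x i : ℂ) - p)⁻¹ + ∑ l, ((x i : ℂ) - t l)⁻¹) * ψ I) =
        (((x i : ℂ) - p) + ((x i : ℂ) - p) ^ 2 * ∑ l, ((x i : ℂ) - t l)⁻¹) * ψ I := by
        field_simp
      rw [e]
      linear_combination (-1 : ℂ) * h1
    exact mul_left_cancel₀ (pow_ne_zero 2 h0) h5
  · have h1 : ∀ J : Finset ι, #J ≠ m → ψ J = 0 := hvac.1
    rw [h1 I hI, mul_zero]
    unfold hamiltonian
    refine sum_eq_zero fun j _ => ?_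
    rw [h1 I hI, h1 _ (by rwa [card_map])]; simp

end Gaudin

namespace Gaudin

open Finset

lemma map_perm_mul {ι : Type*} (e f : Equiv.Perm ι) (I : Finset ι) :
    (I.map f.toEmbedding).map e.toEmbedding = I.map (e * f).toEmbedding := by
  rw [map_map]; rfl

lemma map_perm_one {ι : Type*} (I : Finset ι) :
    I.map (1 : Equiv.Perm ι).toEmbedding = I := map_refl

lemma swap_cycles {ι : Type*} [DecidableEq ι] {i j k : ι} (hij : i ≠ j) (hik : i ≠ k)
    (hjk : j ≠ k) :
    (Equiv.swap i k * Equiv.swap i j = Equiv.swap i j * Equiv.swap j k ∧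
      Equiv.swap j k * Equiv.swap i k = Equiv.swap i j * Equiv.swap j k) ∧
    (Equiv.swap i j * Equiv.swap i k = Equiv.swap j k * Equiv.swap i j ∧
      Equiv.swap i k * Equiv.swap j k = Equiv.swap j k * Equiv.swap i j) := by
  have h1 : Equiv.swap i k * Equiv.swap i j = Equiv.swap i j * Equiv.swap j k := by
    rw [Equiv.mul_swap_eq_swap_mul (Equiv.swap i j) j k, Equiv.swap_apply_right,
      Equiv.swap_apply_of_ne_of_ne hik.symm hjk.symm]
  have h2 : Equiv.swap j k * Equiv.swap i k = Equiv.swap i j * Equiv.swap j k := by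
    rw [Equiv.mul_swap_eq_swap_mul (Equiv.swap j k) i k, Equiv.swap_apply_right,
      Equiv.swap_apply_of_ne_of_ne hij hik]
  refine ⟨⟨h1, h2⟩, ?_, ?_⟩
  · simpa using congrArg (·⁻¹) h1
  · simpa using congrArg (·⁻¹) h2

variable {ι : Type*} [Fintype ι] [DecidableEq ι] {m : ℕ}

lemma hamiltonian_smul (A : ι → ι → ℝ) (i : ι) (c : ℂ) (ψ : Finset ι → ℂ) :
    hamiltonian A i (c • ψ) = c • hamiltonian A i ψ := by
  ext I
  simp only [hamiltonian, Pi.smul_apply, smul_eq_mul, mul_sum]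
  exact sum_congr rfl fun j _ => by ring

lemma hamiltonian_add (A : ι → ι → ℝ) (i : ι) (φ ψ : Finset ι → ℂ) :
    hamiltonian A i (φ + ψ) = hamiltonian A i φ + hamiltonian A i ψ := by
  ext I
  simp only [hamiltonian, Pi.add_apply, ← sum_add_distrib]
  exact sum_congr rfl fun j _ => by ring

lemma sum_star_mul_hamiltonian (A : ι → ι → ℝ) (i : ι) (φ ψ : Finset ι → ℂ) :
    ∑ I, star (φ I) * hamiltonian A i ψ I = ∑ I, star (hamiltonian A i φ I) * ψ I := by
  simp only [hamiltonian, mul_sum, star_sum, sum_mul]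
  rw [sum_comm]
  nth_rw 2 [sum_comm]
  refine sum_congr rfl fun j _ => ?_
  have h1 : ∑ I, star (φ (I.map (Equiv.swap i j).toEmbedding)) * ψ I =
      ∑ I, star (φ I) * ψ (I.map (Equiv.swap i j).toEmbedding) := by
    refine sum_bij' (fun I _ => I.map (Equiv.swap i j).toEmbedding)
      (fun I _ => I.map (Equiv.swap i j).toEmbedding) ?_ ?_ ?_ ?_ ?_
    · simp
    · simp
    · intro I _
      rw [map_perm_mul, Equiv.swap_mul_self, map_perm_one]
    · intro I _
      rw [map_perm_mul, Equiv.swap_mul_self, map_perm_one]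
    · intro I _
      rw [map_perm_mul, Equiv.swap_mul_self, map_perm_one]
  have h2 : ∀ I, star (φ I) * ((A i j : ℂ) * (ψ I - ψ (I.map (Equiv.swap i j).toEmbedding))) =
      A i j * (star (φ I) * ψ I) -
        A i j * (star (φ I) * ψ (I.map (Equiv.swap i j).toEmbedding)) := fun I => by ring
  have h3 : ∀ I, star ((A i j : ℂ) * (φ I - φ (I.map (Equiv.swap i j).toEmbedding))) * ψ I =
      A i j * (star (φ I) * ψ I) -
        A i j * (star (φ (I.map (Equiv.swap i j).toEmbedding)) * ψ I) := fun I => by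
    simp; ring
  rw [sum_congr rfl fun I _ => h2 I, sum_congr rfl fun I _ => h3 I, sum_sub_distrib,
    sum_sub_distrib, ← mul_sum, ← mul_sum, ← mul_sum, h1]

lemma addOne_map_perm (e : Equiv.Perm ι) (ψ : Finset ι → ℂ) (J : Finset ι) :
    addOne univ (fun I => ψ (I.map e.toEmbedding)) J = addOne univ ψ (J.map e.toEmbedding) := by
  unfold addOne
  refine sum_bij' (fun a _ => e a) (fun a _ => e.symm a) ?_ ?_ ?_ ?_ ?_
  · intro a ha; simpa using ha
  · intro a ha; simpa [Finset.mem_map_equiv] using ha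
  · intro a _; simp
  · intro a _; simp
  · intro a _; simp

lemma IsVac.hamiltonian {ψ : Finset ι → ℂ} (h : IsVac m ψ) (A : ι → ι → ℝ) (i : ι) :
    IsVac m (hamiltonian A i ψ) := by
  constructor
  · intro I hI
    unfold Gaudin.hamiltonian
    refine sum_eq_zero fun j _ => ?_
    rw [h.1 I hI, h.1 _ (by rwa [card_map])]; simp
  · intro J hJ hJm
    have h1 : addOne univ (Gaudin.hamiltonian A i ψ) J = ∑ j, (A i j : ℂ) *
        (addOne univ ψ J - addOne univ ψ (J.map (Equiv.swap i j).toEmbedding)) := by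
      simp_rw [← addOne_map_perm]
      unfold addOne Gaudin.hamiltonian
      rw [sum_comm]
      refine sum_congr rfl fun j _ => ?_
      rw [← mul_sum, sum_sub_distrib]
    rw [h1]
    refine sum_eq_zero fun j _ => ?_
    rw [h.2 J hJ hJm, h.2 _ (subset_univ _) (by rwa [card_map])]; simp

lemma gaudin_self (x : ι → ℝ) (i : ι) : gaudin x i i = 0 := by simp [gaudin]

lemma gaudin_symm (x : ι → ℝ) (i j : ι) : gaudin x j i = - gaudin x i j := by
  unfold gaudin; rw [← neg_sub, inv_neg]

lemma gaudin_mul_gaudin {x : ι → ℝ} (hx : Function.Injective x) {i j k : ι} (hij : i ≠ j)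
    (hik : i ≠ k) (hjk : j ≠ k) :
    gaudin x i j * gaudin x i k = gaudin x j k * (gaudin x i j - gaudin x i k) := by
  unfold gaudin
  have h1 : x i - x j ≠ 0 := sub_ne_zero.2 fun h => hij (hx h)
  have h2 : x i - x k ≠ 0 := sub_ne_zero.2 fun h => hik (hx h)
  have h3 : x j - x k ≠ 0 := sub_ne_zero.2 fun h => hjk (hx h)
  field_simp
  ring

theorem hamiltonian_gaudin_comm {x : ι → ℝ} (hx : Function.Injective x) (i j : ι)
    (ψ : Finset ι → ℂ) :
    hamiltonian (gaudin x) i (hamiltonian (gaudin x) j ψ) =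
      hamiltonian (gaudin x) j (hamiltonian (gaudin x) i ψ) := by
  by_cases hij : i = j
  · rw [hij]
  ext I
  set D : ι → ι → ℂ := fun k l => ψ (I.map (Equiv.swap j l * Equiv.swap i k).toEmbedding) -
    ψ (I.map (Equiv.swap i k * Equiv.swap j l).toEmbedding) with hD
  have key : hamiltonian (gaudin x) i (hamiltonian (gaudin x) j ψ) I -
      hamiltonian (gaudin x) j (hamiltonian (gaudin x) i ψ) I =
      ∑ k, ∑ l, (gaudin x i k : ℂ) * gaudin x j l * D k l := by
    have e1 : hamiltonian (gaudin x) j (hamiltonian (gaudin x) i ψ) I =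
        ∑ k, ∑ l, (gaudin x j l : ℂ) * ((gaudin x i k : ℂ) * (ψ I -
          ψ (I.map (Equiv.swap i k).toEmbedding)) - (gaudin x i k : ℂ) *
          (ψ (I.map (Equiv.swap j l).toEmbedding) -
          ψ ((I.map (Equiv.swap j l).toEmbedding).map (Equiv.swap i k).toEmbedding))) := by
      rw [sum_comm]
      simp only [hamiltonian, mul_sum, ← sum_sub_distrib]
    rw [e1]
    simp only [hamiltonian, mul_sum, ← sum_sub_distrib]
    refine sum_congr rfl fun k _ => sum_congr rfl fun l _ => ?_
    simp only [map_perm_mul, hD]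
    ring
  rw [← sub_eq_zero, key]
  have hD0 : ∀ k l, k ≠ j → l ≠ i → k ≠ l → D k l = 0 := by
    intro k l hkj hli hkl
    simp only [hD]
    rw [Equiv.mul_swap_eq_swap_mul (Equiv.swap j l) i k,
      Equiv.swap_apply_of_ne_of_ne hij (Ne.symm hli), Equiv.swap_apply_of_ne_of_ne hkj hkl, sub_self]
  set E : ι → ℂ := fun k => if k = i ∨ k = j then 0 else D j k with hE
  have hsplit : ∀ k l, (gaudin x i k : ℂ) * gaudin x j l * D k l =
      (if k = j then (gaudin x i j : ℂ) * gaudin x j l * E l else 0) +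
      ((if l = i then (gaudin x i k : ℂ) * gaudin x j i * E k else 0) -
      (if k = l then (gaudin x i k : ℂ) * gaudin x j k * E k else 0)) := by
    intro k l
    by_cases hki : k = i
    · subst hki
      by_cases hlk : k = l <;> simp [gaudin_self, hij, hE, hlk]
    by_cases hlj : l = j
    · subst hlj
      by_cases hlk : k = l <;> simp [gaudin_self, Ne.symm hij, hE, hlk]
    by_cases hkj : k = j
    · subst hkj
      by_cases hli : l = i
      · subst hli
        simp [hE, hki, D, Equiv.swap_comm k l]
      · simp [hE, hli, hlj, Ne.symm hlj]
    by_cases hli : l = i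
    · subst hli
      have : D k l = D j k := by
        simp only [hD]
        obtain ⟨⟨c1, c2⟩, c3, c4⟩ := swap_cycles hij (Ne.symm hki) (Ne.symm hkj)
        rw [Equiv.swap_comm j l, c1, c3]
      simp [hE, hkj, hki, this]
    by_cases hkl : k = l
    · subst hkl
      have : D k k = - D j k := by
        simp only [hD]
        obtain ⟨⟨c1, c2⟩, c3, c4⟩ := swap_cycles hij (Ne.symm hki) (Ne.symm hkj)
        rw [c2, c4]
        ring
      simp [hE, hkj, hki, this]
    · simp [hD0 k l hkj hli hkl, hkj, hli, hkl]
  simp only [hsplit, sum_add_distrib, sum_sub_distrib]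
  rw [sum_comm]
  simp only [sum_ite_eq, sum_ite_eq', mem_univ, if_true, ← sum_sub_distrib, ← sum_add_distrib]
  refine sum_eq_zero fun k _ => ?_
  by_cases h : k = i ∨ k = j
  · simp [hE, h]
  · push Not at h
    have h1 := gaudin_mul_gaudin hx h.1 h.2 hij
    rw [gaudin_symm x i k, gaudin_symm x j k] at h1
    have h2 : (gaudin x i k : ℂ) * gaudin x j k =
      gaudin x i j * (gaudin x j k - gaudin x i k) := by
      have : gaudin x i k * gaudin x j k =
        gaudin x i j * (gaudin x j k - gaudin x i k) := by linarith
      exact_mod_cast this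
    rw [h2, gaudin_symm x i j]
    push_cast
    ring

lemma swap_add_swap (ψ : Finset ι → ℂ) (I : Finset ι) {i j k : ι} (hij : i ≠ j) (hik : i ≠ k)
    (hjk : j ≠ k) :
    ψ (I.map (Equiv.swap i j * Equiv.swap i k).toEmbedding) +
      ψ (I.map (Equiv.swap i k * Equiv.swap i j).toEmbedding) =
    ψ (I.map (Equiv.swap i j).toEmbedding) + ψ (I.map (Equiv.swap i k).toEmbedding) +
      ψ (I.map (Equiv.swap j k).toEmbedding) - ψ I := by
  obtain ⟨⟨c1, c2⟩, c3, c4⟩ := swap_cycles hij hik hjk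
  have : (i ∈ I ↔ j ∈ I) ∨ (i ∈ I ↔ k ∈ I) ∨ (j ∈ I ↔ k ∈ I) := by tauto
  rcases this with h | h | h
  · have h1 := map_swap_of_iff h
    rw [c3, ← map_perm_mul, ← map_perm_mul, h1]; ring
  · have h1 := map_swap_of_iff h
    rw [c1, ← c2, ← map_perm_mul, ← map_perm_mul, h1]; ring
  · have h1 := map_swap_of_iff h
    rw [c1, c3, ← c4, ← map_perm_mul, ← map_perm_mul, h1]; ring

theorem hamiltonian_gaudin_sq {x : ι → ℝ} (hx : Function.Injective x) (i : ι)
    (ψ : Finset ι → ℂ) (I : Finset ι) :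
    hamiltonian (gaudin x) i (hamiltonian (gaudin x) i ψ) I =
      (∑ k, (gaudin x i k : ℂ)) * hamiltonian (gaudin x) i ψ I -
        ∑ j, (gaudin x i j : ℂ) * hamiltonian (gaudin x) j ψ I := by
  set R : ι → ι → ℂ := fun j k => ψ I - ψ (I.map (Equiv.swap j k).toEmbedding) with hR
  set B : ι → ι → ℂ := fun j k => ψ I - ψ (I.map (Equiv.swap i j).toEmbedding) -
    (ψ (I.map (Equiv.swap i k).toEmbedding) -
      ψ (I.map (Equiv.swap i j * Equiv.swap i k).toEmbedding)) with hB
  set a : ι → ι → ℂ := fun j k => (gaudin x j k : ℂ) with ha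
  have haij : ∀ j k, a k j = - a j k := fun j k => by simp only [ha]; rw [gaudin_symm]; simp
  have haii : ∀ j, a j j = 0 := fun j => by simp [ha, gaudin_self]
  have hRs : ∀ j k, R k j = R j k := fun j k => by simp only [hR]; rw [map_swap_comm]
  have hRR : ∀ j, R j j = 0 := fun j => by simp [hR]
  have e1 : hamiltonian (gaudin x) i (hamiltonian (gaudin x) i ψ) I =
      ∑ k, ∑ j, a i k * a i j * B j k := by
    simp only [hamiltonian, mul_sum, ← sum_sub_distrib]
    refine sum_congr rfl fun k _ => sum_congr rfl fun j _ => ?_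
    simp only [map_perm_mul, hB, ha]
    ring
  have e1' : hamiltonian (gaudin x) i (hamiltonian (gaudin x) i ψ) I =
      ∑ k, ∑ j, a i k * a i j * B k j := by
    rw [e1, sum_comm]
    refine sum_congr rfl fun k _ => sum_congr rfl fun j _ => by ring
  have e2 : ∀ j k, a i k * a i j * B j k + a i k * a i j * B k j =
      a i k * a i j * R i j + a i k * a i j * R i k - a j k * (a i j - a i k) * R j k +
      ((if k = j then 2 * (a i k * a i j * R i j) else 0) -
      (if j = i then a i k * a i k * R i k else 0) -
      (if k = i then a i j * a i j * R i j else 0)) := by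
    intro j k
    by_cases hj : j = i
    · subst hj
      by_cases hk : k = j
      · subst hk; simp [haii]
      · simp [haii, hk]
    by_cases hk : k = i
    · subst hk
      simp only [haii, hj, Ne.symm hj, if_false, if_true, hRs k j, haij k j]
      simp
    by_cases hkj : k = j
    · subst hkj
      simp only [hj, if_true, if_false, hRR, hR, hB, Equiv.swap_mul_self, sub_self]
      rw [map_perm_one]
      ring
    · have h1 := swap_add_swap ψ I (Ne.symm hj) (Ne.symm hk) (Ne.symm hkj)
      have h2 : a i j * a i k = a j k * (a i j - a i k) := by
        simp only [ha]
        exact_mod_cast gaudin_mul_gaudin hx (Ne.symm hj) (Ne.symm hk) (Ne.symm hkj)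
      simp only [hkj, hj, hk, if_false, ← h2, hR, hB]
      linear_combination a i k * a i j * h1
  have e3 : 2 * hamiltonian (gaudin x) i (hamiltonian (gaudin x) i ψ) I =
      ∑ k, ∑ j, (a i k * a i j * B j k + a i k * a i j * B k j) := by
    simp only [sum_add_distrib]
    rw [← e1, ← e1']; ring
  have e4 : ∀ j, hamiltonian (gaudin x) j ψ I = ∑ k, a j k * R j k := fun j => rfl
  have f1 : ∑ k, ∑ j, a i k * a i j * R i j = (∑ k, a i k) * ∑ j, a i j * R i j := by
    rw [sum_mul_sum]
    exact sum_congr rfl fun k _ => sum_congr rfl fun j _ => by ring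
  have f2 : ∑ k, ∑ j, a i k * a i j * R i k = (∑ k, a i k) * ∑ j, a i j * R i j := by
    rw [sum_mul_sum, sum_comm]
    exact sum_congr rfl fun k _ => sum_congr rfl fun j _ => by ring
  have f3 : ∑ k, ∑ j, a j k * (a i j - a i k) * R j k = 2 * ∑ j, a i j * ∑ k, a j k * R j k := by
    have g1 : ∀ k j, a j k * (a i j - a i k) * R j k =
      a i j * (a j k * R j k) + a i k * (a k j * R k j) := by
      intro k j
      rw [hRs j k, haij j k]; ring
    simp only [g1, sum_add_distrib, mul_sum]
    rw [sum_comm, ← two_mul, mul_sum]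
    refine sum_congr rfl fun k _ => ?_
    rw [mul_sum]
  rw [sum_congr rfl fun k _ => sum_congr rfl fun j _ => e2 j k] at e3
  simp only [sum_add_distrib, sum_sub_distrib, f1, f2, f3] at e3
  simp only [sum_ite_eq, sum_ite_eq', mem_univ, if_true] at e3
  rw [sum_comm (f := fun k j => if k = i then a i j * a i j * R i j else 0)] at e3
  simp only [sum_ite_eq, sum_ite_eq', mem_univ, if_true, ← mul_sum] at e3
  rw [e4 i]
  simp only [e4]
  linear_combination (1 / 2 : ℂ) * e3

/-- The relations satisfied by the joint eigenvalues of the Gaudin Hamiltonians on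
singular vectors of middle level. -/
structure IsSpectral (m : ℕ) (x q : ι → ℝ) : Prop where
  sum_eq : ∑ i, q i = 0
  sum_mul_eq : ∑ i, x i * q i = m ^ 2 + m
  sq_eq : ∀ i, q i ^ 2 = (∑ k, (x i - x k)⁻¹) * q i - ∑ j, (x i - x j)⁻¹ * q j

theorem isSpectral_of_eigenvector {x q : ι → ℝ} (hx : Function.Injective x)
    (hm : Fintype.card ι = 2 * m) {ψ : Finset ι → ℂ} (hψ : IsVac m ψ) (hne : ψ ≠ 0)
    (heig : ∀ i, hamiltonian (gaudin x) i ψ = (q i : ℂ) • ψ) : IsSpectral m x q := by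
  obtain ⟨I, hI⟩ : ∃ I, ψ I ≠ 0 := by
    by_contra! h; exact hne (funext h)
  have hIm : #I = m := by by_contra h; exact hI (hψ.1 I h)
  have heig' : ∀ i, hamiltonian (gaudin x) i ψ I = q i * ψ I := fun i => by rw [heig]; rfl
  refine ⟨?_, ?_, fun i => ?_⟩
  · have h1 := sum_hamiltonian_gaudin x ψ I
    simp only [heig', ← sum_mul] at h1
    have := (mul_eq_zero.1 h1).resolve_right hI
    exact_mod_cast this
  · have h1 := sum_mul_hamiltonian_gaudin hx hm ψ hIm
    rw [hψ.2.removeOne_addOne (subset_univ I) hIm, sub_zero] at h1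
    simp only [heig', ← sum_mul, ← mul_assoc] at h1
    have := mul_right_cancel₀ hI h1
    exact_mod_cast this
  · have h1 := hamiltonian_gaudin_sq hx i ψ I
    rw [heig i, hamiltonian_smul, heig i] at h1
    simp only [heig', Pi.smul_apply, smul_eq_mul, ← mul_assoc, ← sum_mul, ← sub_mul] at h1
    have := mul_right_cancel₀ hI h1
    rw [pow_two]
    unfold gaudin at this
    exact_mod_cast this

end Gaudin

namespace Gaudin

open Finset

section JucysMurphy

variable {α : Type*} [LinearOrder α]

/-- `ψ` is, at level `r` on `U`, a joint eigenvector of the Jucys-Murphy elements. -/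
def IsJM (U : Finset α) (r : ℕ) (γ : α → ℂ) (ψ : Finset α → ℂ) : Prop :=
  ∀ i ∈ U, ∀ I ⊆ U, #I = r →
    ∑ j ∈ U with j < i, ψ (I.map (Equiv.swap i j).toEmbedding) = γ i * ψ I

lemma IsSing.linear_comb {U : Finset α} {r : ℕ} {φ ψ : Finset α → ℂ} (h : IsSing U r φ)
    (h' : IsSing U r ψ) (a b : ℂ) : IsSing U r (fun I => a * φ I + b * ψ I) := by
  intro J hJ hr
  have h1 := h J hJ hr
  have h2 := h' J hJ hr
  unfold addOne at *
  rw [sum_add_distrib, ← mul_sum, ← mul_sum, h1, h2]; simp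

lemma IsJM.linear_comb {U : Finset α} {r : ℕ} {γ : α → ℂ} {φ ψ : Finset α → ℂ}
    (h : IsJM U r γ φ) (h' : IsJM U r γ ψ) (a b : ℂ) :
    IsJM U r γ (fun I => a * φ I + b * ψ I) := by
  intro i hi I hI hr
  have h1 := h i hi I hI hr
  have h2 := h' i hi I hI hr
  rw [sum_add_distrib, ← mul_sum, ← mul_sum, h1, h2]; ring

lemma IsJM.sum_eq {U : Finset α} {r : ℕ} {γ : α → ℂ} {ψ : Finset α → ℂ} (h : IsJM U r γ ψ)
    {I : Finset α} (hI : I ⊆ U) (hr : #I = r) :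
    ∑ i ∈ U, ∑ j ∈ U, ψ (I.map (Equiv.swap i j).toEmbedding) =
      (#U + 2 * ∑ i ∈ U, γ i) * ψ I := by
  have h1 : ∀ i ∈ U, ∑ j ∈ U, ψ (I.map (Equiv.swap i j).toEmbedding) =
      ψ I + γ i * ψ I + ∑ j ∈ U with i < j, ψ (I.map (Equiv.swap i j).toEmbedding) := by
    intro i hi
    rw [← h i hi I hI hr, ← add_sum_erase U _ hi,
      ← sum_filter_add_sum_filter_not (U.erase i) (fun j => j < i)]
    have e1 : (U.erase i).filter (fun j => j < i) = U.filter (fun j => j < i) := by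
      ext j; simp only [mem_filter, mem_erase]
      exact ⟨fun h => ⟨h.1.2, h.2⟩, fun h => ⟨⟨h.2.ne, h.1⟩, h.2⟩⟩
    have e2 : (U.erase i).filter (fun j => ¬ j < i) = U.filter (fun j => i < j) := by
      ext j; simp only [mem_filter, mem_erase, not_lt]
      exact ⟨fun h => ⟨h.1.2, lt_of_le_of_ne h.2 h.1.1.symm⟩, fun h => ⟨⟨h.2.ne', h.1⟩, h.2.le⟩⟩
    have e3 : I.map (Equiv.swap i i).toEmbedding = I := by
      rw [Equiv.swap_self]; exact map_refl
    rw [e1, e2, e3]; ring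
  have h2 : ∑ i ∈ U, ∑ j ∈ U with i < j, ψ (I.map (Equiv.swap i j).toEmbedding) =
      ∑ i ∈ U, γ i * ψ I := by
    simp_rw [sum_filter]
    rw [sum_comm]
    refine sum_congr rfl fun i hi => ?_
    rw [← h i hi I hI hr, sum_filter]
    refine sum_congr rfl fun j _ => ?_
    rw [map_swap_comm]
  rw [sum_congr rfl h1, sum_add_distrib, sum_add_distrib, h2, sum_const, ← sum_mul, nsmul_eq_mul]
  ring

lemma IsJM.casimir {U : Finset α} {r : ℕ} {γ : α → ℂ} {ψ : Finset α → ℂ} (h : IsJM U r γ ψ)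
    (hs : IsSing U r ψ) (hne : ∃ I ⊆ U, #I = r ∧ ψ I ≠ 0) :
    (#U + 2 * ∑ i ∈ U, γ i : ℂ) = (r : ℂ) ^ 2 + ((#U : ℂ) - r) ^ 2 - 2 * r := by
  obtain ⟨I, hI, hr, h0⟩ := hne
  have h1 := h.sum_eq hI hr
  rw [sum_sum_swap U ψ hI, hs.removeOne_addOne hI hr, hr] at h1
  refine mul_right_cancel₀ h0 ?_
  rw [← h1]; ring

lemma IsJM.restrict {U : Finset α} {κ : α} (hκ : ∀ u ∈ U, u < κ) {r : ℕ} {γ : α → ℂ}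
    {ψ : Finset α → ℂ} (h : IsJM (insert κ U) r γ ψ) : IsJM U r γ ψ := by
  intro i hi I hI hr
  rw [← h i (mem_insert_of_mem hi) I (hI.trans (subset_insert _ _)) hr, filter_insert,
    if_neg (hκ i hi).not_gt]

lemma IsJM.restrict_insert {U : Finset α} {κ : α} (hκ : ∀ u ∈ U, u < κ) {r : ℕ} {γ : α → ℂ}
    {ψ : Finset α → ℂ} (h : IsJM (insert κ U) (r + 1) γ ψ) :
    IsJM U r γ (fun I => ψ (insert κ I)) := by
  intro i hi I hI hr
  have hκU : κ ∉ U := fun h => (hκ κ h).ne rfl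
  have h1 := h i (mem_insert_of_mem hi) (insert κ I) (insert_subset_insert _ hI)
    (by rw [card_insert_of_notMem (fun h => hκU (hI h)), hr])
  rw [filter_insert, if_neg (hκ i hi).not_gt] at h1
  rw [← h1]
  refine sum_congr rfl fun j hj => ?_
  rw [map_insert]
  have hj' := (mem_filter.1 hj).1
  have e : (Equiv.swap i j).toEmbedding κ = κ :=
    Equiv.swap_apply_of_ne_of_ne (hκ i hi).ne' (hκ j hj').ne'
  rw [e]

lemma addOne_insert {U : Finset α} {κ : α} (hκ : κ ∉ U) (ψ : Finset α → ℂ) {J : Finset α}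
    (hJ : J ⊆ U) : addOne (insert κ U) ψ J = ψ (insert κ J) + addOne U ψ J := by
  unfold addOne
  rw [insert_sdiff_of_notMem _ (fun h => hκ (hJ h)), sum_insert (by simp [hκ])]

lemma IsSing.restrict_insert {U : Finset α} {κ : α} (hκ : κ ∉ U) {r : ℕ} {ψ : Finset α → ℂ}
    (h : IsSing (insert κ U) (r + 1) ψ) : IsSing U r (fun I => ψ (insert κ I)) := by
  intro J hJ hr
  have h1 := h (insert κ J) (insert_subset_insert _ hJ)
    (by rw [card_insert_of_notMem (fun h => hκ (hJ h)), hr])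
  rw [← h1]
  unfold addOne
  have e : insert κ U \ insert κ J = U \ J := by
    ext a
    simp only [mem_sdiff, mem_insert, not_or]
    constructor
    · rintro ⟨h1 | h1, h2, h3⟩
      · exact absurd h1 h2
      · exact ⟨h1, h3⟩
    · rintro ⟨h1, h2⟩
      exact ⟨Or.inr h1, fun h => hκ (h ▸ h1), h2⟩
  rw [e]
  refine sum_congr rfl fun j _ => ?_
  change ψ (insert κ (insert j J)) = _
  rw [Finset.insert_comm]

lemma IsSing.restrict {U : Finset α} {κ : α} (hκ : κ ∉ U) {r : ℕ} {ψ : Finset α → ℂ}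
    (h : IsSing (insert κ U) (r + 1) ψ) (hb : ∀ J ⊆ U, #J = r → ψ (insert κ J) = 0) :
    IsSing U (r + 1) ψ := by
  intro J hJ hr
  have h1 := h J (hJ.trans (subset_insert _ _)) hr
  rwa [addOne_insert hκ ψ hJ, hb J hJ (by omega), zero_add] at h1

/-- Joint eigenspaces of the Jucys-Murphy elements on singular vectors are lines. -/
theorem IsJM.exists_linear_comb (U : Finset α) : ∀ (r : ℕ) (γ : α → ℂ) (φ ψ : Finset α → ℂ),
    IsSing U r φ → IsSing U r ψ → IsJM U r γ φ → IsJM U r γ ψ →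
    ∃ a b : ℂ, (a ≠ 0 ∨ b ≠ 0) ∧ ∀ I ⊆ U, #I = r → a * φ I + b * ψ I = 0 := by
  have zero_level : ∀ φ ψ : Finset α → ℂ, ∃ a b : ℂ, (a ≠ 0 ∨ b ≠ 0) ∧
      a * φ ∅ + b * ψ ∅ = 0 := by
    intro φ ψ
    by_cases h : φ ∅ = 0
    · exact ⟨1, 0, by simp, by simp [h]⟩
    · exact ⟨ψ ∅, -φ ∅, by simp [h], by ring⟩
  induction U using Finset.induction_on_max with
  | empty =>
    intro r γ φ ψ _ _ _ _
    obtain ⟨a, b, h1, h2⟩ := zero_level φ ψ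
    refine ⟨a, b, h1, fun I hI _ => ?_⟩
    rwa [subset_empty.1 hI]
  | insert κ U hκ ih =>
    intro r γ φ ψ hφ hψ jφ jψ
    have hκU : κ ∉ U := fun h => (hκ κ h).ne rfl
    obtain _ | s := r
    · obtain ⟨a, b, h1, h2⟩ := zero_level φ ψ
      refine ⟨a, b, h1, fun I _ hI => ?_⟩
      rwa [card_eq_zero.1 hI]
    have split : ∀ χ : Finset α → ℂ, (∀ J ⊆ U, #J = s → χ (insert κ J) = 0) →
        (∀ J ⊆ U, #J = s + 1 → χ J = 0) → ∀ I ⊆ insert κ U, #I = s + 1 → χ I = 0 := by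
      intro χ h1 h2 I hI hc
      by_cases hk : κ ∈ I
      · have h3 := h1 (I.erase κ) (by rwa [← subset_insert_iff]) (by
          rw [card_erase_of_mem hk, hc]; rfl)
        rwa [insert_erase hk] at h3
      · exact h2 I ((subset_insert_iff_of_notMem hk).1 hI) hc
    by_cases hb : (∀ J ⊆ U, #J = s → φ (insert κ J) = 0) ∧
        (∀ J ⊆ U, #J = s → ψ (insert κ J) = 0)
    · obtain ⟨a, b, h1, h2⟩ := ih (s + 1) γ φ ψ (hφ.restrict hκU hb.1) (hψ.restrict hκU hb.2)
        (jφ.restrict hκ) (jψ.restrict hκ)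
      refine ⟨a, b, h1, split _ ?_ h2⟩
      intro J hJ hc
      simp [hb.1 J hJ hc, hb.2 J hJ hc]
    · have hval : (#U + 2 * ∑ i ∈ U, γ i : ℂ) = (s : ℂ) ^ 2 + ((#U : ℂ) - s) ^ 2 - 2 * s := by
        rw [not_and_or] at hb
        push Not at hb
        obtain hb | hb := hb
        · exact (jφ.restrict_insert hκ).casimir (hφ.restrict_insert hκU) hb
        · exact (jψ.restrict_insert hκ).casimir (hψ.restrict_insert hκU) hb
      obtain ⟨a, b, h1, h2⟩ := ih s γ _ _ (hφ.restrict_insert hκU) (hψ.restrict_insert hκU)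
        (jφ.restrict_insert hκ) (jψ.restrict_insert hκ)
      refine ⟨a, b, h1, split (fun I => a * φ I + b * ψ I) h2 ?_⟩
      by_contra! hne
      have hs := (hφ.linear_comb hψ a b).restrict hκU h2
      have hc := ((jφ.linear_comb jψ a b).restrict hκ).casimir hs hne
      have hle := hs.two_mul_le hne
      rw [hval] at hc
      have hc' : (s : ℝ) ^ 2 + ((#U : ℝ) - s) ^ 2 - 2 * s =
        ((s + 1 : ℕ) : ℝ) ^ 2 + ((#U : ℝ) - (s + 1 : ℕ)) ^ 2 - 2 * (s + 1 : ℕ) := by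
        exact_mod_cast hc
      have hle' : 2 * ((s : ℝ) + 1) ≤ #U := by exact_mod_cast hle
      push_cast at hc'
      nlinarith

end JucysMurphy

end Gaudin

namespace Gaudin

open Finset

section Ode

variable {ι K : Type*} [Fintype ι] [DecidableEq ι] [Field K]

/-- The polynomial with simple zeros at the points `x i`. -/
noncomputable def critPoly (x : ι → K) : K[X] := Lagrange.nodal univ x

/-- The polynomial of degree less than the number of nodes with the value
`q i * (critPoly x)'` at each node. -/
noncomputable def potential (x q : ι → K) : K[X] :=
  ∑ i, C (q i) * ∏ j ∈ univ.erase i, (X - C (x j))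

/-- The second order operator attached to the nodes `x` and residues `q`. -/
noncomputable def ode (x q : ι → K) (y : K[X]) : K[X] :=
  critPoly x * derivative (derivative y) - derivative (critPoly x) * derivative y +
    potential x q * y

lemma critPoly_monic (x : ι → K) : (critPoly x).Monic := Lagrange.nodal_monic

lemma natDegree_critPoly (x : ι → K) : (critPoly x).natDegree = Fintype.card ι :=
  Lagrange.natDegree_nodal

lemma eval_critPoly_node (x : ι → K) (i : ι) : (critPoly x).eval (x i) = 0 :=
  Lagrange.eval_nodal_at_node (mem_univ i)

lemma eval_critPoly_eq_zero {x : ι → K} {z : K} : (critPoly x).eval z = 0 ↔ ∃ i, z = x i := by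
  rw [critPoly, Lagrange.eval_nodal, prod_eq_zero_iff]
  simp [sub_eq_zero]

lemma eval_derivative_critPoly (x : ι → K) (i : ι) :
    (derivative (critPoly x)).eval (x i) = ∏ j ∈ univ.erase i, (x i - x j) := by
  rw [critPoly, Lagrange.eval_nodal_derivative_eval_node_eq (mem_univ i), Lagrange.eval_nodal]

lemma eval_derivative_critPoly_ne_zero {x : ι → K} (hx : Function.Injective x) (i : ι) :
    (derivative (critPoly x)).eval (x i) ≠ 0 := by
  rw [eval_derivative_critPoly]
  refine prod_ne_zero_iff.2 fun j hj => ?_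
  rw [mem_erase] at hj
  exact sub_ne_zero.2 fun h => hj.1 (hx h).symm

lemma eval_potential (x q : ι → K) (i : ι) :
    (potential x q).eval (x i) = q i * (derivative (critPoly x)).eval (x i) := by
  rw [eval_derivative_critPoly, potential, eval_finsetSum, sum_eq_single i]
  · simp [eval_prod]
  · intro j _ hj
    rw [eval_mul, eval_prod, prod_eq_zero (i := i)]
    · simp
    · simp [hj.symm]
    · simp
  · simp

lemma degree_potential_lt (x q : ι → K) : (potential x q).degree < Fintype.card ι := by
  refine (degree_sum_le _ _).trans_lt ?_
  rw [Finset.sup_lt_iff (by exact WithBot.bot_lt_coe _)]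
  intro i _
  refine (degree_mul_le _ _).trans_lt ?_
  refine (add_le_add_left degree_C_le _).trans_lt ?_
  rw [zero_add]
  have h : (∏ j ∈ univ.erase i, (X - C (x j)) : K[X]) = Lagrange.nodal (univ.erase i) x := rfl
  rw [h, Lagrange.degree_nodal, card_erase_of_mem (mem_univ i), card_univ]
  have : 0 < Fintype.card ι := Fintype.card_pos_iff.2 ⟨i⟩
  exact_mod_cast Nat.sub_lt this one_pos

lemma eq_potential {x : ι → K} (hx : Function.Injective x) {P : K[X]}
    (hP : P.degree < Fintype.card ι) :
    P = potential x (fun i => P.eval (x i) / (derivative (critPoly x)).eval (x i)) := by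
  refine eq_of_degrees_lt_of_eval_index_eq univ hx.injOn hP (degree_potential_lt _ _) ?_
  intro i _
  rw [eval_potential, div_mul_cancel₀ _ (eval_derivative_critPoly_ne_zero hx i)]

lemma critPoly_dvd_of_eval {x : ι → K} (hx : Function.Injective x) {P : K[X]}
    (hP : ∀ i, P.eval (x i) = 0) : critPoly x ∣ P := by
  rw [critPoly, Lagrange.nodal_eq]
  refine Finset.prod_dvd_of_coprime ?_ fun i _ => dvd_iff_isRoot.2 (hP i)
  intro i _ j _ hij
  exact pairwise_coprime_X_sub_C hx hij

lemma isCoprime_critPoly {x : ι → K} (hx : Function.Injective x) :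
    IsCoprime (critPoly x) (derivative (critPoly x)) :=
  separable_prod_X_sub_C_iff.2 hx

lemma ode_C_mul (x q : ι → K) (c : K) (y : K[X]) : ode x q (C c * y) = C c * ode x q y := by
  unfold ode; simp only [derivative_mul, derivative_C, zero_mul, zero_add]; ring

lemma ode_add (x q : ι → K) (y z : K[X]) : ode x q (y + z) = ode x q y + ode x q z := by
  unfold ode; simp only [derivative_add]; ring

lemma ode_sub (x q : ι → K) (y z : K[X]) : ode x q (y - z) = ode x q y - ode x q z := by
  unfold ode; simp only [derivative_sub]; ring

/-- The residue at a node is the logarithmic derivative of a solution. -/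
lemma ode_eval_node {x q : ι → K} (hx : Function.Injective x) {y : K[X]} (hy : ode x q y = 0)
    (i : ι) : (derivative y).eval (x i) = q i * y.eval (x i) := by
  have h := congrArg (eval (x i)) hy
  simp only [ode, eval_add, eval_sub, eval_mul, eval_critPoly_node, eval_potential, eval_zero] at h
  refine mul_left_cancel₀ (eval_derivative_critPoly_ne_zero hx i) ?_
  linear_combination -h

variable [CharZero K]

/-- The wronskian of two solutions is a constant multiple of the nodal polynomial. -/
lemma exists_wronskian_eq {x q : ι → K} (hx : Function.Injective x) {y z : K[X]}
    (hy : ode x q y = 0) (hz : ode x q z = 0) : ∃ c : K, wronskian y z = C c * critPoly x := by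
  have h1 : critPoly x * derivative (wronskian y z) =
      derivative (critPoly x) * wronskian y z := by
    unfold ode at hy hz
    simp only [wronskian, derivative_sub, derivative_mul]
    linear_combination y * hz - z * hy
  obtain ⟨v, hv⟩ : critPoly x ∣ wronskian y z :=
    (isCoprime_critPoly hx).dvd_of_dvd_mul_left ⟨_, h1.symm⟩
  have h2 : derivative v = 0 := by
    rw [hv] at h1
    have h0 : critPoly x ≠ 0 := (critPoly_monic x).ne_zero
    refine mul_left_cancel₀ (mul_ne_zero h0 h0) ?_
    rw [derivative_mul] at h1
    linear_combination h1
  have h3 := eq_C_of_natDegree_eq_zero (derivative_eq_zero.1 h2)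
  exact ⟨v.coeff 0, by rw [hv, ← h3]; ring⟩

/-- Two solutions with nonzero wronskian span all solutions. -/
lemma exists_eq_linear_comb {x q : ι → K} (hx : Function.Injective x) {f g y : K[X]} {c : K}
    (hc : c ≠ 0) (hw : wronskian f g = C c * critPoly x) (hf : ode x q f = 0)
    (hg : ode x q g = 0) (hy : ode x q y = 0) : ∃ a b : K, y = C a * f + C b * g := by
  obtain ⟨c1, h1⟩ := exists_wronskian_eq hx hy hg
  obtain ⟨c2, h2⟩ := exists_wronskian_eq hx hy hf
  refine ⟨c1 / c, -c2 / c, ?_⟩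
  have h0 : critPoly x ≠ 0 := (critPoly_monic x).ne_zero
  have hc' : (C c : K[X]) ≠ 0 := C_ne_zero.2 hc
  refine mul_left_cancel₀ (mul_ne_zero hc' h0) ?_
  have e1 : (C c : K[X]) * C (c1 / c) = C c1 := by rw [← C_mul]; congr 1; field_simp
  have e2 : (C c : K[X]) * C (-c2 / c) = -C c2 := by rw [← C_mul, ← C_neg]; congr 1; field_simp
  simp only [wronskian] at h1 h2 hw
  linear_combination (-y) * hw + f * h1 - g * h2 - critPoly x * f * e1 - critPoly x * g * e2

/-- A pair of polynomials whose wronskian is a multiple of the nodal polynomial solves the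
equation for suitable residues. -/
lemma exists_ode_of_wronskian {x : ι → K} (hx : Function.Injective x) {m : ℕ} (hm0 : 1 ≤ m)
    (hm : Fintype.card ι = 2 * m) {f g : K[X]} (hf : f.natDegree ≤ m + 1)
    (hg : g.natDegree ≤ m + 1) {c : K} (hc : c ≠ 0) (hw : wronskian f g = C c * critPoly x) :
    ∃ q : ι → K, ode x q f = 0 ∧ ode x q g = 0 := by
  set P : K[X] := C c⁻¹ * (derivative f * derivative (derivative g) -
    derivative (derivative f) * derivative g) with hP
  have d1 : ∀ f : K[X], f.natDegree ≤ m + 1 → (derivative f).natDegree ≤ m := fun f hf =>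
    (natDegree_derivative_le f).trans (by omega)
  have d2 : ∀ f : K[X], f.natDegree ≤ m + 1 → (derivative (derivative f)).natDegree ≤ m - 1 :=
    fun f hf => (natDegree_derivative_le _).trans (by have := d1 f hf; omega)
  have hdeg : P.natDegree < Fintype.card ι := by
    refine (natDegree_C_mul_le _ _).trans_lt ?_
    refine (natDegree_sub_le _ _).trans_lt (max_lt ?_ ?_)
    · refine natDegree_mul_le.trans_lt ?_
      have := d1 f hf; have := d2 g hg; omega
    · refine natDegree_mul_le.trans_lt ?_
      have := d1 g hg; have := d2 f hf; omega
  have hdeg' : P.degree < Fintype.card ι := by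
    by_cases h0 : P = 0
    · rw [h0, degree_zero]; exact WithBot.bot_lt_coe _
    · exact (natDegree_lt_iff_degree_lt h0).1 hdeg
  have hw' := congrArg derivative hw
  simp only [wronskian, derivative_sub, derivative_mul, derivative_C] at hw' hw
  have hc' : (C c : K[X]) ≠ 0 := C_ne_zero.2 hc
  have e1 : (C c : K[X]) * C c⁻¹ = 1 := by rw [← C_mul, mul_inv_cancel₀ hc, C_1]
  have hQ := eq_potential hx hdeg'
  refine ⟨fun i => P.eval (x i) / (derivative (critPoly x)).eval (x i), ?_, ?_⟩
  · unfold ode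
    rw [← hQ]
    refine mul_left_cancel₀ hc' ?_
    rw [hP]
    linear_combination (-derivative (derivative f)) * hw + derivative f * hw' +
      f * (derivative f * derivative (derivative g) -
        derivative (derivative f) * derivative g) * e1
  · unfold ode
    rw [← hQ]
    refine mul_left_cancel₀ hc' ?_
    rw [hP]
    linear_combination (-derivative (derivative g)) * hw + derivative g * hw' +
      g * (derivative f * derivative (derivative g) -
        derivative (derivative f) * derivative g) * e1

/-- The solutions determine the residues. -/
lemma residues_unique {x q q' : ι → K} (hx : Function.Injective x) {f g : K[X]} {c : K}
    (hc : c ≠ 0) (hw : wronskian f g = C c * critPoly x) (hf : ode x q f = 0)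
    (hg : ode x q g = 0) (hf' : ode x q' f = 0) (hg' : ode x q' g = 0) : q = q' := by
  ext i
  by_contra hne
  have h0 : ∀ y : K[X], ode x q y = 0 → ode x q' y = 0 → y.eval (x i) = 0 := by
    intro y h1 h2
    have h3 := (ode_eval_node hx h1 i).symm.trans (ode_eval_node hx h2 i)
    by_contra h4
    exact hne (mul_right_cancel₀ h4 h3)
  have hw' := congrArg (fun P => eval (x i) (derivative P)) hw
  simp only [wronskian, derivative_sub, derivative_mul, derivative_C, eval_sub, eval_add, eval_mul,
    h0 f hf hf', h0 g hg hg', eval_C, eval_zero, ode_eval_node hx hf, ode_eval_node hx hg] at hw'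
  simp only [zero_mul, mul_zero, add_zero, sub_self, zero_add] at hw'
  exact mul_ne_zero hc (eval_derivative_critPoly_ne_zero hx i) hw'.symm

lemma eval_derivative_prod_X_sub_C {κ : Type*} [DecidableEq κ] (s : Finset κ) (t : κ → K) {z : K}
    (hz : ∀ l ∈ s, z ≠ t l) :
    (derivative (∏ l ∈ s, (X - C (t l)))).eval z =
      (∏ l ∈ s, (z - t l)) * ∑ l ∈ s, (z - t l)⁻¹ := by
  induction s using Finset.induction_on with
  | empty => simp
  | insert a s ha ih =>
    rw [prod_insert ha, derivative_mul, eval_add, eval_mul, eval_mul,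
      ih fun l hl => hz l (mem_insert_of_mem hl), prod_insert ha, sum_insert ha]
    have : z - t a ≠ 0 := sub_ne_zero.2 (hz a (mem_insert_self _ _))
    simp only [derivative_sub, derivative_X, derivative_C, sub_zero, eval_one, eval_prod, eval_sub,
      eval_X, eval_C]
    field_simp

lemma eval_derivative_critPoly_of_ne {x : ι → K} {z : K} (hz : ∀ i, z ≠ x i) :
    (derivative (critPoly x)).eval z = (critPoly x).eval z * ∑ i, (z - x i)⁻¹ := by
  rw [critPoly, Lagrange.eval_nodal, Lagrange.nodal_eq,
    eval_derivative_prod_X_sub_C univ x fun i _ => hz i]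

/-- Bethe equations for the simple zeros of a solution. -/
lemma bethe_of_ode {x q : ι → K} {m : ℕ} {h : K[X]} (hh : ode x q h = 0)
    {κ p : K} (hκ : κ ≠ 0) {t : Fin m → K} (ht : Function.Injective t)
    (htx : ∀ l i, t l ≠ x i) (htp : ∀ l, t l ≠ p)
    (hh' : h = C κ * ((X - C p) * ∏ l, (X - C (t l)))) (k : Fin m) :
    ∑ l ∈ univ.erase k, 2 * (t k - t l)⁻¹ + 2 * (t k - p)⁻¹ = ∑ i, (t k - x i)⁻¹ := by
  set R : K[X] := (X - C p) * ∏ l ∈ univ.erase k, (X - C (t l)) with hR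
  have h1 : h = C κ * ((X - C (t k)) * R) := by
    rw [hh', hR, ← mul_prod_erase univ _ (mem_univ k)]; ring
  have hk : ∀ l ∈ univ.erase k, t k ≠ t l := fun l hl e => (mem_erase.1 hl).1 (ht e).symm
  have hR0 : R.eval (t k) ≠ 0 := by
    rw [hR, eval_mul, eval_prod]
    refine mul_ne_zero ?_ (prod_ne_zero_iff.2 fun l hl => ?_)
    · simpa [sub_eq_zero] using htp k
    · simpa [sub_eq_zero] using hk l hl
  have hR1 : (derivative R).eval (t k) =
      R.eval (t k) * ((t k - p)⁻¹ + ∑ l ∈ univ.erase k, (t k - t l)⁻¹) := by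
    rw [hR, derivative_mul, eval_add, eval_mul, eval_mul, eval_derivative_prod_X_sub_C _ _ hk]
    have : t k - p ≠ 0 := sub_ne_zero.2 (htp k)
    simp only [derivative_sub, derivative_X, derivative_C, sub_zero, eval_one, eval_prod, eval_sub,
      eval_X, eval_C, eval_mul]
    field_simp
  have h2 := congrArg (eval (t k)) hh
  simp only [ode, h1, derivative_mul, derivative_sub, derivative_X, derivative_C, eval_add,
    eval_sub, eval_mul, eval_X, eval_C, eval_zero, sub_self, eval_one, derivative_one,
    derivative_add, derivative_zero, eval_derivative_critPoly_of_ne (htx k), hR1] at h2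
  have hW : (critPoly x).eval (t k) ≠ 0 := by
    rw [Ne, eval_critPoly_eq_zero]; push Not; exact htx k
  have h3 : κ * R.eval (t k) * (critPoly x).eval (t k) *
      (2 * ((t k - p)⁻¹ + ∑ l ∈ univ.erase k, (t k - t l)⁻¹)) =
      κ * R.eval (t k) * (critPoly x).eval (t k) * ∑ i, (t k - x i)⁻¹ := by
    linear_combination h2
  have h4 := mul_left_cancel₀ (mul_ne_zero (mul_ne_zero hκ hR0) hW) h3
  rw [← h4, ← mul_sum]; ring

/-- Residues in terms of the zeros of a solution. -/
lemma residue_eq_of_ode {x q : ι → K} (hx : Function.Injective x) {m : ℕ} {h : K[X]}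
    (hh : ode x q h = 0) {κ p : K} (hκ : κ ≠ 0) {t : Fin m → K}
    (htx : ∀ l i, t l ≠ x i) (hpx : ∀ i, x i ≠ p)
    (hh' : h = C κ * ((X - C p) * ∏ l, (X - C (t l)))) (i : ι) :
    q i = (x i - p)⁻¹ + ∑ l, (x i - t l)⁻¹ := by
  have h1 := ode_eval_node hx hh i
  have hp : x i - p ≠ 0 := sub_ne_zero.2 (hpx i)
  have hP : ∏ l, (x i - t l) ≠ 0 := prod_ne_zero_iff.2 fun l _ => sub_ne_zero.2 (htx l i).symm
  rw [hh', derivative_mul, derivative_mul, eval_add, eval_mul, eval_mul, eval_mul, eval_add,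
    eval_mul, eval_mul, eval_derivative_prod_X_sub_C univ t fun l _ => (htx l i).symm] at h1
  simp only [derivative_sub, derivative_X, derivative_C, sub_zero, eval_one, eval_prod, eval_sub,
      eval_X, eval_C, eval_zero, eval_mul] at h1
  have h2 : κ * (x i - p) * (∏ l, (x i - t l)) * q i =
      κ * (x i - p) * (∏ l, (x i - t l)) * ((x i - p)⁻¹ + ∑ l, (x i - t l)⁻¹) := by
    linear_combination -h1 - κ * (∏ l, (x i - t l)) * mul_inv_cancel₀ hp
  exact mul_left_cancel₀ (mul_ne_zero (mul_ne_zero hκ hp) hP) h2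

end Ode

end Gaudin

namespace Gaudin

open Finset

section Roots

lemma exists_prod_fin {m : ℕ} {u : ℂ[X]} (hu : u.Monic) (hm : u.natDegree = m) :
    ∃ t : Fin m → ℂ, u = ∏ l, (X - C (t l)) := by
  have h1 := (IsAlgClosed.splits u).eq_prod_roots
  have hc : u.roots.toList.length = m := by
    rw [Multiset.length_toList, ← hm]
    exact ((IsAlgClosed.splits u).natDegree_eq_card_roots).symm
  refine ⟨fun l => u.roots.toList.get (l.cast hc.symm), ?_⟩
  rw [hu.leadingCoeff, C_1, one_mul] at h1
  conv_lhs => rw [h1]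
  subst hc
  rw [← List.prod_ofFn]
  have : (List.ofFn fun l : Fin u.roots.toList.length => X - C (u.roots.toList.get l)) =
      u.roots.toList.map fun a => X - C a := by
    rw [List.ofFn_comp' (f := fun l => u.roots.toList.get l) (g := fun a : ℂ => (X - C a : ℂ[X])),
      List.ofFn_get]
  change _ = (List.ofFn fun l : Fin u.roots.toList.length => X - C (u.roots.toList.get l)).prod
  rw [this, ← Multiset.prod_coe, ← Multiset.map_coe, Multiset.coe_toList]

lemma simple_zeros {K : Type*} [Field K] {m : ℕ} {h : K[X]} {κ p : K} {t : Fin m → K}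
    (hh : h = C κ * ((X - C p) * ∏ l, (X - C (t l))))
    (hs : ∀ z, h.eval z = 0 → (derivative h).eval z ≠ 0) :
    Function.Injective t ∧ ∀ l, t l ≠ p := by
  constructor
  · intro k l hkl
    by_contra hne
    have h1 : h = C κ * (X - C p) * (∏ a ∈ (univ.erase k).erase l, (X - C (t a))) *
        ((X - C (t k)) * (X - C (t k))) := by
      rw [hh, ← mul_prod_erase univ _ (mem_univ k),
        ← mul_prod_erase (univ.erase k) _ (mem_erase.2 ⟨fun e => hne e.symm, mem_univ l⟩), ← hkl]
      ring
    refine hs (t k) ?_ ?_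
    · rw [h1]; simp
    · rw [h1, derivative_mul, eval_add, derivative_mul]; simp
  · intro l hl
    have h1 : h = C κ * (∏ a ∈ univ.erase l, (X - C (t a))) *
        ((X - C p) * (X - C p)) := by
      rw [hh, ← mul_prod_erase univ _ (mem_univ l), hl]
      ring
    refine hs p ?_ ?_
    · rw [h1]; simp
    · rw [h1, derivative_mul, eval_add, derivative_mul]; simp

lemma exists_real_eval_ne_zero {N : ℂ[X]} (hN : N ≠ 0) : ∃ p : ℝ, N.eval (p : ℂ) ≠ 0 := by
  by_contra! h
  refine hN (eq_zero_of_infinite_isRoot N ?_)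
  refine (Set.infinite_range_of_injective Complex.ofReal_injective).mono ?_
  rintro _ ⟨p, rfl⟩
  exact h p

lemma linear_comb_ne_zero {K : Type*} [Field K] {f g : K[X]} (hw : wronskian f g ≠ 0) {a b : K}
    (hab : a ≠ 0 ∨ b ≠ 0) : C a * g - C b * f ≠ 0 := by
  intro h
  have h' := congrArg derivative h
  simp only [derivative_sub, derivative_mul, derivative_C, zero_mul, zero_add, derivative_zero] at h'
  refine hw ?_
  unfold wronskian
  obtain ha | hb := hab
  · refine mul_left_cancel₀ (C_ne_zero.2 ha) ?_
    linear_combination f * h' - derivative f * h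
  · refine mul_left_cancel₀ (C_ne_zero.2 hb) ?_
    linear_combination g * h' - derivative g * h

lemma coeff_ne_zero_of_wronskian {K : Type*} [Field K] {m : ℕ} {f g : K[X]}
    (hf : f.natDegree ≤ m + 1)
    (hg : g.natDegree ≤ m + 1) (hw : 2 * m ≤ (wronskian f g).natDegree)
    (hw0 : wronskian f g ≠ 0) : f.coeff (m + 1) ≠ 0 ∨ g.coeff (m + 1) ≠ 0 := by
  by_contra! h
  have h1 := natDegree_wronskian_lt_add hw0
  have aux : ∀ f : K[X], f.natDegree ≤ m + 1 → f.coeff (m + 1) = 0 → f.natDegree ≤ m := by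
    intro f hf h0
    by_contra! hlt
    have e : f.natDegree = m + 1 := by omega
    have e2 : f.leadingCoeff = 0 := by rw [leadingCoeff, e, h0]
    rw [leadingCoeff_eq_zero.1 e2] at e
    simp at e
  have := aux f hf h.1
  have := aux g hg h.2
  omega

variable {ι : Type*} [Fintype ι] [DecidableEq ι]

/-- A combination of `f` and `g` vanishing at a real point which is in general position with
respect to the nodes. -/
theorem exists_general_position {x : ι → ℝ} {m : ℕ}
    (hm : Fintype.card ι = 2 * m) {f g : ℂ[X]} (hf : f.natDegree ≤ m + 1)
    (hg : g.natDegree ≤ m + 1) {c : ℂ} (hc : c ≠ 0)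
    (hw : wronskian f g = C c * critPoly (fun i => (x i : ℂ)))
    (hfg : ∀ i, f.eval (x i : ℂ) ≠ 0 ∨ g.eval (x i : ℂ) ≠ 0) :
    ∃ p : ℝ, (∀ i, x i ≠ p) ∧ ∃ κ : ℂ, κ ≠ 0 ∧ ∃ t : Fin m → ℂ, Function.Injective t ∧
      (∀ l, t l ≠ p) ∧ (∀ l i, t l ≠ x i) ∧
      C (g.eval (p : ℂ)) * f - C (f.eval (p : ℂ)) * g =
        C κ * ((X - C (p : ℂ)) * ∏ l, (X - C (t l))) := by
  have hW0 : critPoly (fun i => (x i : ℂ)) ≠ 0 := (critPoly_monic _).ne_zero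
  have hw0 : wronskian f g ≠ 0 := by
    rw [hw]; exact mul_ne_zero (C_ne_zero.2 hc) hW0
  have hdeg : (wronskian f g).natDegree = 2 * m := by
    rw [hw, natDegree_C_mul hc, natDegree_critPoly, hm]
  have hlead := coeff_ne_zero_of_wronskian hf hg hdeg.ge hw0
  obtain ⟨p, hp⟩ := exists_real_eval_ne_zero (N := critPoly (fun i => (x i : ℂ)) *
    (C (f.coeff (m + 1)) * g - C (g.coeff (m + 1)) * f) *
    ∏ i, (C (f.eval (x i : ℂ)) * g - C (g.eval (x i : ℂ)) * f)) (by
      refine mul_ne_zero (mul_ne_zero hW0 (linear_comb_ne_zero hw0 hlead)) ?_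
      exact prod_ne_zero_iff.2 fun i _ => linear_comb_ne_zero hw0 (hfg i))
  simp only [eval_mul, eval_prod, eval_sub, eval_C, mul_ne_zero_iff, prod_ne_zero_iff] at hp
  obtain ⟨⟨hp1, hp2⟩, hp3⟩ := hp
  set h : ℂ[X] := C (g.eval (p : ℂ)) * f - C (f.eval (p : ℂ)) * g with hh
  have hcoef : h.coeff (m + 1) ≠ 0 := by
    rw [hh, coeff_sub, coeff_C_mul, coeff_C_mul]
    intro h0; exact hp2 (by linear_combination h0)
  have hnd : h.natDegree = m + 1 := by
    refine natDegree_eq_of_le_of_coeff_ne_zero ?_ hcoef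
    refine (natDegree_sub_le _ _).trans (max_le ?_ ?_)
    · exact (natDegree_C_mul_le _ _).trans hf
    · exact (natDegree_C_mul_le _ _).trans hg
  have hnode : ∀ i, h.eval (x i : ℂ) ≠ 0 := by
    intro i h0
    refine hp3 i (mem_univ i) ?_
    rw [hh, eval_sub, eval_mul, eval_mul, eval_C, eval_C] at h0
    linear_combination h0
  have hsimple : ∀ z, h.eval z = 0 → (derivative h).eval z ≠ 0 := by
    intro z h0 h1
    have hz : (critPoly (fun i => (x i : ℂ))).eval z ≠ 0 := by
      rw [Ne, eval_critPoly_eq_zero]; rintro ⟨i, rfl⟩; exact hnode i h0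
    rw [hh] at h0 h1
    simp only [derivative_sub, derivative_mul, derivative_C, zero_mul, zero_add, eval_sub,
      eval_mul, eval_C] at h0 h1
    have h2 := congrArg (eval z) hw
    have h3 := congrArg (eval (p : ℂ)) hw
    simp only [wronskian, eval_sub, eval_mul, eval_C] at h2 h3
    have h4 : f.eval (p : ℂ) = 0 := by
      refine (mul_eq_zero.1 (?_ : f.eval (p : ℂ) * (c * (critPoly fun i => (x i : ℂ)).eval z) = 0)
        ).resolve_right (mul_ne_zero hc hz)
      linear_combination (-f.eval (p : ℂ)) * h2 - f.eval z * h1 + (derivative f).eval z * h0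
    have h5 : g.eval (p : ℂ) = 0 := by
      refine (mul_eq_zero.1 (?_ : g.eval (p : ℂ) * (c * (critPoly fun i => (x i : ℂ)).eval z) = 0)
        ).resolve_right (mul_ne_zero hc hz)
      linear_combination (-g.eval (p : ℂ)) * h2 - g.eval z * h1 + (derivative g).eval z * h0
    rw [h4, h5, zero_mul, mul_zero, sub_zero] at h3
    exact mul_ne_zero hc hp1 h3.symm
  obtain ⟨u, hu⟩ : X - C (p : ℂ) ∣ h := by
    rw [dvd_iff_isRoot, IsRoot, hh]
    simp only [eval_sub, eval_mul, eval_C]; ring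
  have hu0 : u ≠ 0 := by rintro rfl; rw [hu, mul_zero] at hcoef; simp at hcoef
  have hl : u.leadingCoeff ≠ 0 := leadingCoeff_ne_zero.2 hu0
  have hund : u.natDegree = m := by
    have := congrArg natDegree hu
    rw [natDegree_mul (X_sub_C_ne_zero _) hu0, natDegree_X_sub_C, hnd] at this
    omega
  obtain ⟨t, ht⟩ := exists_prod_fin (m := m) (u := C u.leadingCoeff⁻¹ * u)
    (by rw [mul_comm]; exact monic_mul_leadingCoeff_inv hu0)
    (by rw [natDegree_C_mul (inv_ne_zero hl), hund])
  have hfac : h = C u.leadingCoeff * ((X - C (p : ℂ)) * ∏ l, (X - C (t l))) := by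
    have e : (C u.leadingCoeff : ℂ[X]) * C u.leadingCoeff⁻¹ = 1 := by
      rw [← C_mul, mul_inv_cancel₀ hl, C_1]
    rw [← ht, hu]
    linear_combination (-(X - C (p : ℂ)) * u) * e
  obtain ⟨hinj, htp⟩ := simple_zeros hfac hsimple
  refine ⟨p, ?_, u.leadingCoeff, hl, t, hinj, htp, ?_, hfac⟩
  · intro i hi
    exact hp1 (eval_critPoly_eq_zero.2 ⟨i, by rw [hi]⟩)
  · intro l i hli
    refine hnode i ?_
    rw [hfac, ← hli, eval_mul, eval_mul, eval_prod, prod_eq_zero (mem_univ l)]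
    · simp
    · simp

end Roots

end Gaudin

namespace Gaudin

open Finset

section Frobenius

lemma coeff_X_mul_derivative {K : Type*} [CommRing K] (y : K[X]) (j : ℕ) :
    (X * derivative y).coeff j = j * y.coeff j := by
  cases j with
  | zero => simp
  | succ j => rw [coeff_X_mul, coeff_derivative]; push_cast; ring

lemma natDegree_X_mul_derivative_le {K : Type*} [CommRing K] (y : K[X]) {k : ℕ}
    (hk : y.natDegree ≤ k) : (X * derivative y).natDegree ≤ k := by
  rw [natDegree_le_iff_coeff_eq_zero] at *
  intro N hN
  rw [coeff_X_mul_derivative, hk N hN, mul_zero]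

lemma exists_independent_ker {K V W : Type*} [Field K] [AddCommGroup V] [Module K V]
    [AddCommGroup W] [Module K W] [FiniteDimensional K V] [FiniteDimensional K W] (E : V →ₗ[K] W)
    (h : Module.finrank K W + 2 ≤ Module.finrank K V) :
    ∃ f g : V, E f = 0 ∧ E g = 0 ∧ ∀ a b : K, a • f + b • g = 0 → a = 0 ∧ b = 0 := by
  have h1 := LinearMap.finrank_range_add_finrank_ker E
  have h3 := Submodule.finrank_le (LinearMap.range E)
  have h4 : 1 < Module.finrank K (LinearMap.ker E) := by omega
  have : Nontrivial (LinearMap.ker E) := Module.nontrivial_of_finrank_pos (R := K) (by omega)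
  obtain ⟨f, hf⟩ := exists_ne (0 : LinearMap.ker E)
  obtain ⟨g, hfg⟩ := exists_linearIndependent_pair_of_one_lt_finrank (R := K) h4 hf
  rw [LinearIndependent.pair_iff] at hfg
  refine ⟨f.1, g.1, f.2, g.2, fun a b hab => hfg a b (Subtype.ext ?_)⟩
  simpa using hab

lemma natDegree_le_of_degree_lt_succ {K : Type*} [CommRing K] {y : K[X]} {n : ℕ}
    (h : y.degree < ((n + 1 : ℕ) : WithBot ℕ)) : y.natDegree ≤ n := by
  by_cases h0 : y = 0
  · rw [h0, natDegree_zero]; omega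
  · exact Nat.lt_succ_iff.1 ((natDegree_lt_iff_degree_lt h0).2 h)

lemma wronskian_ne_zero_of_natDegree_ne {K : Type*} [Field K] [CharZero K] {f g : K[X]}
    (hf : f ≠ 0) (hg : g ≠ 0) (h : f.natDegree ≠ g.natDegree) : wronskian f g ≠ 0 := by
  intro h0
  have h1 : f * (X * derivative g) - (X * derivative f) * g = 0 := by
    unfold wronskian at h0; linear_combination X * h0
  have h2 := congrArg (fun P => coeff P (f.natDegree + g.natDegree)) h1
  simp only [coeff_sub, coeff_zero] at h2
  rw [coeff_mul_add_eq_of_natDegree_le le_rfl (natDegree_X_mul_derivative_le g le_rfl),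
    coeff_mul_add_eq_of_natDegree_le (natDegree_X_mul_derivative_le f le_rfl) le_rfl,
    coeff_X_mul_derivative, coeff_X_mul_derivative] at h2
  have h3 : f.leadingCoeff * g.leadingCoeff * ((g.natDegree : K) - f.natDegree) = 0 := by
    unfold leadingCoeff; linear_combination h2
  have h4 : (g.natDegree : K) - f.natDegree ≠ 0 := by
    rw [sub_ne_zero]; exact_mod_cast h.symm
  exact mul_ne_zero (mul_ne_zero (leadingCoeff_ne_zero.2 hf) (leadingCoeff_ne_zero.2 hg)) h4 h3

lemma wronskian_ne_zero_of_linearIndependent {K : Type*} [Field K] [CharZero K] {f g : K[X]}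
    (h : ∀ a b : K, C a * f + C b * g = 0 → a = 0 ∧ b = 0) : wronskian f g ≠ 0 := by
  have hf : f ≠ 0 := by
    rintro rfl; have := h 1 0 (by simp); simp at this
  have hg : g ≠ 0 := by
    rintro rfl; have := h 0 1 (by simp); simp at this
  by_cases hd : f.natDegree = g.natDegree
  · set g' := C f.leadingCoeff * g - C g.leadingCoeff * f with hg'
    have hlf := leadingCoeff_ne_zero.2 hf
    have h0 : g' ≠ 0 := by
      intro h0
      have := h (-g.leadingCoeff) f.leadingCoeff (by rw [C_neg]; linear_combination h0)
      exact hlf this.2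
    have hw : wronskian f g' = C f.leadingCoeff * wronskian f g := by
      rw [hg']
      unfold wronskian
      simp only [derivative_sub, derivative_mul, derivative_C, zero_mul, zero_add]
      ring
    have hcoef : g'.coeff f.natDegree = 0 := by
      rw [hg', coeff_sub, coeff_C_mul, coeff_C_mul]
      conv_lhs => enter [1, 2]; rw [hd]
      unfold leadingCoeff; ring
    have hle : g'.natDegree ≤ f.natDegree := by
      refine (natDegree_sub_le _ _).trans (max_le ?_ ?_)
      · exact (natDegree_C_mul_le _ _).trans hd.ge
      · exact natDegree_C_mul_le _ _
    have hne : f.natDegree ≠ g'.natDegree := by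
      intro e
      rw [e] at hcoef
      exact h0 (leadingCoeff_eq_zero.1 hcoef)
    have := wronskian_ne_zero_of_natDegree_ne hf h0 hne
    rw [hw] at this
    exact right_ne_zero_of_mul this
  · exact wronskian_ne_zero_of_natDegree_ne hf hg hd

variable {ι K : Type*} [Fintype ι] [DecidableEq ι] [Field K]

lemma coeff_potential (x q : ι → K) {n : ℕ} (hn : Fintype.card ι = n + 1) :
    (potential x q).coeff n = ∑ i, q i := by
  rw [potential, finsetSum_coeff]
  refine sum_congr rfl fun i _ => ?_
  have h : (∏ j ∈ univ.erase i, (X - C (x j)) : K[X]) = Lagrange.nodal (univ.erase i) x := rfl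
  have h1 : (Lagrange.nodal (univ.erase i) x : K[X]).natDegree = n := by
    rw [Lagrange.natDegree_nodal, card_erase_of_mem (mem_univ i), card_univ, hn]; rfl
  have h2 : (Lagrange.nodal (univ.erase i) x : K[X]).coeff n = 1 := by
    rw [← h1]; exact Lagrange.nodal_monic
  rw [coeff_C_mul, h, h2, mul_one]

lemma X_mul_potential (x q : ι → K) (hq : ∑ i, q i = 0) :
    X * potential x q = potential x (fun i => x i * q i) := by
  have h : ∀ i, X * (C (q i) * ∏ j ∈ univ.erase i, (X - C (x j))) =
      C (q i) * critPoly x + C (x i * q i) * ∏ j ∈ univ.erase i, (X - C (x j)) := by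
    intro i
    rw [critPoly, Lagrange.nodal_eq, ← mul_prod_erase univ _ (mem_univ i), C_mul]; ring
  unfold potential
  rw [mul_sum, sum_congr rfl fun i _ => h i, sum_add_distrib, ← sum_mul, ← map_sum, hq, C_0,
    zero_mul, zero_add]

variable [CharZero K]

/-- The possible degrees of solutions. -/
lemma natDegree_of_ode {x q : ι → K} {m : ℕ} (hm0 : 1 ≤ m)
    (hm : Fintype.card ι = 2 * m) (hq0 : ∑ i, q i = 0) (hq1 : ∑ i, x i * q i = (m : K) ^ 2 + m)
    {y : K[X]} (hy : ode x q y = 0) (hy0 : y ≠ 0) : y.natDegree = m ∨ y.natDegree = m + 1 := by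
  set k := y.natDegree with hk
  obtain ⟨n, hn⟩ : ∃ n, 2 * m = n + 1 := ⟨2 * m - 1, by omega⟩
  have h1 : critPoly x * (X * derivative (X * derivative y) - X * derivative y) -
      (X * derivative (critPoly x)) * (X * derivative y) +
      (X * potential x (fun i => x i * q i)) * y = 0 := by
    rw [← X_mul_potential x q hq0]
    unfold ode at hy
    simp only [derivative_mul, derivative_X, one_mul]
    linear_combination X ^ 2 * hy
  have dW : (critPoly x).natDegree ≤ 2 * m := (natDegree_critPoly x).le.trans hm.le
  have cW : (critPoly x).coeff (2 * m) = 1 := by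
    rw [← hm, ← natDegree_critPoly x]; exact critPoly_monic x
  have dy : (X * derivative y).natDegree ≤ k := natDegree_X_mul_derivative_le y le_rfl
  have dP : (X * potential x (fun i => x i * q i)).natDegree ≤ 2 * m := by
    refine natDegree_mul_le.trans ?_
    have h2 : (potential x (fun i => x i * q i)).natDegree ≤ n := by
      have := degree_potential_lt x (fun i => x i * q i)
      rw [hm, hn] at this
      exact natDegree_le_of_degree_lt_succ this
    rw [natDegree_X]; omega
  have h2 := congrArg (fun P => coeff P (2 * m + k)) h1
  simp only [coeff_sub, coeff_add, coeff_zero] at h2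
  rw [coeff_mul_add_eq_of_natDegree_le dW ((natDegree_sub_le _ _).trans
      (max_le (natDegree_X_mul_derivative_le _ dy) dy)),
    coeff_mul_add_eq_of_natDegree_le (natDegree_X_mul_derivative_le _ dW) dy,
    coeff_mul_add_eq_of_natDegree_le dP le_rfl, coeff_sub, coeff_X_mul_derivative,
    coeff_X_mul_derivative, coeff_X_mul_derivative, cW, hn, coeff_X_mul,
    coeff_potential x _ (hm.trans hn), hq1] at h2
  have h3 : y.coeff k ≠ 0 := by
    rw [hk]; exact leadingCoeff_ne_zero.2 hy0
  have hn' : ((n + 1 : ℕ) : K) = 2 * m := by rw [← hn]; push_cast; ring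
  rw [hn'] at h2
  have h4 : ((k : K) - m) * (k - (m + 1)) = 0 := by
    refine mul_left_cancel₀ h3 ?_
    linear_combination h2
  obtain h5 | h5 := mul_eq_zero.1 h4
  · left; exact_mod_cast sub_eq_zero.1 h5
  · right; exact_mod_cast sub_eq_zero.1 h5

/-- The condition on the residues for the absence of logarithms. -/
lemma no_log {x q : ι → K} (hx : Function.Injective x) {i : ι}
    (hq : q i ^ 2 = (∑ k, (x i - x k)⁻¹) * q i - ∑ j, (x i - x j)⁻¹ * q j) :
    (potential x q).eval (x i) ^ 2 -
      (derivative (derivative (critPoly x))).eval (x i) * (potential x q).eval (x i) +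
      (derivative (critPoly x)).eval (x i) * (derivative (potential x q)).eval (x i) = 0 := by
  set P := ∏ j ∈ univ.erase i, (x i - x j) with hP
  set S := ∑ k, (x i - x k)⁻¹ with hS
  have hne : ∀ l ∈ univ.erase i, x i ≠ x l := fun l hl e => (mem_erase.1 hl).1 (hx e).symm
  have hS' : ∑ k ∈ univ.erase i, (x i - x k)⁻¹ = S := by
    rw [hS, ← add_sum_erase univ _ (mem_univ i)]; simp
  have hWi : (derivative (∏ j ∈ univ.erase i, (X - C (x j)))).eval (x i) = P * S := by
    rw [eval_derivative_prod_X_sub_C _ _ hne, hS']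
  have e1 : (derivative (critPoly x)).eval (x i) = P := eval_derivative_critPoly x i
  have e2 : (derivative (derivative (critPoly x))).eval (x i) = 2 * (P * S) := by
    rw [critPoly, Lagrange.nodal_eq, ← mul_prod_erase univ _ (mem_univ i)]
    simp only [derivative_mul, derivative_sub, derivative_X, derivative_C, sub_zero,
      derivative_add, derivative_one, eval_add, eval_mul, eval_sub, eval_X, eval_C, hWi, eval_zero,
      eval_one, zero_mul, sub_self]
    ring
  have e3 : (derivative (potential x q)).eval (x i) =
      q i * (P * S) + P * ∑ j, (x i - x j)⁻¹ * q j := by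
    rw [potential, derivative_sum, eval_finsetSum, ← add_sum_erase univ _ (mem_univ i),
      ← add_sum_erase (univ : Finset ι) (fun j => (x i - x j)⁻¹ * q j) (mem_univ i)]
    simp only [derivative_mul, derivative_C, zero_mul, zero_add, eval_mul, eval_C, hWi, sub_self,
      inv_zero]
    rw [Finset.mul_sum (univ.erase i) _ P]
    refine congrArg₂ (· + ·) rfl (sum_congr rfl fun j hj => ?_)
    have hij : i ∈ univ.erase j := mem_erase.2 ⟨(mem_erase.1 hj).1.symm, mem_univ i⟩
    have hji : x i - x j ≠ 0 := sub_ne_zero.2 (hne j hj)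
    rw [← mul_prod_erase _ _ hij, derivative_mul, hP, ← mul_prod_erase _ _ hj]
    have : (univ.erase j).erase i = (univ.erase i).erase j := by
      ext a; simp only [mem_erase]; tauto
    rw [this]
    simp only [derivative_sub, derivative_X, derivative_C, eval_add, eval_mul, eval_sub, eval_X,
      eval_C, eval_zero, sub_zero, eval_one, sub_self, zero_mul, add_zero, one_mul, eval_prod]
    field_simp
  rw [eval_potential, e1, e2, e3]
  linear_combination P ^ 2 * hq

/-- If the residues satisfy the spectral relations then all solutions of the equation are
polynomials. -/
theorem exists_solutions {x q : ι → K} (hx : Function.Injective x)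
    {m : ℕ} (hm0 : 1 ≤ m)
    (hm : Fintype.card ι = 2 * m) (hq0 : ∑ i, q i = 0) (hq1 : ∑ i, x i * q i = (m : K) ^ 2 + m)
    (hq2 : ∀ i, q i ^ 2 = (∑ k, (x i - x k)⁻¹) * q i - ∑ j, (x i - x j)⁻¹ * q j) :
    ∃ f g : K[X], ode x q f = 0 ∧ ode x q g = 0 ∧ f.natDegree ≤ m + 1 ∧ g.natDegree ≤ m + 1 ∧
      ∃ c : K, c ≠ 0 ∧ wronskian f g = C c * critPoly x := by
  let D : K[X] →ₗ[K] K[X] :=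
    { toFun := ode x q
      map_add' := ode_add x q
      map_smul' := fun c y => by
        rw [RingHom.id_apply, smul_eq_C_mul, smul_eq_C_mul, ode_C_mul] }
  let E : degreeLT K (2 * m + 2) →ₗ[K] (ι → K) :=
    LinearMap.pi fun i => (leval (x i) : K[X] →ₗ[K] K) ∘ₗ D ∘ₗ (degreeLT K (2 * m + 2)).subtype
  have hE : ∀ y (i : ι), E y i = (ode x q y.1).eval (x i) := fun y i => rfl
  have hfd : Module.Finite K (degreeLT K (2 * m + 2)) :=
    Module.Finite.equiv (degreeLTEquiv K (2 * m + 2)).symm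
  have hdim : Module.finrank K (ι → K) + 2 ≤ Module.finrank K (degreeLT K (2 * m + 2)) := by
    rw [(degreeLTEquiv K (2 * m + 2)).finrank_eq, Module.finrank_fintype_fun_eq_card, hm]
    simp
  have hker : ∀ y, E y = 0 → ode x q y.1 = 0 := by
    intro y hy
    have h1 : ∀ i, (ode x q y.1).eval (x i) = 0 := fun i => by
      rw [← hE, hy]; rfl
    obtain ⟨v, hv⟩ := critPoly_dvd_of_eval hx h1
    have h2 : ∀ i, v.eval (x i) = 0 := by
      intro i
      have hl := no_log hx (hq2 i)
      have e1 := h1 i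
      have e2 := congrArg (fun P => (derivative P).eval (x i)) hv
      simp only [ode, derivative_add, derivative_sub, derivative_mul, eval_add, eval_sub, eval_mul,
        eval_critPoly_node, zero_mul, add_zero, zero_sub] at e1 e2
      have h0 := eval_derivative_critPoly_ne_zero hx i
      refine (mul_eq_zero.1 ((?_ : _ * _ * v.eval (x i) = 0))).resolve_left (mul_ne_zero h0 h0)
      linear_combination (-(derivative (critPoly x)).eval (x i)) * e2 -
        ((potential x q).eval (x i) - (derivative (derivative (critPoly x))).eval (x i)) * e1 +
        y.1.eval (x i) * hl
    obtain ⟨w, hw⟩ := critPoly_dvd_of_eval hx h2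
    by_contra hne
    have hw0 : w ≠ 0 := by rintro rfl; rw [hv, hw] at hne; simp at hne
    have hW0 : critPoly x ≠ 0 := (critPoly_monic x).ne_zero
    have hlow : 4 * m ≤ (ode x q y.1).natDegree := by
      rw [hv, hw, natDegree_mul hW0 (mul_ne_zero hW0 hw0), natDegree_mul hW0 hw0,
        natDegree_critPoly, hm]
      omega
    have hyd : y.1.natDegree ≤ 2 * m + 1 :=
      natDegree_le_of_degree_lt_succ (mem_degreeLT.1 y.2)
    have hup : (ode x q y.1).natDegree ≤ 4 * m - 1 := by
      unfold ode
      have hW := (natDegree_critPoly x).trans hm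
      refine (natDegree_add_le _ _).trans (max_le ((natDegree_sub_le _ _).trans
        (max_le ?_ ?_)) ?_)
      · refine natDegree_mul_le.trans ?_
        have h1 := natDegree_derivative_le y.1
        have h2 := natDegree_derivative_le (derivative y.1)
        omega
      · refine natDegree_mul_le.trans ?_
        have h1 := natDegree_derivative_le y.1
        have h2 := natDegree_derivative_le (critPoly x)
        omega
      · refine natDegree_mul_le.trans ?_
        have : (potential x q).natDegree + 2 ≤ 2 * m := by
          by_cases h0 : potential x q = 0
          · rw [h0, natDegree_zero]; omega
          have h1 := degree_potential_lt x (fun i => x i * q i)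
          rw [← X_mul_potential x q hq0, ← natDegree_lt_iff_degree_lt (mul_ne_zero X_ne_zero h0),
            natDegree_X_mul h0] at h1
          omega
        omega
    omega
  obtain ⟨f, g, hf, hg, hfg⟩ := exists_independent_ker E hdim
  have hli : ∀ a b : K, C a * f.1 + C b * g.1 = 0 → a = 0 ∧ b = 0 := by
    intro a b hab
    refine hfg a b (Subtype.ext ?_)
    simpa [smul_eq_C_mul] using hab
  have hw := wronskian_ne_zero_of_linearIndependent hli
  have hf0 := hker f hf
  have hg0 := hker g hg
  have hdeg : ∀ y : K[X], ode x q y = 0 → y.natDegree ≤ m + 1 := by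
    intro y hy
    by_cases hy0 : y = 0
    · rw [hy0, natDegree_zero]; omega
    · have := natDegree_of_ode hm0 hm hq0 hq1 hy hy0
      omega
  obtain ⟨c, hc⟩ := exists_wronskian_eq hx hf0 hg0
  refine ⟨f.1, g.1, hf0, hg0, hdeg _ hf0, hdeg _ hg0, c, ?_, hc⟩
  rintro rfl
  rw [C_0, zero_mul] at hc
  exact hw hc

end Frobenius

end Gaudin

namespace Gaudin

open Finset

section Diagonalization

lemma exists_joint_eigenbasis {ι E : Type*} [NormedAddCommGroup E]
    [InnerProductSpace ℂ E] [FiniteDimensional ℂ E] (T : ι → E →ₗ[ℂ] E)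
    (hT : ∀ i, (T i).IsSymmetric) (hC : ∀ i j, Commute (T i) (T j)) {N : ℕ}
    (hN : Module.finrank ℂ E = N) :
    ∃ (b : OrthonormalBasis (Fin N) ℂ E) (q : Fin N → ι → ℝ),
      ∀ a i, T i (b a) = (q a i : ℂ) • b a := by
  classical
  have hI := LinearMap.IsSymmetric.directSum_isInternal_of_pairwise_commute hT
    (fun i j _ => hC i j)
  have hO := LinearMap.IsSymmetric.orthogonalFamily_iInf_eigenspaces hT
  set A : (ι → ℂ) → Submodule ℂ E := fun α => ⨅ j, Module.End.eigenspace (T j) (α j)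
  have hI' := (DirectSum.isInternal_ne_bot_iff).2 hI
  have hfin : Finite {i // A i ≠ ⊥} :=
    WellFoundedGT.finite_ne_bot_of_iSupIndep hI.submodule_iSupIndep
  haveI := Fintype.ofFinite {i // A i ≠ ⊥}
  have hO' : OrthogonalFamily ℂ (fun i : {i // A i ≠ ⊥} => A i) fun i => (A i).subtypeₗᵢ :=
    hO.comp Subtype.val_injective
  let b := hI'.subordinateOrthonormalBasis hN hO'
  have hb : ∀ a, ∃ α : ι → ℂ, ∀ i, T i (b a) = α i • b a := fun a => by
    have := hI'.subordinateOrthonormalBasis_subordinate hN a hO'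
    exact ⟨_, fun i => Module.End.mem_eigenspace_iff.1 ((Submodule.mem_iInf _).1 this i)⟩
  choose α hα using hb
  refine ⟨b, fun a i => (α a i).re, fun a i => ?_⟩
  have h1 : star (α a i) = α a i :=
    (hT i).conj_eigenvalue_eq_self (Module.End.hasEigenvalue_of_hasEigenvector
      ⟨Module.End.mem_eigenspace_iff.2 (hα a i), b.orthonormal.ne_zero a⟩)
  rw [hα a i, Complex.conj_eq_iff_re.1 h1]

lemma exists_joint_eigenvectors {ι E : Type*} [NormedAddCommGroup E]
    [InnerProductSpace ℂ E] [FiniteDimensional ℂ E] (T : ι → E →ₗ[ℂ] E)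
    (hT : ∀ i, (T i).IsSymmetric) (V : Submodule ℂ E) (hV : ∀ i, ∀ v ∈ V, T i v ∈ V)
    (hC : ∀ i j v, T i (T j v) = T j (T i v)) {N : ℕ} (hN : Module.finrank ℂ V = N) :
    ∃ b : Fin N → E, Orthonormal ℂ b ∧ (∀ a, b a ∈ V) ∧ ∃ q : Fin N → ι → ℝ,
      ∀ a i, T i (b a) = (q a i : ℂ) • b a := by
  obtain ⟨b, q, hb⟩ := exists_joint_eigenbasis (fun i => (T i).restrict (hV i))
    (fun i => (hT i).restrict_invariant (hV i))
    (fun i j => LinearMap.ext fun v => Subtype.ext (hC i j v.1)) hN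
  refine ⟨fun a => (b a : E), ?_, fun a => (b a).2, q, fun a i => congrArg Subtype.val (hb a i)⟩
  exact b.orthonormal.comp_linearIsometry V.subtypeₗᵢ

end Diagonalization

variable {ι : Type*} [Fintype ι] [DecidableEq ι] {m : ℕ}

/-- The space of singular vectors in the middle level. -/
def vacSpace (ι : Type*) [Fintype ι] [DecidableEq ι] (m : ℕ) : Submodule ℂ (Finset ι → ℂ) where
  carrier := {ψ | IsVac m ψ}
  zero_mem' := ⟨fun _ _ => rfl, fun J _ _ => by simp [addOne]⟩
  add_mem' := fun {φ ψ} hφ hψ => ⟨fun I hI => by simp [hφ.1 I hI, hψ.1 I hI], fun J hJ hm => by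
    have h1 := hφ.2 J hJ hm
    have h2 := hψ.2 J hJ hm
    simp only [addOne] at h1 h2 ⊢
    simp [sum_add_distrib, h1, h2]⟩
  smul_mem' := fun c ψ hψ => ⟨fun I hI => by simp [hψ.1 I hI], fun J hJ hm => by
    have h2 := hψ.2 J hJ hm
    simp only [addOne] at h2 ⊢
    simp [← mul_sum, h2]⟩

lemma mem_vacSpace {ψ : Finset ι → ℂ} : ψ ∈ vacSpace ι m ↔ IsVac m ψ := Iff.rfl

/-- `addOne` from the level above a level of size less than half is surjective. -/
lemma exists_addOne_eq {r : ℕ} (hr : 2 * r < Fintype.card ι) (φ : Finset ι → ℂ) :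
    ∃ ψ : Finset ι → ℂ, ∀ J, #J = r → addOne univ ψ J = φ J := by
  classical
  let ext : ({J : Finset ι // #J = r} → ℂ) → Finset ι → ℂ :=
    fun χ J => if h : #J = r then χ ⟨J, h⟩ else 0
  let L : ({J : Finset ι // #J = r} → ℂ) →ₗ[ℂ] ({J : Finset ι // #J = r} → ℂ) :=
    { toFun := fun χ J => addOne univ (removeOne (ext χ)) J
      map_add' := fun χ χ' => by
        have : ext (χ + χ') = ext χ + ext χ' := by
          ext J; simp only [ext, Pi.add_apply]; split_ifs <;> simp
        ext J
        simp [this, addOne, removeOne, sum_add_distrib]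
      map_smul' := fun c χ => by
        have : ext (c • χ) = c • ext χ := by
          ext J; simp only [ext, Pi.smul_apply]; split_ifs <;> simp
        ext J
        simp only [this, addOne, removeOne, mul_sum, Pi.smul_apply, smul_eq_mul,
          RingHom.id_apply] }
  have hL : Function.Injective L := by
    rw [← LinearMap.ker_eq_bot, LinearMap.ker_eq_bot']
    intro χ hχ
    have h1 : ∑ K ∈ univ.powersetCard (r + 1),
        star (removeOne (ext χ) K) * removeOne (ext χ) K = 0 := by
      have := sum_mul_removeOne univ r (fun K => star (removeOne (ext χ) K)) (ext χ)
      rw [this]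
      refine sum_eq_zero fun I hI => ?_
      have h2 := congrFun hχ ⟨I, (mem_powersetCard.1 hI).2⟩
      have h3 : addOne univ (fun K => star (removeOne (ext χ) K)) I =
        star (addOne univ (removeOne (ext χ)) I) := by simp [addOne]
      rw [h3]
      have h4 : addOne univ (removeOne (ext χ)) I = 0 := h2
      rw [h4]; simp
    have h5 := eq_zero_of_removeOne_eq_zero (by simpa using hr) (sum_normSq_eq_zero h1)
    ext ⟨J, hJ⟩
    have := h5 J (mem_powersetCard.2 ⟨subset_univ _, hJ⟩)
    simpa [ext, hJ] using this
  obtain ⟨χ, hχ⟩ := LinearMap.injective_iff_surjective.1 hL (fun J => φ J)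
  exact ⟨removeOne (ext χ), fun J hJ => congrFun hχ ⟨J, hJ⟩⟩

lemma finrank_vacSpace (hm0 : 1 ≤ m) (hm : Fintype.card ι = 2 * m) :
    Module.finrank ℂ (vacSpace ι m) = (2 * m).choose m / (m + 1) := by
  classical
  obtain ⟨r, rfl⟩ : ∃ r, m = r + 1 := ⟨m - 1, by omega⟩
  let L : (Finset ι → ℂ) →ₗ[ℂ] (({J : Finset ι // #J = r} → ℂ) ×
      ({I : Finset ι // ¬ #I = r + 1} → ℂ)) :=
    { toFun := fun ψ => (fun J => addOne univ ψ J, fun I => ψ I)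
      map_add' := fun ψ ψ' => by
        ext J <;> simp [addOne, sum_add_distrib]
      map_smul' := fun c ψ => by
        ext J <;> simp only [addOne, mul_sum, Pi.smul_apply, smul_eq_mul,
          RingHom.id_apply, Prod.smul_fst, Prod.smul_snd] }
  have hker : LinearMap.ker L = vacSpace ι (r + 1) := by
    ext ψ
    rw [LinearMap.mem_ker, mem_vacSpace]
    constructor
    · intro h
      have h1 := congrArg Prod.fst h
      have h2 := congrArg Prod.snd h
      exact ⟨fun I hI => congrFun h2 ⟨I, hI⟩, fun J _ hJ => congrFun h1 ⟨J, by omega⟩⟩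
    · intro h
      refine Prod.ext (funext fun J => h.2 J (subset_univ _) (by rw [J.2])) (funext fun I => h.1 I I.2)
  have hsurj : LinearMap.range L = ⊤ := by
    rw [LinearMap.range_eq_top]
    rintro ⟨φ, χ⟩
    obtain ⟨ψ, hψ⟩ := exists_addOne_eq (ι := ι) (r := r) (by omega)
      (fun J => if h : #J = r then φ ⟨J, h⟩ else 0)
    refine ⟨fun I => if h : #I = r + 1 then ψ I else χ ⟨I, h⟩, ?_⟩
    refine Prod.ext (funext fun J => ?_) (funext fun I => ?_)
    · have h1 := hψ J J.2
      rw [dif_pos J.2] at h1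
      refine Eq.trans (sum_congr rfl fun j hj => ?_) h1
      have : #(insert j (J : Finset ι)) = r + 1 := by
        rw [card_insert_of_notMem (mem_sdiff.1 hj).2, J.2]
      simp [this]
    · simp [L, I.2]
  have h1 := LinearMap.finrank_range_add_finrank_ker L
  rw [hker, hsurj, finrank_top, Module.finrank_prod, Module.finrank_fintype_fun_eq_card,
    Module.finrank_fintype_fun_eq_card, Module.finrank_fintype_fun_eq_card,
    Fintype.card_subtype_compl, Fintype.card_finset_len, Fintype.card_finset_len, hm] at h1
  have h2 : (2 * (r + 1)).choose (r + 1) ≤ Fintype.card (Finset ι) := by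
    rw [← hm, ← Fintype.card_finset_len]; exact Fintype.card_subtype_le _
  have h3 := Nat.choose_succ_right_eq (2 * (r + 1)) r
  have h4 : 2 * (r + 1) - r = r + 2 := by omega
  rw [h4] at h3
  have h5 : Module.finrank ℂ (vacSpace ι (r + 1)) + (2 * (r + 1)).choose r =
    (2 * (r + 1)).choose (r + 1) := by omega
  symm
  apply Nat.div_eq_of_eq_mul_left (by omega)
  have : (r + 1 + 1) * ((2 * (r + 1)).choose (r + 1)) =
    (r + 1 + 1) * (Module.finrank ℂ (vacSpace ι (r + 1)) * (r + 1 + 1)) := by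
    rw [← h5] at h3 ⊢
    nlinarith
  exact Nat.eq_of_mul_eq_mul_left (by omega) this

/-- An orthonormal family of singular vectors of the middle level diagonalizing all the
exchange Hamiltonians. -/
structure IsDiag (m : ℕ) {N : ℕ} (A : ι → ι → ℝ) (b : Fin N → Finset ι → ℂ)
    (q : Fin N → ι → ℝ) : Prop where
  ortho : ∀ a c, ∑ I, star (b a I) * b c I = if a = c then 1 else 0
  vac : ∀ a, IsVac m (b a)
  eig : ∀ a i, hamiltonian A i (b a) = (q a i : ℂ) • b a

lemma exists_isDiag {x : ι → ℝ} (hx : Function.Injective x) {N : ℕ}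
    (hN : Module.finrank ℂ (vacSpace ι m) = N) :
    ∃ (b : Fin N → Finset ι → ℂ) (q : Fin N → ι → ℝ), IsDiag m (gaudin x) b q := by
  let e := WithLp.linearEquiv 2 ℂ (Finset ι → ℂ)
  let V : Submodule ℂ (EuclideanSpace ℂ (Finset ι)) := (vacSpace ι m).comap e.toLinearMap
  have hV : Module.finrank ℂ V = N := by
    rw [← hN]
    exact (e.ofSubmodule' (vacSpace ι m)).finrank_eq
  let H : ι → (EuclideanSpace ℂ (Finset ι)) →ₗ[ℂ] (EuclideanSpace ℂ (Finset ι)) := fun i =>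
    { toFun := fun v => WithLp.toLp 2 (hamiltonian (gaudin x) i (WithLp.ofLp v))
      map_add' := fun v w => by rw [WithLp.ofLp_add, hamiltonian_add, WithLp.toLp_add]
      map_smul' := fun c v => by
        rw [WithLp.ofLp_smul, hamiltonian_smul, WithLp.toLp_smul, RingHom.id_apply] }
  have hH : ∀ i, ∀ v ∈ V, H i v ∈ V := fun i v hv => IsVac.hamiltonian hv (gaudin x) i
  have hinner : ∀ v w : EuclideanSpace ℂ (Finset ι),
      inner ℂ v w = ∑ I, star (v I) * w I := fun v w => by
    rw [PiLp.inner_apply]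
    refine sum_congr rfl fun I _ => ?_
    rw [RCLike.inner_apply', RCLike.star_def]
  have hHs : ∀ i, (H i).IsSymmetric := fun i v w => by
    rw [hinner, hinner]
    exact (sum_star_mul_hamiltonian (gaudin x) i (WithLp.ofLp v) (WithLp.ofLp w)).symm
  have hHc : ∀ i j v, H i (H j v) = H j (H i v) := fun i j v =>
    congrArg (WithLp.toLp 2) (hamiltonian_gaudin_comm hx i j (WithLp.ofLp v))
  obtain ⟨b, hbo, hbV, q, hb⟩ := exists_joint_eigenvectors H hHs V hH hHc hV
  refine ⟨fun a => WithLp.ofLp (b a), q, fun a c => ?_, fun a => hbV a, fun a i => ?_⟩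
  · rw [← hinner]
    exact orthonormal_iff_ite.1 hbo a c
  · exact congrArg WithLp.ofLp (hb a i)

end Gaudin

namespace Gaudin

open Finset

variable {ι : Type*} [Fintype ι] [DecidableEq ι] {m : ℕ}

lemma eigenvector_of_ode {x : ι → ℝ} (hx : Function.Injective x)
    (hm : Fintype.card ι = 2 * m) {q : ι → ℂ} {h : ℂ[X]}
    (hh : ode (fun i => (x i : ℂ)) q h = 0) {p : ℝ} (hp : ∀ i, x i ≠ p) {κ : ℂ} (hκ : κ ≠ 0)
    {t : Fin m → ℂ} (ht : Function.Injective t) (htp : ∀ l, t l ≠ p) (htx : ∀ l i, t l ≠ x i)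
    (hh' : h = C κ * ((X - C (p : ℂ)) * ∏ l, (X - C (t l)))) :
    IsVac m (bethe (fun i => ((x i : ℂ) - p)⁻¹) (fun l => (t l - p)⁻¹)) ∧
    bethe (fun i => ((x i : ℂ) - p)⁻¹) (fun l => (t l - p)⁻¹) ≠ 0 ∧
    ∀ i, hamiltonian (gaudin x) i
        (bethe (fun i => ((x i : ℂ) - p)⁻¹) (fun l => (t l - p)⁻¹)) =
      q i • bethe (fun i => ((x i : ℂ) - p)⁻¹) (fun l => (t l - p)⁻¹) := by
  have hxC : Function.Injective fun i => (x i : ℂ) := Complex.ofReal_injective.comp hx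
  have hpC : ∀ i, (x i : ℂ) ≠ p := fun i => by exact_mod_cast hp i
  obtain ⟨h1, ⟨I, h2⟩, h3⟩ := hamiltonian_bethe_inv hx hm hp ht htx htp
    (bethe_of_ode hh hκ ht htx htp hh')
  refine ⟨h1, fun h => h2 (by rw [h]; rfl), fun i => funext fun I => ?_⟩
  rw [h3, residue_eq_of_ode hxC hh hκ htx hpC hh' i]
  rfl

/-- Two polynomials whose Wronskian is a multiple of a squarefree polynomial do not vanish
simultaneously. -/
lemma eval_ne_zero_of_wronskian {K : Type*} [Field K] {f g w : K[X]} (hw : wronskian f g = w)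
    {z : K} (hz : w.eval z ≠ 0 ∨ (derivative w).eval z ≠ 0) : f.eval z ≠ 0 ∨ g.eval z ≠ 0 := by
  by_contra! h
  have h1 : w.eval z = 0 := by rw [← hw]; simp [wronskian, h.1, h.2]
  have h2 : (derivative w).eval z = 0 := by
    rw [← hw]
    simp only [wronskian, derivative_sub, derivative_mul, eval_sub, eval_add, eval_mul, h.1, h.2]
    ring
  exact hz.elim (· h1) (· h2)

lemma eval_ne_zero_of_wronskian_critPoly {K : Type*} [Field K] {x : ι → K}
    (hx : Function.Injective x) {f g : K[X]} {c : K} (hc : c ≠ 0)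
    (hw : wronskian f g = C c * critPoly x) (z : K) : f.eval z ≠ 0 ∨ g.eval z ≠ 0 := by
  refine eval_ne_zero_of_wronskian hw ?_
  by_cases hz : ∃ i, z = x i
  · obtain ⟨i, rfl⟩ := hz
    right
    rw [derivative_C_mul, eval_C_mul]
    exact mul_ne_zero hc (eval_derivative_critPoly_ne_zero hx i)
  · left
    rw [eval_C_mul]
    exact mul_ne_zero hc fun h => hz (eval_critPoly_eq_zero.1 h)

/-- Common eigenvectors attached to a complex solution space of the differential equation. -/
lemma exists_eigenvector {x : ι → ℝ} (hx : Function.Injective x)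
    (hm : Fintype.card ι = 2 * m) {q : ι → ℂ} {f g : ℂ[X]} (hf : f.natDegree ≤ m + 1)
    (hg : g.natDegree ≤ m + 1) {c : ℂ} (hc : c ≠ 0)
    (hw : wronskian f g = C c * critPoly (fun i => (x i : ℂ)))
    (hfq : ode (fun i => (x i : ℂ)) q f = 0) (hgq : ode (fun i => (x i : ℂ)) q g = 0) :
    ∃ ψ : Finset ι → ℂ, IsVac m ψ ∧ ψ ≠ 0 ∧ ∀ i, hamiltonian (gaudin x) i ψ = q i • ψ := by
  have hxC : Function.Injective fun i => (x i : ℂ) := Complex.ofReal_injective.comp hx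
  obtain ⟨p, hp, κ, hκ, t, ht, htp, htx, hh'⟩ := exists_general_position hm hf hg hc hw
    fun i => eval_ne_zero_of_wronskian_critPoly hxC hc hw _
  have hh : ode (fun i => (x i : ℂ)) q
      (C (g.eval (p : ℂ)) * f - C (f.eval (p : ℂ)) * g) = 0 := by
    rw [ode_sub, ode_C_mul, ode_C_mul, hfq, hgq]; simp
  exact ⟨_, eigenvector_of_ode hx hm hh hp hκ ht htp htx hh'⟩

section Diag

variable {N : ℕ} {A : ι → ι → ℝ} {b : Fin N → Finset ι → ℂ} {q : Fin N → ι → ℝ}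

lemma IsDiag.ne_zero (h : IsDiag m A b q) (a : Fin N) : b a ≠ 0 := fun h0 => by
  have := h.ortho a a
  simp [h0] at this

lemma IsDiag.sum_star_mul_hamiltonian_self (h : IsDiag m A b q) (a : Fin N) (i : ι) :
    ∑ I, star (b a I) * hamiltonian A i (b a) I = q a i := by
  rw [h.eig a i]
  have := h.ortho a a
  simp only [if_true] at this
  simp only [Pi.smul_apply, smul_eq_mul, mul_left_comm, ← mul_sum, this, mul_one]

lemma sum_star_mul_of_eigenvector (h : IsDiag m A b q) {ψ : Finset ι → ℂ} {z : ℂ} {i : ι}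
    (hψ : hamiltonian A i ψ = z • ψ) (a : Fin N) :
    z * ∑ I, star (b a I) * ψ I = q a i * ∑ I, star (b a I) * ψ I := by
  have h1 := sum_star_mul_hamiltonian A i (b a) ψ
  rw [hψ, h.eig a i] at h1
  simp only [Pi.smul_apply, smul_eq_mul, star_mul', RCLike.star_def, Complex.conj_ofReal] at h1
  simp only [RCLike.star_def, mul_sum]
  refine Eq.trans (sum_congr rfl fun I _ => ?_) (h1.trans (sum_congr rfl fun I _ => ?_)) <;> ring

/-- A singular vector orthogonal to the whole family vanishes. -/
lemma IsDiag.exists_sum_ne_zero (h : IsDiag m A b q)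
    (hN : Module.finrank ℂ (vacSpace ι m) = N) {ψ : Finset ι → ℂ} (hψ : IsVac m ψ)
    (hψ0 : ψ ≠ 0) : ∃ a, ∑ I, star (b a I) * ψ I ≠ 0 := by
  let v : Fin N → vacSpace ι m := fun a => ⟨b a, h.vac a⟩
  have pair : ∀ (g : Fin N → ℂ) c, ∑ I, star (b c I) * (∑ a, g a • b a) I = g c := by
    intro g c
    simp only [Finset.sum_apply, Pi.smul_apply, smul_eq_mul, mul_sum]
    rw [sum_comm]
    have : ∀ a ∈ univ, ∑ I, star (b c I) * (g a * b a I) = g a * if c = a then 1 else 0 :=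
      fun a _ => by
        rw [← h.ortho c a, mul_sum]
        exact sum_congr rfl fun I _ => by ring
    rw [sum_congr rfl this]
    simp
  have hv : LinearIndependent ℂ v := by
    rw [Fintype.linearIndependent_iff]
    intro g hg c
    have h1 : ∑ a, g a • b a = 0 := by
      have := congrArg Subtype.val hg
      simpa [v] using this
    rw [← pair g c, h1]; simp
  have hspan := hv.span_eq_top_of_card_eq_finrank' (by rw [Fintype.card_fin, hN])
  have hmem : (⟨ψ, hψ⟩ : vacSpace ι m) ∈ Submodule.span ℂ (Set.range v) := by
    rw [hspan]; trivial
  obtain ⟨g, hg⟩ := (Submodule.mem_span_range_iff_exists_fun ℂ).1 hmem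
  have hg' : ∑ a, g a • b a = ψ := by
    have := congrArg Subtype.val hg
    simpa [v] using this
  obtain ⟨a, ha⟩ : ∃ a, g a ≠ 0 := by
    by_contra! h0
    exact hψ0 (by rw [← hg']; simp [h0])
  exact ⟨a, by rwa [← hg', pair g a]⟩

/-- Every joint eigenvalue on singular vectors is in the list. -/
lemma IsDiag.complete (h : IsDiag m A b q) (hN : Module.finrank ℂ (vacSpace ι m) = N)
    {ψ : Finset ι → ℂ} (hψ : IsVac m ψ) (hψ0 : ψ ≠ 0) {z : ι → ℂ}
    (hz : ∀ i, hamiltonian A i ψ = z i • ψ) : ∃ a, ∀ i, z i = q a i := by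
  obtain ⟨a, ha⟩ := h.exists_sum_ne_zero hN hψ hψ0
  exact ⟨a, fun i => mul_right_cancel₀ ha (sum_star_mul_of_eigenvector h (hz i) a)⟩

/-- Simplicity of the joint spectrum does not depend on the diagonalizing family. -/
lemma IsDiag.injective_of_injective (h : IsDiag m A b q)
    (hN : Module.finrank ℂ (vacSpace ι m) = N) (hq : Function.Injective q)
    {b' : Fin N → Finset ι → ℂ} {q' : Fin N → ι → ℝ} (h' : IsDiag m A b' q') :
    Function.Injective q' := by
  intro a c hac
  by_contra hne
  set α := fun e => ∑ I, star (b e I) * b' a I with hα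
  set β := fun e => ∑ I, star (b e I) * b' c I with hβ
  obtain ⟨e, he⟩ := h.exists_sum_ne_zero hN (h'.vac a) (h'.ne_zero a)
  set ψ : Finset ι → ℂ := β e • b' a + (-α e) • b' c with hψ
  have hpair : ∀ φ : Finset ι → ℂ, ∑ I, star (φ I) * ψ I =
      β e * ∑ I, star (φ I) * b' a I - α e * ∑ I, star (φ I) * b' c I := fun φ => by
    rw [mul_sum, mul_sum, ← sum_sub_distrib]
    refine sum_congr rfl fun I _ => ?_
    simp only [hψ, Pi.add_apply, Pi.smul_apply, smul_eq_mul]; ring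
  have hψv : IsVac m ψ := mem_vacSpace.1 <| Submodule.add_mem _
    (Submodule.smul_mem _ _ (h'.vac a)) (Submodule.smul_mem _ _ (h'.vac c))
  have hψ0 : ψ ≠ 0 := fun h0 => by
    have h1 := hpair (b' c)
    rw [h0, h'.ortho c a, h'.ortho c c, if_neg (Ne.symm hne), if_pos rfl] at h1
    have h2 : α e = 0 := by simpa using h1
    exact he h2
  have hψe : ∀ i, hamiltonian A i ψ = (q' a i : ℂ) • ψ := fun i => by
    rw [hψ, hamiltonian_add, hamiltonian_smul, hamiltonian_smul, h'.eig a i, h'.eig c i, ← hac,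
      smul_add, smul_comm, smul_comm (-α e)]
  obtain ⟨e', he'⟩ := h.exists_sum_ne_zero hN hψv hψ0
  have h1 : ∀ i, (q' a i : ℂ) = q e' i := fun i =>
    mul_right_cancel₀ he' (sum_star_mul_of_eigenvector h (hψe i) e')
  have h2 : ∀ i, (q' a i : ℂ) = q e i := fun i =>
    mul_right_cancel₀ he (sum_star_mul_of_eigenvector h (h'.eig a i) e)
  have h3 : e' = e := hq (funext fun i => by exact_mod_cast (h1 i).symm.trans (h2 i))
  rw [h3, hpair] at he'
  exact he' (by simp only [hα, hβ]; ring)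

lemma IsDiag.norm_le_one (h : IsDiag m A b q) : ‖b‖ ≤ 1 := by
  refine (pi_norm_le_iff_of_nonneg zero_le_one).2 fun a =>
    (pi_norm_le_iff_of_nonneg zero_le_one).2 fun I => ?_
  have h1 := h.ortho a a
  rw [sum_normSq_eq_ofReal, if_pos rfl] at h1
  have h2 : ∑ I, ‖b a I‖ ^ 2 = 1 := by exact_mod_cast h1
  have h3 : ‖b a I‖ ^ 2 ≤ 1 := by
    rw [← h2]
    exact single_le_sum (f := fun I => ‖b a I‖ ^ 2) (fun _ _ => by positivity) (mem_univ I)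
  exact (sq_le_one_iff₀ (norm_nonneg _)).1 h3

open Filter Topology

lemma tendsto_hamiltonian {A : ℕ → ι → ι → ℝ} {A₀ : ι → ι → ℝ} {ψ : ℕ → Finset ι → ℂ}
    {ψ₀ : Finset ι → ℂ} (hA : Tendsto A atTop (𝓝 A₀)) (hψ : Tendsto ψ atTop (𝓝 ψ₀)) (i : ι) :
    Tendsto (fun k => hamiltonian (A k) i (ψ k)) atTop (𝓝 (hamiltonian A₀ i ψ₀)) := by
  rw [tendsto_pi_nhds] at hψ ⊢
  have hA' : ∀ i j, Tendsto (fun k => A k i j) atTop (𝓝 (A₀ i j)) := fun i j =>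
    tendsto_pi_nhds.1 (tendsto_pi_nhds.1 hA i) j
  intro I
  refine tendsto_finsetSum _ fun j _ => ?_
  exact ((Complex.continuous_ofReal.tendsto _).comp (hA' i j)).mul ((hψ _).sub (hψ _))

lemma exists_subseq_isDiag {A : ℕ → ι → ι → ℝ} {A₀ : ι → ι → ℝ} (hA : Tendsto A atTop (𝓝 A₀))
    {b : ℕ → Fin N → Finset ι → ℂ} {q : ℕ → Fin N → ι → ℝ} (h : ∀ k, IsDiag m (A k) (b k) (q k)) :
    ∃ φ : ℕ → ℕ, StrictMono φ ∧ ∃ b₀ q₀, Tendsto (fun k => b (φ k)) atTop (𝓝 b₀) ∧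
      Tendsto (fun k => q (φ k)) atTop (𝓝 q₀) ∧ IsDiag m A₀ b₀ q₀ := by
  obtain ⟨b₀, -, φ, hφ, hb⟩ := (isCompact_closedBall (0 : Fin N → Finset ι → ℂ) 1).tendsto_subseq
    (x := b) fun k => by simpa using (h k).norm_le_one
  have hA' := hA.comp hφ.tendsto_atTop
  have hb1 : ∀ a, Tendsto (fun k => b (φ k) a) atTop (𝓝 (b₀ a)) := tendsto_pi_nhds.1 hb
  have hb2 : ∀ a I, Tendsto (fun k => b (φ k) a I) atTop (𝓝 (b₀ a I)) := fun a =>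
    tendsto_pi_nhds.1 (hb1 a)
  have hH : ∀ a i, Tendsto (fun k => hamiltonian (A (φ k)) i (b (φ k) a)) atTop
    (𝓝 (hamiltonian A₀ i (b₀ a))) := fun a i => tendsto_hamiltonian hA' (hb1 a) i
  let q₁ : Fin N → ι → ℂ := fun a i => ∑ I, star (b₀ a I) * hamiltonian A₀ i (b₀ a) I
  have hq1 : ∀ a i, Tendsto (fun k => (q (φ k) a i : ℂ)) atTop (𝓝 (q₁ a i)) := by
    intro a i
    have : ∀ k, (q (φ k) a i : ℂ) =
        ∑ I, star (b (φ k) a I) * hamiltonian (A (φ k)) i (b (φ k) a) I := fun k =>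
      ((h (φ k)).sum_star_mul_hamiltonian_self a i).symm
    simp only [this]
    exact tendsto_finsetSum _ fun I _ =>
      ((continuous_star.tendsto _).comp (hb2 a I)).mul (tendsto_pi_nhds.1 (hH a i) I)
  have hq2 : ∀ a i, Tendsto (fun k => q (φ k) a i) atTop (𝓝 (q₁ a i).re) := fun a i =>
    (Complex.continuous_re.tendsto _).comp (hq1 a i)
  have hq3 : ∀ a i, q₁ a i = ((q₁ a i).re : ℂ) := fun a i =>
    tendsto_nhds_unique (hq1 a i) ((Complex.continuous_ofReal.tendsto _).comp (hq2 a i))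
  refine ⟨φ, hφ, b₀, fun a i => (q₁ a i).re, hb, ?_, ?_, ?_, ?_⟩
  · exact tendsto_pi_nhds.2 fun a => tendsto_pi_nhds.2 fun i => hq2 a i
  · intro a c
    refine tendsto_nhds_unique (tendsto_finsetSum _ fun I _ =>
      ((continuous_star.tendsto _).comp (hb2 a I)).mul (hb2 c I)) ?_
    simp only [Function.comp_def, (h _).ortho a c]
    exact tendsto_const_nhds
  · intro a
    refine ⟨fun I hI => tendsto_nhds_unique (hb2 a I) ?_, fun J hJ hJm => ?_⟩
    · simp only [((h _).vac a).1 I hI]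
      exact tendsto_const_nhds
    · refine tendsto_nhds_unique (tendsto_finsetSum _ fun j _ => hb2 a (insert j J)) ?_
      have : ∀ k, ∑ j ∈ univ \ J, b (φ k) a (insert j J) = 0 := fun k =>
        ((h (φ k)).vac a).2 J hJ hJm
      simp only [this]
      exact tendsto_const_nhds
  · intro a i
    refine tendsto_nhds_unique (hH a i) ?_
    simp only [(h _).eig a i]
    rw [← hq3]
    exact (hq1 a i).smul (hb1 a)

end Diag

end Gaudin

namespace Gaudin

open Finset

section Limits

open Filter Topology

/-- The polynomial with a given coefficient vector. -/
noncomputable def ofVec {M : ℕ} (v : Fin M → ℂ) : ℂ[X] := ∑ j, C (v j) * X ^ (j : ℕ)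

lemma coeff_ofVec {M : ℕ} (v : Fin M → ℂ) (j : Fin M) : (ofVec v).coeff j = v j := by
  simp only [ofVec, finsetSum_coeff, coeff_C_mul, coeff_X_pow]
  rw [sum_eq_single j]
  · simp
  · intro i _ hi
    rw [if_neg fun h => hi (Fin.ext h.symm), mul_zero]
  · simp

lemma degree_ofVec_lt {M : ℕ} (v : Fin M → ℂ) : (ofVec v).degree < M := by
  refine (degree_sum_le _ _).trans_lt
    ((Finset.sup_lt_iff (WithBot.bot_lt_coe M)).2 fun j _ =>
      (degree_C_mul_X_pow_le _ _).trans_lt (WithBot.coe_lt_coe.2 j.2))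

lemma natDegree_ofVec_le {M : ℕ} (v : Fin (M + 1) → ℂ) : (ofVec v).natDegree ≤ M := by
  have := degree_ofVec_lt v
  refine natDegree_le_of_degree_lt_succ ?_
  exact_mod_cast this

lemma ofVec_smul {M : ℕ} (c : ℂ) (v : Fin M → ℂ) : ofVec (c • v) = C c * ofVec v := by
  simp only [ofVec, mul_sum, Pi.smul_apply, smul_eq_mul, C_mul, mul_assoc]

lemma ofVec_coeff {M : ℕ} {h : ℂ[X]} (hh : h.natDegree ≤ M) :
    ofVec (fun j : Fin (M + 1) => h.coeff j) = h := by
  rw [ofVec, Fin.sum_univ_eq_sum_range (fun j => C (h.coeff j) * X ^ j) (M + 1)]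
  exact (as_sum_range_C_mul_X_pow' h (Nat.lt_succ_of_le hh)).symm

lemma tendsto_eval_ofVec {M : ℕ} {v : ℕ → Fin M → ℂ} {v₀ : Fin M → ℂ}
    (hv : Tendsto v atTop (𝓝 v₀)) (D : ℂ[X] →ₗ[ℂ] ℂ) :
    Tendsto (fun k => D (ofVec (v k))) atTop (𝓝 (D (ofVec v₀))) := by
  simp only [ofVec, ← smul_eq_C_mul, map_sum, _root_.map_smul, smul_eq_mul]
  exact tendsto_finsetSum _ fun j _ => (tendsto_pi_nhds.1 hv j).mul tendsto_const_nhds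

variable {ι : Type*} [Fintype ι] [DecidableEq ι] {m : ℕ}

lemma tendsto_eval_ode {M : ℕ} {v : ℕ → Fin M → ℂ} {v₀ : Fin M → ℂ}
    (hv : Tendsto v atTop (𝓝 v₀)) {x q : ℕ → ι → ℂ} {x₀ q₀ : ι → ℂ}
    (hx : Tendsto x atTop (𝓝 x₀)) (hq : Tendsto q atTop (𝓝 q₀)) (z : ℂ) :
    Tendsto (fun k => (ode (x k) (q k) (ofVec (v k))).eval z) atTop
      (𝓝 ((ode x₀ q₀ (ofVec v₀)).eval z)) := by
  have hx' := fun i => tendsto_pi_nhds.1 hx i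
  have hq' := fun i => tendsto_pi_nhds.1 hq i
  have h0 := tendsto_eval_ofVec hv (leval z)
  have h1 := tendsto_eval_ofVec hv (leval z ∘ₗ derivative)
  have h2 := tendsto_eval_ofVec hv (leval z ∘ₗ derivative ∘ₗ derivative)
  simp only [LinearMap.comp_apply, leval_apply] at h0 h1 h2
  have e1 : ∀ x : ι → ℂ, (critPoly x).eval z = ∏ i, (z - x i) := fun x => by
    rw [critPoly, Lagrange.eval_nodal]
  have e2 : ∀ x : ι → ℂ, (derivative (critPoly x)).eval z =
      ∑ i, ∏ j ∈ univ.erase i, (z - x j) := fun x => by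
    rw [critPoly, Lagrange.derivative_nodal, eval_finsetSum]
    exact sum_congr rfl fun i _ => by rw [Lagrange.eval_nodal]
  have e3 : ∀ x q : ι → ℂ, (potential x q).eval z =
      ∑ i, q i * ∏ j ∈ univ.erase i, (z - x j) := fun x q => by
    rw [potential, eval_finsetSum]
    exact sum_congr rfl fun i _ => by simp [eval_prod]
  simp only [ode, eval_add, eval_sub, eval_mul, e1, e2, e3]
  have hd : ∀ i, Tendsto (fun k => z - x k i) atTop (𝓝 (z - x₀ i)) := fun i =>
    tendsto_const_nhds.sub (hx' i)
  have hp : ∀ s : Finset ι, Tendsto (fun k => ∏ i ∈ s, (z - x k i)) atTop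
    (𝓝 (∏ i ∈ s, (z - x₀ i))) := fun s => tendsto_finsetProd _ fun i _ => hd i
  refine ((((hp _).mul h2).sub ((tendsto_finsetSum _ fun i _ => hp _).mul h1)).add
    ((tendsto_finsetSum _ fun i _ => (hq' i).mul (hp _)).mul h0))

/-- Normalized solutions vanishing at a given point subconverge. -/
lemma exists_subseq_solution {x q : ℕ → ι → ℝ} {x₀ q₀ : ι → ℝ} (hm0 : 1 ≤ m)
    (hm : Fintype.card ι = 2 * m) (hinj : ∀ k, Function.Injective (x k))
    (hs : ∀ k, IsSpectral m (x k) (q k)) (hx : Tendsto x atTop (𝓝 x₀))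
    (hq : Tendsto q atTop (𝓝 q₀)) (p : ℂ) :
    ∃ φ : ℕ → ℕ, StrictMono φ ∧ ∃ (v : ℕ → Fin (m + 1 + 1) → ℂ) (v₀ : Fin (m + 1 + 1) → ℂ),
      Tendsto v atTop (𝓝 v₀) ∧ (∀ k, ‖v k‖ = 1) ∧ ‖v₀‖ = 1 ∧
      (∀ k, ode (fun i => (x (φ k) i : ℂ)) (fun i => (q (φ k) i : ℂ)) (ofVec (v k)) = 0) ∧
      (∀ k, (ofVec (v k)).eval p = 0) ∧
      ode (fun i => (x₀ i : ℂ)) (fun i => (q₀ i : ℂ)) (ofVec v₀) = 0 ∧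
      (ofVec v₀).eval p = 0 := by
  have key : ∀ k, ∃ v : Fin (m + 1 + 1) → ℂ, ‖v‖ = 1 ∧
      ode (fun i => (x k i : ℂ)) (fun i => (q k i : ℂ)) (ofVec v) = 0 ∧
      (ofVec v).eval p = 0 := by
    intro k
    have hxC : Function.Injective fun i => (x k i : ℂ) := Complex.ofReal_injective.comp (hinj k)
    obtain ⟨f, g, hf, hg, hfd, hgd, c, hc, hw⟩ := exists_solutions (m := m)
      (q := fun i => (q k i : ℂ)) hxC hm0 hm
      (by exact_mod_cast (hs k).sum_eq) (by exact_mod_cast (hs k).sum_mul_eq)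
      (fun i => by exact_mod_cast (hs k).sq_eq i)
    have hfg := eval_ne_zero_of_wronskian_critPoly hxC hc hw p
    have hw0 : wronskian f g ≠ 0 := by
      rw [hw]; exact mul_ne_zero (C_ne_zero.2 hc) (critPoly_monic _).ne_zero
    set h := C (f.eval p) * g - C (g.eval p) * f with hh
    have h0 : h ≠ 0 := linear_comb_ne_zero hw0 hfg
    have hd : h.natDegree ≤ m + 1 := (natDegree_sub_le _ _).trans
      (max_le ((natDegree_C_mul_le _ _).trans hgd) ((natDegree_C_mul_le _ _).trans hfd))
    set w : Fin (m + 1 + 1) → ℂ := fun j => h.coeff j with hwdef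
    have hwv : ofVec w = h := ofVec_coeff hd
    have hwn : w ≠ 0 := fun e => h0 (by rw [← hwv, e]; simp [ofVec])
    refine ⟨((‖w‖⁻¹ : ℝ) : ℂ) • w, ?_, ?_, ?_⟩
    · rw [norm_smul, Complex.norm_real, norm_inv, norm_norm,
        inv_mul_cancel₀ (norm_ne_zero_iff.2 hwn)]
    · rw [ofVec_smul, hwv, ode_C_mul, hh, ode_sub, ode_C_mul, ode_C_mul, hf, hg]; simp
    · rw [ofVec_smul, hwv, hh]; simp [mul_comm]
  choose v hv1 hv2 hv3 using key
  obtain ⟨v₀, hv₀, φ, hφ, hlim⟩ := (isCompact_sphere (0 : Fin (m + 1 + 1) → ℂ) 1).tendsto_subseq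
    (x := v) fun k => by simpa using hv1 k
  have cast : ∀ {y : ℕ → ι → ℝ} {y₀ : ι → ℝ}, Tendsto y atTop (𝓝 y₀) →
      Tendsto (fun k i => (y (φ k) i : ℂ)) atTop (𝓝 fun i => (y₀ i : ℂ)) := fun hy =>
    tendsto_pi_nhds.2 fun i => (Complex.continuous_ofReal.tendsto _).comp
      ((tendsto_pi_nhds.1 hy i).comp hφ.tendsto_atTop)
  refine ⟨φ, hφ, fun k => v (φ k), v₀, hlim, fun k => hv1 _, by simpa using hv₀, fun k => hv2 _,
    fun k => hv3 _, ?_, ?_⟩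
  · refine Polynomial.funext fun z => ?_
    refine tendsto_nhds_unique (tendsto_eval_ode hlim (cast hx) (cast hq) z) ?_
    simp only [Function.comp_apply, hv2]
    simpa using tendsto_const_nhds
  · refine tendsto_nhds_unique (tendsto_eval_ofVec hlim (leval p)) ?_
    simp only [Function.comp_apply, leval_apply, hv3]
    exact tendsto_const_nhds

lemma exists_perm_of_prod_eq {t s : Fin m → ℂ} (ht : Function.Injective t)
    (h : ∏ l, (X - C (t l)) = ∏ l, (X - C (s l))) :
    ∃ e : Equiv.Perm (Fin m), t = s ∘ e := by
  have h1 : ∀ l, ∃ k, t l = s k := fun l => by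
    have h2 := congrArg (eval (t l)) h
    rw [eval_prod, eval_prod, prod_eq_zero (mem_univ l) (by simp)] at h2
    obtain ⟨k, _, hk⟩ := prod_eq_zero_iff.1 h2.symm
    exact ⟨k, by simpa [sub_eq_zero] using hk⟩
  choose e he using h1
  have hinj : Function.Injective e := fun a b hab => ht (by rw [he a, he b, hab])
  exact ⟨Equiv.ofBijective e (Finite.injective_iff_bijective.1 hinj), funext he⟩

/-- Convergence of the roots of a convergent sequence of polynomials with a common root. -/
lemma exists_subseq_roots {v : ℕ → Fin (m + 1 + 1) → ℂ} {v₀ : Fin (m + 1 + 1) → ℂ}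
    (hv : Tendsto v atTop (𝓝 v₀)) (hv1 : ∀ k, ‖v k‖ = 1) {p : ℂ}
    (hp : ∀ k, (ofVec (v k)).eval p = 0) {μ : ℂ} (hμ : μ ≠ 0) {t₀ : Fin m → ℂ}
    (ht₀ : Function.Injective t₀)
    (h₀ : ofVec v₀ = C μ * ((X - C p) * ∏ l, (X - C (t₀ l)))) :
    ∃ φ : ℕ → ℕ, StrictMono φ ∧ ∃ (κ : ℕ → ℂ) (t : ℕ → Fin m → ℂ), (∀ k, κ k ≠ 0) ∧
      Tendsto t atTop (𝓝 t₀) ∧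
      ∀ k, ofVec (v (φ k)) = C (κ k) * ((X - C p) * ∏ l, (X - C (t k l))) := by
  have hmon : ∀ t : Fin m → ℂ, ((X - C p) * ∏ l, (X - C (t l))).Monic := fun t =>
    (monic_X_sub_C p).mul (monic_prod_X_sub_C t univ)
  have hdeg : ∀ t : Fin m → ℂ, ((X - C p) * ∏ l, (X - C (t l))).natDegree = m + 1 := fun t => by
    rw [Monic.natDegree_mul (monic_X_sub_C p) (monic_prod_X_sub_C t univ), natDegree_X_sub_C,
      natDegree_finsetProd_X_sub_C_eq_card]
    simp [add_comm]
  have hlast : v₀ (Fin.last (m + 1)) = μ := by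
    rw [← coeff_ofVec v₀, h₀, coeff_C_mul, Fin.val_last, ← hdeg t₀, (hmon t₀).coeff_natDegree,
      mul_one]
  have hlim : Tendsto (fun k => ‖v k (Fin.last (m + 1))‖) atTop (𝓝 ‖μ‖) := by
    rw [← hlast]; exact (tendsto_pi_nhds.1 hv _).norm
  obtain ⟨K, hK⟩ := eventually_atTop.1
    (hlim.eventually (lt_mem_nhds (half_lt_self (norm_pos_iff.2 hμ))))
  have hpos : 0 < ‖μ‖ / 2 := half_pos (norm_pos_iff.2 hμ)
  have hκ : ∀ k, v (k + K) (Fin.last (m + 1)) ≠ 0 := fun k =>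
    norm_pos_iff.1 (hpos.trans (hK _ (by omega)))
  have key : ∀ k, ∃ t : Fin m → ℂ, ofVec (v (k + K)) =
      C (v (k + K) (Fin.last (m + 1))) * ((X - C p) * ∏ l, (X - C (t l))) := by
    intro k
    set h := ofVec (v (k + K)) with hh
    have hc : h.coeff (m + 1) = v (k + K) (Fin.last (m + 1)) := by
      rw [← coeff_ofVec (v (k + K))]; rfl
    have hd : h.natDegree = m + 1 := le_antisymm (natDegree_ofVec_le _)
      (le_natDegree_of_ne_zero (by rw [hc]; exact hκ k))
    have hl : h.leadingCoeff = v (k + K) (Fin.last (m + 1)) := by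
      rw [leadingCoeff, hd, hc]
    have hmon' : (C h.leadingCoeff⁻¹ * h).Monic := monic_C_mul_of_mul_leadingCoeff_eq_one
      (inv_mul_cancel₀ (by rw [hl]; exact hκ k))
    obtain ⟨u, hu⟩ := dvd_iff_isRoot.2 (show (C h.leadingCoeff⁻¹ * h).IsRoot p by
      rw [IsRoot, eval_mul, hp]; simp)
    rw [hu] at hmon'
    have humon : u.Monic := (monic_X_sub_C p).of_mul_monic_left hmon'
    have hudeg : u.natDegree = m := by
      have := congrArg natDegree hu
      rw [natDegree_C_mul (inv_ne_zero (by rw [hl]; exact hκ k)), hd,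
        Monic.natDegree_mul (monic_X_sub_C p) humon, natDegree_X_sub_C] at this
      omega
    obtain ⟨t, ht⟩ := exists_prod_fin humon hudeg
    refine ⟨t, ?_⟩
    rw [← ht, ← hu, hl, ← mul_assoc, ← C_mul, mul_inv_cancel₀ (hκ k)]; simp
  choose t ht using key
  have hbound : ∀ k, t k ∈ Metric.closedBall (0 : Fin m → ℂ) ((‖μ‖ / 2)⁻¹ + 1) := by
    intro k
    rw [mem_closedBall_zero_iff, pi_norm_le_iff_of_nonneg (by positivity)]
    intro l
    set h := ofVec (v (k + K)) with hh
    have h0 : h ≠ 0 := by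
      rw [hh, ht k]
      exact mul_ne_zero (C_ne_zero.2 (hκ k)) (hmon _).ne_zero
    have hroot : h.IsRoot (t k l) := by
      rw [IsRoot, hh, ht k, eval_mul, eval_mul, eval_prod, prod_eq_zero (mem_univ l) (by simp)]
      simp
    have hlead : h.leadingCoeff = v (k + K) (Fin.last (m + 1)) := by
      rw [hh, ht k, leadingCoeff_mul, leadingCoeff_C, (hmon _).leadingCoeff, mul_one]
    have h1 := hroot.norm_lt_cauchyBound h0
    have h2 : cauchyBound h ≤ (‖v (k + K) (Fin.last (m + 1))‖₊)⁻¹ + 1 := by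
      unfold cauchyBound
      refine add_le_add_left ?_ 1
      rw [hlead, div_eq_mul_inv]
      refine mul_le_of_le_one_left (zero_le) (Finset.sup_le fun j hj => ?_)
      have hj' : j < m + 1 + 1 := by
        have := mem_range.1 hj
        have : h.natDegree ≤ m + 1 := natDegree_ofVec_le (v (k + K))
        omega
      have h3 := coeff_ofVec (v (k + K)) ⟨j, hj'⟩
      have h4 := norm_le_pi_norm (v (k + K)) ⟨j, hj'⟩
      rw [hv1, ← h3] at h4
      exact h4
    have h5 : (cauchyBound h : ℝ) ≤ (‖v (k + K) (Fin.last (m + 1))‖)⁻¹ + 1 := by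
      exact_mod_cast h2
    have h1' : ‖t k l‖ ≤ cauchyBound h := by exact_mod_cast h1.le
    refine h1'.trans (h5.trans ?_)
    have := inv_anti₀ hpos (hK (k + K) (by omega)).le
    linarith
  obtain ⟨t₁, -, φ, hφ, hlimt⟩ :=
    (isCompact_closedBall (0 : Fin m → ℂ) ((‖μ‖ / 2)⁻¹ + 1)).tendsto_subseq hbound
  have hvφ : Tendsto (fun k => v (φ k + K)) atTop (𝓝 v₀) :=
    hv.comp ((tendsto_add_atTop_iff_nat K).2 tendsto_id |>.comp hφ.tendsto_atTop)
  have hpoly : ∏ l, (X - C (t₀ l)) = ∏ l, (X - C (t₁ l)) := by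
    have h1 : ofVec v₀ = C μ * ((X - C p) * ∏ l, (X - C (t₁ l))) := by
      refine Polynomial.funext fun z => ?_
      refine tendsto_nhds_unique (tendsto_eval_ofVec hvφ (leval z)) ?_
      simp only [leval_apply, ht, eval_mul, eval_C, eval_sub, eval_X, eval_prod]
      refine Tendsto.mul ?_ (tendsto_const_nhds.mul (tendsto_finsetProd _ fun l _ =>
        tendsto_const_nhds.sub (tendsto_pi_nhds.1 hlimt l)))
      rw [← hlast]
      exact tendsto_pi_nhds.1 hvφ _
    rw [h₀] at h1
    exact mul_left_cancel₀ (X_sub_C_ne_zero p) (mul_left_cancel₀ (C_ne_zero.2 hμ) h1)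
  obtain ⟨e, he⟩ := exists_perm_of_prod_eq ht₀ hpoly
  refine ⟨fun k => φ k + K, fun a b hab => Nat.add_lt_add_right (hφ hab) K,
    fun k => v (φ k + K) (Fin.last (m + 1)), fun k => t (φ k) ∘ e, fun k => hκ _, ?_, fun k => ?_⟩
  · rw [he]
    exact tendsto_pi_nhds.2 fun l => tendsto_pi_nhds.1 hlimt (e l)
  · rw [ht (φ k)]
    congr 2
    exact (Equiv.prod_comp e fun l => X - C (t (φ k) l)).symm

end Limits

end Gaudin

namespace Gaudin

open Finset

section Continuation

open Filter Topology

variable {ι : Type*} [Fintype ι] [DecidableEq ι] {m N : ℕ}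

lemma tendsto_bethe_inv {x : ℕ → ι → ℝ} {x₀ : ι → ℝ} (hx : Tendsto x atTop (𝓝 x₀))
    {t : ℕ → Fin m → ℂ} {t₀ : Fin m → ℂ} (ht : Tendsto t atTop (𝓝 t₀)) {p : ℝ}
    (hp : ∀ i, x₀ i ≠ p) (htp : ∀ l, t₀ l ≠ p) (htx : ∀ l i, t₀ l ≠ x₀ i) :
    Tendsto (fun k => bethe (fun i => ((x k i : ℂ) - p)⁻¹) (fun l => (t k l - p)⁻¹)) atTop
      (𝓝 (bethe (fun i => ((x₀ i : ℂ) - p)⁻¹) (fun l => (t₀ l - p)⁻¹))) := by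
  refine tendsto_pi_nhds.2 fun I => tendsto_finsetSum _ fun σ _ => tendsto_finsetProd _ fun l _ => ?_
  have h1 : Tendsto (fun k => t k l - (p : ℂ)) atTop (𝓝 (t₀ l - p)) :=
    (tendsto_pi_nhds.1 ht l).sub tendsto_const_nhds
  have h2 : Tendsto (fun k => (x k (σ l) : ℂ) - (p : ℂ)) atTop (𝓝 ((x₀ (σ l) : ℂ) - p)) :=
    ((Complex.continuous_ofReal.tendsto _).comp (tendsto_pi_nhds.1 hx _)).sub tendsto_const_nhds
  have hpC : (x₀ (σ l) : ℂ) ≠ p := by exact_mod_cast hp _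
  refine ((h1.inv₀ (sub_ne_zero.2 (htp l))).sub (h2.inv₀ (sub_ne_zero.2 hpC))).inv₀ ?_
  refine sub_ne_zero.2 fun h => htx l (σ l) ?_
  exact sub_left_injective (inv_injective h)

/-- A Bethe vector in general position at the limit is a limit of Bethe vectors. -/
lemma exists_bethe_seq {x q : ℕ → ι → ℝ} {x₀ q₀ : ι → ℝ} (hm0 : 1 ≤ m)
    (hm : Fintype.card ι = 2 * m) (hinj : ∀ k, Function.Injective (x k))
    (hinj₀ : Function.Injective x₀) (hs : ∀ k, IsSpectral m (x k) (q k))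
    (hx : Tendsto x atTop (𝓝 x₀)) (hq : Tendsto q atTop (𝓝 q₀)) {f g : ℂ[X]}
    (hf : ode (fun i => (x₀ i : ℂ)) (fun i => (q₀ i : ℂ)) f = 0)
    (hg : ode (fun i => (x₀ i : ℂ)) (fun i => (q₀ i : ℂ)) g = 0) {c : ℂ} (hc : c ≠ 0)
    (hw : wronskian f g = C c * critPoly (fun i => (x₀ i : ℂ))) {p : ℝ} (hp : ∀ i, x₀ i ≠ p)
    {κ : ℂ} (hκ : κ ≠ 0) {t₀ : Fin m → ℂ} (ht : Function.Injective t₀) (htp : ∀ l, t₀ l ≠ p)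
    (htx : ∀ l i, t₀ l ≠ x₀ i)
    (hh : C (g.eval (p : ℂ)) * f - C (f.eval (p : ℂ)) * g =
      C κ * ((X - C (p : ℂ)) * ∏ l, (X - C (t₀ l)))) :
    ∃ φ : ℕ → ℕ, StrictMono φ ∧ ∃ ψ : ℕ → Finset ι → ℂ,
      Tendsto ψ atTop (𝓝 (bethe (fun i => ((x₀ i : ℂ) - p)⁻¹) (fun l => (t₀ l - p)⁻¹))) ∧
      ∀ᶠ k in atTop, ∀ i, hamiltonian (gaudin (x (φ k))) i (ψ k) = (q (φ k) i : ℂ) • ψ k := by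
  have hxC : Function.Injective fun i => (x₀ i : ℂ) := Complex.ofReal_injective.comp hinj₀
  obtain ⟨φ, hφ, v, v₀, hv, hv1, hv₀1, hode, hvp, hode₀, hv₀p⟩ :=
    exists_subseq_solution hm0 hm hinj hs hx hq (p : ℂ)
  obtain ⟨a, b, hab⟩ := exists_eq_linear_comb hxC hc hw hf hg hode₀
  have hv₀0 : ofVec v₀ ≠ 0 := fun h0 => by
    have : v₀ = 0 := funext fun j => by rw [← coeff_ofVec v₀, h0]; simp
    rw [this, norm_zero] at hv₀1
    exact zero_ne_one hv₀1
  have hrel : a * f.eval (p : ℂ) + b * g.eval (p : ℂ) = 0 := by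
    rw [hab] at hv₀p; simpa using hv₀p
  obtain ⟨r, hr⟩ : ∃ r : ℂ, ofVec v₀ = C r *
      (C (g.eval (p : ℂ)) * f - C (f.eval (p : ℂ)) * g) := by
    rcases eval_ne_zero_of_wronskian_critPoly hxC hc hw (p : ℂ) with h1 | h1
    · refine ⟨-b / f.eval (p : ℂ), ?_⟩
      have ha : a = -b / f.eval (p : ℂ) * g.eval (p : ℂ) := by
        field_simp; linear_combination hrel
      have hb : b = b / f.eval (p : ℂ) * f.eval (p : ℂ) := by field_simp
      rw [hab]
      conv_lhs => rw [ha]; arg 2; rw [hb]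
      simp only [C_mul, neg_div, C_neg]; ring
    · refine ⟨a / g.eval (p : ℂ), ?_⟩
      have hb : b = -(a / g.eval (p : ℂ) * f.eval (p : ℂ)) := by
        field_simp; linear_combination hrel
      have ha : a = a / g.eval (p : ℂ) * g.eval (p : ℂ) := by field_simp
      rw [hab]
      conv_lhs => rw [hb]; arg 1; rw [ha]
      simp only [C_mul, C_neg]; ring
  have hr0 : r ≠ 0 := fun h0 => hv₀0 (by rw [hr, h0]; simp)
  rw [hh, ← mul_assoc, ← C_mul] at hr
  obtain ⟨φ', hφ', κ', t, hκ', hlim, hprod⟩ :=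
    exists_subseq_roots hv hv1 hvp (mul_ne_zero hr0 hκ) ht hr
  have hx' : Tendsto (fun k => x (φ (φ' k))) atTop (𝓝 x₀) :=
    hx.comp (hφ.comp hφ').tendsto_atTop
  have hxi : ∀ i, Tendsto (fun k => x (φ (φ' k)) i) atTop (𝓝 (x₀ i)) := tendsto_pi_nhds.1 hx'
  have hxiC : ∀ i, Tendsto (fun k => (x (φ (φ' k)) i : ℂ)) atTop (𝓝 (x₀ i : ℂ)) := fun i =>
    (Complex.continuous_ofReal.tendsto _).comp (hxi i)
  have htl : ∀ l, Tendsto (fun k => t k l) atTop (𝓝 (t₀ l)) := tendsto_pi_nhds.1 hlim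
  refine ⟨φ ∘ φ', hφ.comp hφ', _, tendsto_bethe_inv hx' hlim hp htp htx, ?_⟩
  have e1 : ∀ᶠ k in atTop, ∀ i, x (φ (φ' k)) i ≠ p :=
    eventually_all.2 fun i => (hxi i).eventually_ne (hp i)
  have e2 : ∀ᶠ k in atTop, ∀ l, t k l ≠ p :=
    eventually_all.2 fun l => (htl l).eventually_ne (htp l)
  have e3 : ∀ᶠ k in atTop, ∀ l i, t k l ≠ x (φ (φ' k)) i :=
    eventually_all.2 fun l => eventually_all.2 fun i => by
      have := ((htl l).sub (hxiC i)).eventually_ne (sub_ne_zero.2 (htx l i))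
      exact this.mono fun k hk => sub_ne_zero.1 hk
  have e4 : ∀ᶠ k in atTop, ∀ l l', l ≠ l' → t k l ≠ t k l' :=
    eventually_all.2 fun l => eventually_all.2 fun l' => by
      by_cases hl : l = l'
      · exact Eventually.of_forall fun k h => absurd hl h
      · have := ((htl l).sub (htl l')).eventually_ne (sub_ne_zero.2 fun h => hl (ht h))
        exact this.mono fun k hk _ => sub_ne_zero.1 hk
  filter_upwards [e1, e2, e3, e4] with k h1 h2 h3 h4
  exact (eigenvector_of_ode (hinj _) hm (hode (φ' k)) h1 (hκ' k)
    (fun l l' h => by by_contra hne; exact h4 l l' hne h) h2 h3 (hprod k)).2.2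

lemma sum_star_mul_eq_zero {A : ι → ι → ℝ} {i : ι} {φ ψ : Finset ι → ℂ} {a b : ℝ} (hab : a ≠ b)
    (hφ : hamiltonian A i φ = (a : ℂ) • φ) (hψ : hamiltonian A i ψ = (b : ℂ) • ψ) :
    ∑ I, star (φ I) * ψ I = 0 := by
  have h1 := sum_star_mul_hamiltonian A i φ ψ
  rw [hφ, hψ] at h1
  simp only [Pi.smul_apply, smul_eq_mul, star_mul', RCLike.star_def, Complex.conj_ofReal] at h1
  have h2 : ((b : ℂ) - a) * ∑ I, star (φ I) * ψ I = 0 := by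
    rw [sub_mul, mul_sum, mul_sum, sub_eq_zero]
    simp only [RCLike.star_def]
    refine Eq.trans (sum_congr rfl fun I _ => ?_) (h1.trans (sum_congr rfl fun I _ => ?_)) <;> ring
  exact (mul_eq_zero.1 h2).resolve_left (sub_ne_zero.2 (by exact_mod_cast hab.symm))

/-- Simplicity of the joint spectrum is preserved in limits of configurations of distinct
points. -/
lemma IsDiag.injective_of_tendsto {x : ℕ → ι → ℝ} {x₀ : ι → ℝ} (hm0 : 1 ≤ m)
    (hm : Fintype.card ι = 2 * m) (hinj : ∀ k, Function.Injective (x k))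
    (hinj₀ : Function.Injective x₀) (hx : Tendsto x atTop (𝓝 x₀))
    {b : ℕ → Fin N → Finset ι → ℂ} {q : ℕ → Fin N → ι → ℝ}
    (h : ∀ k, IsDiag m (gaudin (x k)) (b k) (q k)) (hqi : ∀ k, Function.Injective (q k))
    {b₀ : Fin N → Finset ι → ℂ} {q₀ : Fin N → ι → ℝ} (hq : Tendsto q atTop (𝓝 q₀))
    (h₀ : IsDiag m (gaudin x₀) b₀ q₀) : Function.Injective q₀ := by
  intro a c hac
  by_contra hne
  have hxC : Function.Injective fun i => (x₀ i : ℂ) := Complex.ofReal_injective.comp hinj₀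
  have hs₀ := isSpectral_of_eigenvector hinj₀ hm (h₀.vac a) (h₀.ne_zero a) (h₀.eig a)
  have hs : ∀ e k, IsSpectral m (x k) (q k e) := fun e k =>
    isSpectral_of_eigenvector (hinj k) hm ((h k).vac e) ((h k).ne_zero e) ((h k).eig e)
  obtain ⟨f, g, hf, hg, hfd, hgd, d, hd, hw⟩ := exists_solutions (m := m)
    (q := fun i => (q₀ a i : ℂ)) hxC hm0 hm
    (by exact_mod_cast hs₀.sum_eq) (by exact_mod_cast hs₀.sum_mul_eq)
    (fun i => by exact_mod_cast hs₀.sq_eq i)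
  obtain ⟨p, hp, κ, hκ, t, ht, htp, htx, hh⟩ := exists_general_position hm hfd hgd hd hw
    fun i => eval_ne_zero_of_wronskian_critPoly hxC hd hw _
  have hq' : ∀ e, Tendsto (fun k => q k e) atTop (𝓝 (q₀ e)) := tendsto_pi_nhds.1 hq
  obtain ⟨φ, hφ, ψ, hψ, hψe⟩ := exists_bethe_seq hm0 hm hinj hinj₀ (hs a) hx (hq' a) hf hg hd hw
    hp hκ ht htp htx hh
  obtain ⟨φ', hφ', ψ', hψ', hψe'⟩ := exists_bethe_seq (x := fun k => x (φ k))
    (q := fun k => q (φ k) c) hm0 hm (fun k => hinj _) hinj₀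
    (fun k => hs c (φ k)) (hx.comp hφ.tendsto_atTop)
    (hac ▸ (hq' c).comp hφ.tendsto_atTop) hf hg hd hw hp hκ ht htp htx hh
  set Ψ := bethe (fun i => ((x₀ i : ℂ) - p)⁻¹) (fun l => (t l - p)⁻¹) with hΨ
  have hΨ0 : Ψ ≠ 0 := by
    have hode : ode (fun i => (x₀ i : ℂ)) (fun i => (q₀ a i : ℂ))
        (C (g.eval (p : ℂ)) * f - C (f.eval (p : ℂ)) * g) = 0 := by
      rw [ode_sub, ode_C_mul, ode_C_mul, hf, hg]; simp
    exact (eigenvector_of_ode hinj₀ hm hode hp hκ ht htp htx hh).2.1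
  have hlim : Tendsto (fun k => ∑ I, star (ψ (φ' k) I) * ψ' k I) atTop
      (𝓝 (∑ I, star (Ψ I) * Ψ I)) :=
    tendsto_finsetSum _ fun I _ => ((continuous_star.tendsto _).comp
      ((tendsto_pi_nhds.1 hψ I).comp hφ'.tendsto_atTop)).mul (tendsto_pi_nhds.1 hψ' I)
  have hzero : ∀ᶠ k in atTop, ∑ I, star (ψ (φ' k) I) * ψ' k I = 0 := by
    filter_upwards [hφ'.tendsto_atTop.eventually hψe, hψe'] with k h1 h2
    obtain ⟨i, hi⟩ := Function.ne_iff.1 ((hqi (φ (φ' k))).ne hne)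
    exact sum_star_mul_eq_zero hi (h1 i) (h2 i)
  have h0 : ∑ I, star (Ψ I) * Ψ I = 0 :=
    tendsto_nhds_unique hlim (tendsto_const_nhds.congr' (hzero.mono fun k hk => hk.symm))
  exact hΨ0 (funext fun I => sum_normSq_eq_zero h0 I (mem_univ I))

lemma not_injective_of_tendsto {q : ℕ → Fin N → ι → ℝ} {q₀ : Fin N → ι → ℝ}
    (hq : Tendsto q atTop (𝓝 q₀)) (h : ∀ k, ¬ Function.Injective (q k)) :
    ¬ Function.Injective q₀ := by
  intro h0
  have : ∀ᶠ k in atTop, ∀ a c, a ≠ c → q k a ≠ q k c :=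
    eventually_all.2 fun a => eventually_all.2 fun c => by
      by_cases hac : a = c
      · exact Eventually.of_forall fun k h => absurd hac h
      · have := ((tendsto_pi_nhds.1 hq a).sub (tendsto_pi_nhds.1 hq c)).eventually_ne
          (sub_ne_zero.2 fun h => hac (h0 h))
        exact this.mono fun k hk _ => sub_ne_zero.1 hk
  obtain ⟨k, hk⟩ := this.exists
  exact h k fun a c hac => by by_contra hne; exact hk a c hne hac

lemma tendsto_gaudin {x : ℕ → ι → ℝ} {x₀ : ι → ℝ} (hx : Tendsto x atTop (𝓝 x₀))
    (hinj : Function.Injective x₀) :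
    Tendsto (fun k => gaudin (x k)) atTop (𝓝 (gaudin x₀)) := by
  refine tendsto_pi_nhds.2 fun i => tendsto_pi_nhds.2 fun j => ?_
  by_cases hij : i = j
  · subst hij
    simp only [gaudin_self]
    exact tendsto_const_nhds
  · exact ((tendsto_pi_nhds.1 hx i).sub (tendsto_pi_nhds.1 hx j)).inv₀
      (sub_ne_zero.2 fun h => hij (hinj h))

/-- The joint spectrum of the Gaudin Hamiltonians on singular vectors is simple. -/
def HasSimpleSpectrum (m N : ℕ) (x : ι → ℝ) : Prop :=
  ∃ (b : Fin N → Finset ι → ℂ) (q : Fin N → ι → ℝ), IsDiag m (gaudin x) b q ∧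
    Function.Injective q

lemma HasSimpleSpectrum.of_path (hm0 : 1 ≤ m) (hm : Fintype.card ι = 2 * m)
    (hN : Module.finrank ℂ (vacSpace ι m) = N) {γ : unitInterval → ι → ℝ} (hγ : Continuous γ)
    (hinj : ∀ s, Function.Injective (γ s)) (h0 : HasSimpleSpectrum m N (γ 0)) :
    HasSimpleSpectrum m N (γ 1) := by
  set T : Set unitInterval := {s | HasSimpleSpectrum m N (γ s)} with hT
  have hclosed : IsClosed T := by
    refine IsSeqClosed.isClosed fun u s hu hs => ?_
    choose b q hb hq using hu
    have hx : Tendsto (fun k => γ (u k)) atTop (𝓝 (γ s)) := (hγ.tendsto s).comp hs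
    obtain ⟨φ, hφ, b₀, q₀, -, hq₀, h₀⟩ := exists_subseq_isDiag (tendsto_gaudin hx (hinj s)) hb
    exact ⟨b₀, q₀, h₀, IsDiag.injective_of_tendsto hm0 hm (fun k => hinj _) (hinj s)
      (hx.comp hφ.tendsto_atTop) (fun k => hb (φ k)) (fun k => hq (φ k)) hq₀ h₀⟩
  have hopen : IsOpen T := by
    rw [← isClosed_compl_iff]
    refine IsSeqClosed.isClosed fun u s hu hs => ?_
    have hdiag := fun k => exists_isDiag (hinj (u k)) hN
    choose b q hb using hdiag
    have hx : Tendsto (fun k => γ (u k)) atTop (𝓝 (γ s)) := (hγ.tendsto s).comp hs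
    obtain ⟨φ, hφ, b₀, q₀, -, hq₀, h₀⟩ := exists_subseq_isDiag (tendsto_gaudin hx (hinj s)) hb
    rintro ⟨b', q', h', hq'⟩
    exact not_injective_of_tendsto hq₀ (fun k hk => hu (φ k) ⟨_, _, hb _, hk⟩)
      (h'.injective_of_injective hN hq' h₀)
  have huniv : T = Set.univ := IsClopen.eq_univ ⟨hclosed, hopen⟩ ⟨0, h0⟩
  have : (1 : unitInterval) ∈ T := by rw [huniv]; trivial
  exact this

section JucysMurphy

variable {n : ℕ}

lemma IsDiag.injective_jucysMurphy {b : Fin N → Finset (Fin n) → ℂ} {q : Fin N → Fin n → ℝ}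
    (h : IsDiag m (fun i j => if j < i then 1 else 0) b q) : Function.Injective q := by
  intro a c hac
  by_contra hne
  have key : ∀ e, IsJM univ m (fun i => (#{j | j < i} : ℂ) - q e i) (b e) := by
    intro e i _ I _ _
    have h1 := congrFun (h.eig e i) I
    simp only [hamiltonian, Pi.smul_apply, smul_eq_mul, apply_ite (Complex.ofReal),
      Complex.ofReal_one, Complex.ofReal_zero, ite_mul, one_mul, zero_mul] at h1
    rw [← sum_filter, sum_sub_distrib, sum_const, nsmul_eq_mul] at h1
    linear_combination -h1
  have key' : IsJM univ m (fun i => (#{j | j < i} : ℂ) - q a i) (b c) := by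
    rw [hac]; exact key c
  obtain ⟨α, β, hαβ, hz⟩ := IsJM.exists_linear_comb univ m _ _ _ (h.vac a).2 (h.vac c).2
    (key a) key'
  have hz' : ∀ I, α * b a I + β * b c I = 0 := fun I => by
    by_cases hI : #I = m
    · exact hz I (subset_univ I) hI
    · rw [(h.vac a).1 I hI, (h.vac c).1 I hI]; simp
  have hpair : ∀ e, α * (∑ I, star (b e I) * b a I) + β * (∑ I, star (b e I) * b c I) = 0 := by
    intro e
    rw [mul_sum, mul_sum, ← sum_add_distrib]
    refine sum_eq_zero fun I _ => ?_
    linear_combination star (b e I) * hz' I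
  have h1 := hpair a
  have h2 := hpair c
  simp only [h.ortho, if_true, if_neg hne, if_neg (Ne.symm hne)] at h1 h2
  rcases hαβ with h3 | h3
  · exact h3 (by linear_combination h1)
  · exact h3 (by linear_combination h2)

lemma tendsto_mul_gaudin_pow :
    Tendsto (fun (k : ℕ) (i j : Fin n) => ((k : ℝ) + 2) ^ (i : ℕ) *
      gaudin (fun l : Fin n => ((k : ℝ) + 2) ^ (l : ℕ)) i j) atTop
      (𝓝 fun i j => if j < i then 1 else 0) := by
  refine tendsto_pi_nhds.2 fun i => tendsto_pi_nhds.2 fun j => ?_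
  have hs : Tendsto (fun k : ℕ => (k : ℝ) + 2) atTop atTop :=
    tendsto_atTop_add_const_right _ _ tendsto_natCast_atTop_atTop
  have hpos : ∀ k : ℕ, (0 : ℝ) < (k : ℝ) + 2 := fun k => by positivity
  rcases lt_trichotomy j i with hij | hij | hij
  · rw [if_pos hij]
    obtain ⟨e, he⟩ : ∃ e, (i : ℕ) = j + (e + 1) := ⟨i - j - 1, by
      have : (j : ℕ) < i := hij
      omega⟩
    have h1 : Tendsto (fun k : ℕ => (1 - (((k : ℝ) + 2) ^ (e + 1))⁻¹)⁻¹) atTop (𝓝 1) := by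
      have h2 : Tendsto (fun k : ℕ => (((k : ℝ) + 2) ^ (e + 1))⁻¹) atTop (𝓝 0) :=
        tendsto_inv_atTop_zero.comp ((tendsto_pow_atTop (Nat.succ_ne_zero e)).comp hs)
      have h3 := (tendsto_const_nhds (x := (1 : ℝ))).sub h2
      rw [sub_zero] at h3
      simpa using h3.inv₀ one_ne_zero
    refine h1.congr fun k => ?_
    have hk := hpos k
    have h4 : (1 : ℝ) < ((k : ℝ) + 2) ^ (e + 1) :=
      one_lt_pow₀ (by linarith [(Nat.cast_nonneg k : (0 : ℝ) ≤ k)]) (Nat.succ_ne_zero e)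
    unfold gaudin
    show _ = ((k : ℝ) + 2) ^ (i : ℕ) * (((k : ℝ) + 2) ^ (i : ℕ) - ((k : ℝ) + 2) ^ (j : ℕ))⁻¹
    rw [he, pow_add _ _ (e + 1)]
    generalize ((k : ℝ) + 2) ^ (e + 1) = y at h4
    have hz : ((k : ℝ) + 2) ^ (j : ℕ) ≠ 0 := (pow_pos hk _).ne'
    generalize ((k : ℝ) + 2) ^ (j : ℕ) = z at hz
    have hy : y - 1 ≠ 0 := by linarith [h4] |> fun (h : 0 < y - 1) => h.ne'
    have hy0 : y ≠ 0 := by linarith [h4] |> fun (h : 0 < y) => h.ne'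
    have e1 : z * y - z = z * (y - 1) := by ring
    have e2 : 1 - y⁻¹ = (y - 1) / y := by field_simp
    rw [e1, e2]
    field_simp
  · subst hij
    simp [gaudin_self]
  · rw [if_neg hij.not_gt]
    obtain ⟨e, he⟩ : ∃ e, (j : ℕ) = i + (e + 1) := ⟨j - i - 1, by
      have : (i : ℕ) < j := hij
      omega⟩
    have h1 : Tendsto (fun k : ℕ => (1 - ((k : ℝ) + 2) ^ (e + 1))⁻¹) atTop (𝓝 0) := by
      refine tendsto_inv_atBot_zero.comp ?_
      exact tendsto_const_nhds.add_atBot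
        (tendsto_neg_atTop_atBot.comp ((tendsto_pow_atTop (Nat.succ_ne_zero e)).comp hs))
    refine h1.congr fun k => ?_
    have hk := hpos k
    have h4 : (1 : ℝ) < ((k : ℝ) + 2) ^ (e + 1) :=
      one_lt_pow₀ (by linarith [(Nat.cast_nonneg k : (0 : ℝ) ≤ k)]) (Nat.succ_ne_zero e)
    unfold gaudin
    show _ = ((k : ℝ) + 2) ^ (i : ℕ) * (((k : ℝ) + 2) ^ (i : ℕ) - ((k : ℝ) + 2) ^ (j : ℕ))⁻¹
    rw [he, pow_add _ _ (e + 1)]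
    generalize ((k : ℝ) + 2) ^ (e + 1) = y at h4
    have hz : ((k : ℝ) + 2) ^ (i : ℕ) ≠ 0 := (pow_pos hk _).ne'
    generalize ((k : ℝ) + 2) ^ (i : ℕ) = z at hz
    have e1 : z - z * y = z * (1 - y) := by ring
    rw [e1, mul_inv, ← mul_assoc, mul_inv_cancel₀ hz, one_mul]

lemma strictMono_pow_nat (k : ℕ) : StrictMono fun l : Fin n => ((k : ℝ) + 2) ^ (l : ℕ) :=
  fun i j hij => pow_lt_pow_right₀ (by linarith [(Nat.cast_nonneg k : (0 : ℝ) ≤ k)]) hij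

lemma exists_hasSimpleSpectrum (hN : Module.finrank ℂ (vacSpace (Fin n) m) = N) :
    ∃ x : Fin n → ℝ, StrictMono x ∧ HasSimpleSpectrum m N x := by
  by_contra! hcon
  have hdiag := fun k : ℕ => exists_isDiag (strictMono_pow_nat (n := n) k).injective hN
  choose b q hb using hdiag
  have hb' : ∀ k : ℕ, IsDiag m (fun i j : Fin n => ((k : ℝ) + 2) ^ (i : ℕ) *
      gaudin (fun l : Fin n => ((k : ℝ) + 2) ^ (l : ℕ)) i j) (b k)
      (fun a i => ((k : ℝ) + 2) ^ (i : ℕ) * q k a i) := by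
    refine fun k => ⟨(hb k).ortho, (hb k).vac, fun a i => ?_⟩
    ext I
    have := congrFun ((hb k).eig a i) I
    simp only [hamiltonian, Pi.smul_apply, smul_eq_mul] at this ⊢
    push_cast
    rw [mul_assoc, ← this, mul_sum]
    exact sum_congr rfl fun j _ => by ring
  obtain ⟨φ, hφ, b₀, q₀, -, hq₀, h₀⟩ := exists_subseq_isDiag tendsto_mul_gaudin_pow hb'
  refine not_injective_of_tendsto hq₀ (fun k hk => ?_) h₀.injective_jucysMurphy
  refine hcon _ (strictMono_pow_nat (φ k)) ⟨_, _, hb (φ k), fun a c hac => hk ?_⟩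
  simp only [hac]

/-- Simplicity of the spectrum of the Gaudin model. -/
theorem hasSimpleSpectrum (hm0 : 1 ≤ m) (hm : n = 2 * m)
    (hN : Module.finrank ℂ (vacSpace (Fin n) m) = N) {x : Fin n → ℝ} (hx : StrictMono x) :
    HasSimpleSpectrum m N x := by
  obtain ⟨y, hy, hys⟩ := exists_hasSimpleSpectrum hN
  let γ : unitInterval → Fin n → ℝ := fun s i => (1 - (s : ℝ)) * y i + s * x i
  have hγ : Continuous γ := by fun_prop
  have hmono : ∀ s, StrictMono (γ s) := fun s i j hij => by
    have h1 := hy hij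
    have h2 := hx hij
    have h3 := s.2.1
    have h4 := s.2.2
    rcases h3.eq_or_lt with h5 | h5
    · simp only [γ, ← h5]; linarith
    · simp only [γ]; nlinarith
  have h0 : γ 0 = y := by ext i; simp [γ]
  have h1 : γ 1 = x := by ext i; simp [γ]
  rw [← h1]
  exact HasSimpleSpectrum.of_path hm0 (by simpa using hm) hN hγ (fun s => (hmono s).injective)
    (by rwa [h0])

end JucysMurphy

end Continuation

end Gaudin

namespace Gaudin

open Filter Topology

/-- The pair `(f, g)` separates the points near `z₀`, up to proportionality. -/
def LocInj (f g : ℂ[X]) (z₀ : ℂ) : Prop :=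
  ∃ U ∈ 𝓝 z₀, ∀ z ∈ U, ∀ w ∈ U, f.eval z * g.eval w = f.eval w * g.eval z → z = w

lemma LocInj.swap {f g : ℂ[X]} {z₀ : ℂ} (h : LocInj f g z₀) : LocInj g f z₀ := by
  obtain ⟨U, hU, h⟩ := h
  exact ⟨U, hU, fun z hz w hw hzw => h z hz w hw (by linear_combination -hzw)⟩

lemma hasStrictDerivAt_ratio (f : ℂ[X]) {g : ℂ[X]} {z₀ : ℂ} (hg : g.eval z₀ ≠ 0) :
    HasStrictDerivAt (fun z => f.eval z / g.eval z)
      (-(wronskian f g).eval z₀ / g.eval z₀ ^ 2) z₀ := by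
  refine ((f.hasStrictDerivAt z₀).fun_div (g.hasStrictDerivAt z₀) hg).congr_deriv ?_
  simp only [wronskian, eval_sub, eval_mul]
  ring

lemma locInj_of_ne_zero_aux {f g : ℂ[X]} {z₀ : ℂ} (hg : g.eval z₀ ≠ 0)
    (hw : (wronskian f g).eval z₀ ≠ 0) : LocInj f g z₀ := by
  have hd : -(wronskian f g).eval z₀ / g.eval z₀ ^ 2 ≠ 0 :=
    div_ne_zero (neg_ne_zero.2 hw) (pow_ne_zero _ hg)
  have hf := (hasStrictDerivAt_ratio f hg).hasStrictFDerivAt_equiv hd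
  have h1 := (HasStrictFDerivAt.toOpenPartialHomeomorph _ hf).open_source.mem_nhds
    (HasStrictFDerivAt.mem_toOpenPartialHomeomorph_source hf)
  have h2 : ∀ᶠ z in 𝓝 z₀, g.eval z ≠ 0 := g.continuous.continuousAt.eventually_ne hg
  refine ⟨_, inter_mem h1 h2, fun z hz w hw h => ?_⟩
  refine (HasStrictFDerivAt.toOpenPartialHomeomorph _ hf).injOn hz.1 hw.1 ?_
  have hz2 := hz.2
  have hw2 := hw.2
  simp only [Set.mem_ofPred_eq] at hz2 hw2
  rw [HasStrictFDerivAt.toOpenPartialHomeomorph_coe]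
  rw [div_eq_div_iff hz2 hw2, h]

lemma not_locInj_of_eq_zero_aux {f g : ℂ[X]} {z₀ : ℂ} (hg : g.eval z₀ ≠ 0)
    (hw0 : wronskian f g ≠ 0) (hw : (wronskian f g).eval z₀ = 0) : ¬ LocInj f g z₀ := by
  rintro ⟨U, hU, hinj⟩
  set P : ℂ[X] := C (g.eval z₀) * f - C (f.eval z₀) * g with hP
  have hP0 : P ≠ 0 := fun h => hw0 <| by
    have h1 : wronskian P g = 0 := by rw [h]; simp [wronskian]
    have h2 : wronskian P g = C (g.eval z₀) * wronskian f g := by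
      rw [hP]; simp only [wronskian, derivative_sub, derivative_C_mul]; ring
    rw [h2] at h1
    exact (mul_eq_zero.1 h1).resolve_left (C_ne_zero.2 hg)
  obtain ⟨h, hPh, hndvd⟩ := exists_eq_pow_rootMultiplicity_mul_and_not_dvd P hP0 z₀
  set k := P.rootMultiplicity z₀ with hk
  have hk2 : 1 < k := by
    rw [hk, one_lt_rootMultiplicity_iff_isRoot hP0]
    refine ⟨by simp [hP, mul_comm], ?_⟩
    have : (derivative P).eval z₀ = -(wronskian f g).eval z₀ := by
      simp only [hP, wronskian, derivative_sub, derivative_C_mul, eval_sub, eval_mul, eval_C]; ring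
    rw [IsRoot, this, hw, neg_zero]
  have hh : h.eval z₀ ≠ 0 := fun h0 => hndvd (dvd_iff_isRoot.2 h0)
  have hg2 : ∀ᶠ z in 𝓝 z₀, g.eval z ≠ 0 := g.continuous.continuousAt.eventually_ne hg
  set H : ℂ → ℂ := fun z => h.eval z / g.eval z with hH
  have hH0 : H z₀ ≠ 0 := div_ne_zero hh hg
  have hkey : ∀ z, g.eval z ≠ 0 →
      f.eval z / g.eval z * g.eval z₀ = f.eval z₀ + (z - z₀) ^ k * H z := fun z hz => by
    have := congrArg (eval z) hPh
    simp only [hP, eval_sub, eval_mul, eval_pow, eval_C, eval_X] at this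
    simp only [hH]
    field_simp
    linear_combination this
  obtain ⟨r, hr⟩ := IsAlgClosed.exists_pow_nat_eq (H z₀) (zero_lt_one.trans hk2)
  have hr0 : r ≠ 0 := by
    rintro rfl
    rw [zero_pow (by omega)] at hr
    exact hH0 hr.symm
  set ρ : ℂ → ℂ := fun z => (H z / H z₀) ^ ((k : ℂ)⁻¹) with hρ
  have hρk : ∀ z, ρ z ^ k = H z / H z₀ := fun z => Complex.cpow_nat_inv_pow _ (by omega)
  have hρ0 : ρ z₀ = 1 := by simp [hρ, div_self hH0]
  obtain ⟨c, hc⟩ : ∃ c, HasStrictDerivAt ρ c z₀ := by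
    refine ⟨_, HasStrictDerivAt.cpow ((hasStrictDerivAt_ratio h hg).div_const (H z₀))
      (hasStrictDerivAt_const z₀ ((k : ℂ)⁻¹)) ?_⟩
    rw [div_self hH0]
    exact Complex.one_mem_slitPlane
  set ψ : ℂ → ℂ := fun z => (z - z₀) * (r * ρ z) with hψ
  have hψd : HasStrictDerivAt ψ r z₀ := by
    refine (HasStrictDerivAt.fun_mul ((hasStrictDerivAt_id z₀).sub_const z₀)
      (hc.const_mul r)).congr_deriv ?_
    simp [hρ0]
  have hψk : ∀ z, ψ z ^ k = (z - z₀) ^ k * H z := fun z => by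
    simp only [hψ]
    rw [mul_pow, mul_pow, hr, hρk]
    field_simp
  have hmap := hψd.map_nhds_eq hr0
  have hψ0 : ψ z₀ = 0 := by simp [hψ]
  rw [hψ0] at hmap
  have himg : ψ '' (U ∩ {z | g.eval z ≠ 0}) ∈ 𝓝 (0 : ℂ) := by
    rw [← hmap]; exact image_mem_map (inter_mem hU hg2)
  obtain ⟨ζ, hζ⟩ : ∃ ζ : ℂ, IsPrimitiveRoot ζ k :=
    ⟨_, Complex.isPrimitiveRoot_exp k (by omega)⟩
  have himg2 : ∀ᶠ t in 𝓝 (0 : ℂ), ζ * t ∈ ψ '' (U ∩ {z | g.eval z ≠ 0}) := by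
    have : Tendsto (fun t : ℂ => ζ * t) (𝓝 0) (𝓝 0) := by
      simpa using (continuous_const_mul ζ).tendsto 0
    exact this himg
  have hev : ∀ᶠ t in 𝓝[≠] (0 : ℂ), t ∈ ψ '' (U ∩ {z | g.eval z ≠ 0}) ∧
      ζ * t ∈ ψ '' (U ∩ {z | g.eval z ≠ 0}) ∧ t ≠ 0 := by
    filter_upwards [nhdsWithin_le_nhds himg, nhdsWithin_le_nhds himg2, self_mem_nhdsWithin]
      with t h1 h2 h3 using ⟨h1, h2, h3⟩
  obtain ⟨t, ⟨z, ⟨hzU, hzg⟩, hz⟩, ⟨w, ⟨hwU, hwg⟩, hw'⟩, ht⟩ := hev.exists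
  have h1 : f.eval z / g.eval z = f.eval w / g.eval w := by
    refine mul_right_cancel₀ hg ?_
    rw [hkey z hzg, hkey w hwg, ← hψk, ← hψk, hz, hw', mul_pow, hζ.pow_eq_one, one_mul]
  have h2 := hinj z hzU w hwU (by rwa [div_eq_div_iff hzg hwg] at h1)
  rw [← h2, hz] at hw'
  exact hζ.ne_one hk2 (mul_right_cancel₀ ht (by rw [one_mul]; exact hw'.symm))

/-- Local injectivity of the ratio is detected by the Wronskian. -/
lemma locInj_iff {f g : ℂ[X]} {z₀ : ℂ} (h : f.eval z₀ ≠ 0 ∨ g.eval z₀ ≠ 0)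
    (hw0 : wronskian f g ≠ 0) : LocInj f g z₀ ↔ (wronskian f g).eval z₀ ≠ 0 := by
  have hsw : wronskian g f = -wronskian f g := by simp only [wronskian]; ring
  rcases h with h | h
  · refine ⟨fun hl hw => not_locInj_of_eq_zero_aux h (f := g) ?_ ?_ hl.swap,
      fun hw => (locInj_of_ne_zero_aux h ?_).swap⟩
    · rwa [hsw, neg_ne_zero]
    · rw [hsw, eval_neg, hw, neg_zero]
    · rwa [hsw, eval_neg, neg_ne_zero]
  · exact ⟨fun hl hw => not_locInj_of_eq_zero_aux h hw0 hw hl, locInj_of_ne_zero_aux h⟩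

end Gaudin

namespace Gaudin

open Filter Topology

lemma exists_injOn_iff_of_map_nhds {X Y Z : Type*} [TopologicalSpace X] [TopologicalSpace Y]
    {J : X → Y} (hJ : Function.Injective J) {a : X} {b : Y} (hab : map J (𝓝 a) = 𝓝 b)
    (F : Y → Z) : (∃ U ∈ 𝓝 b, Set.InjOn F U) ↔ ∃ V ∈ 𝓝 a, Set.InjOn (F ∘ J) V := by
  constructor
  · rintro ⟨U, hU, h⟩
    rw [← hab] at hU
    exact ⟨J ⁻¹' U, hU, fun z hz w hw hzw => hJ (h hz hw hzw)⟩
  · rintro ⟨V, hV, h⟩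
    refine ⟨J '' V, hab ▸ image_mem_map hV, ?_⟩
    rintro _ ⟨z, hz, rfl⟩ _ ⟨w, hw, rfl⟩ hzw
    rw [h hz hw hzw]

/-- The point of the sphere with homogeneous coordinates `(a : b)`. -/
noncomputable def homPt (a b : ℂ) : OnePoint ℂ := if b = 0 then ∞ else ((a / b : ℂ) : OnePoint ℂ)

lemma homPt_eq_iff {a b c e : ℂ} (h : a ≠ 0 ∨ b ≠ 0) (h' : c ≠ 0 ∨ e ≠ 0) :
    homPt a b = homPt c e ↔ a * e = c * b := by
  unfold homPt
  by_cases hb : b = 0 <;> by_cases he : e = 0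
  · simp [hb, he]
  · subst hb; simp_all
  · subst he; simp_all
  · rw [if_neg hb, if_neg he, OnePoint.coe_eq_coe, div_eq_div_iff hb he]

lemma homPt_mul_left {c : ℂ} (hc : c ≠ 0) (a b : ℂ) : homPt (c * a) (c * b) = homPt a b := by
  unfold homPt
  simp [hc, mul_div_mul_left]

/-- The chart of the sphere centered at infinity. -/
noncomputable def chartInf (w : ℂ) : OnePoint ℂ := if w = 0 then ∞ else ((w⁻¹ : ℂ) : OnePoint ℂ)

lemma chartInf_injective : Function.Injective chartInf := by
  intro z w h
  unfold chartInf at h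
  by_cases hz : z = 0 <;> by_cases hw : w = 0 <;> simp_all

lemma map_chartInf_nhds : map chartInf (𝓝 0) = 𝓝 (∞ : OnePoint ℂ) := by
  rw [OnePoint.nhds_infty_eq, ← nhdsNE_sup_pure, Filter.map_sup, map_pure]
  congr 1
  · have h1 : map chartInf (𝓝[≠] (0 : ℂ)) = map ((↑) : ℂ → OnePoint ℂ) (map Inv.inv (𝓝[≠] 0)) := by
      rw [map_map]
      refine Filter.map_congr ?_
      filter_upwards [self_mem_nhdsWithin] with w hw
      exact if_neg hw
    rw [h1]
    congr 1
    rw [coclosedCompact_eq_cocompact, ← Metric.cobounded_eq_cocompact, Filter.map_inv,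
      Filter.inv_nhdsNE_zero]
  · simp [chartInf]

lemma isCritPt_coe_iff {f g : ℂ[X]} (h : ∀ z, f.eval z ≠ 0 ∨ g.eval z ≠ 0)
    (hw0 : wronskian f g ≠ 0) (z : ℂ) :
    IsCritPt (ratExt f g) (z : OnePoint ℂ) ↔ (wronskian f g).eval z = 0 := by
  rw [IsCritPt, exists_injOn_iff_of_map_nhds OnePoint.coe_injective (OnePoint.nhds_coe_eq z).symm,
    ← not_ne_iff, ← locInj_iff (h z) hw0, not_iff_not]
  refine exists_congr fun U => and_congr_right fun _ => ?_
  refine forall₂_congr fun a _ => forall₂_congr fun b _ => ?_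
  rw [← homPt_eq_iff (h a) (h b)]
  rfl

lemma ratExt_infty {f g : ℂ[X]} {d : ℕ} (hd : max f.degree g.degree = (d : ℕ)) :
    ratExt f g ∞ = homPt (f.coeff d) (g.coeff d) := by
  change ratAtInf f g = _
  unfold ratAtInf homPt
  have hf : f.degree ≤ d := hd ▸ le_max_left _ _
  have hg : g.degree ≤ d := hd ▸ le_max_right _ _
  by_cases hlt : g.degree < f.degree
  · rw [if_pos hlt, if_pos]
    rw [max_eq_left hlt.le] at hd
    exact coeff_eq_zero_of_degree_lt (hd ▸ hlt)
  · rw [max_eq_right (not_lt.1 hlt)] at hd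
    have hn : g.natDegree = d := natDegree_eq_of_degree_eq_some hd
    have h0 : g.coeff d ≠ 0 := by
      rw [← hn]
      exact leadingCoeff_ne_zero.2 (fun h => by simp [h] at hd)
    rw [if_neg hlt, if_neg h0, leadingCoeff, hn]

lemma eval_reflect (f : ℂ[X]) {d : ℕ} (hf : f.natDegree ≤ d) {w : ℂ} (hw : w ≠ 0) :
    (reflect d f).eval w = w ^ d * f.eval w⁻¹ := by
  have := invertibleOfNonzero (inv_ne_zero hw)
  have := eval₂_reflect_mul_pow (RingHom.id ℂ) w⁻¹ d f hf
  simp only [invOf_eq_inv, inv_inv] at this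
  rw [← eval₂_id, ← eval₂_id (p := f), ← this, mul_left_comm, ← mul_pow, mul_inv_cancel₀ hw, one_pow,
    mul_one]

lemma eval_zero_reflect (f : ℂ[X]) (d : ℕ) : (reflect d f).eval 0 = f.coeff d := by
  rw [← coeff_zero_eq_eval_zero, coeff_reflect, revAt_zero]

lemma ratExt_chartInf {f g : ℂ[X]} {d : ℕ} (hd : max f.degree g.degree = (d : ℕ)) (w : ℂ) :
    ratExt f g (chartInf w) = homPt ((reflect d f).eval w) ((reflect d g).eval w) := by
  unfold chartInf
  split_ifs with hw
  · rw [hw, eval_zero_reflect, eval_zero_reflect, ratExt_infty hd]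
  · have hf : f.natDegree ≤ d := natDegree_le_of_degree_le (hd ▸ le_max_left _ _)
    have hg : g.natDegree ≤ d := natDegree_le_of_degree_le (hd ▸ le_max_right _ _)
    rw [eval_reflect f hf hw, eval_reflect g hg hw, homPt_mul_left (pow_ne_zero _ hw)]
    rfl

lemma coeff_ne_zero_of_max_degree {f g : ℂ[X]} {d : ℕ} (hd : max f.degree g.degree = (d : ℕ)) :
    f.coeff d ≠ 0 ∨ g.coeff d ≠ 0 := by
  rcases max_choice f.degree g.degree with h | h
  · exact Or.inl (coeff_ne_zero_of_eq_degree (h ▸ hd))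
  · exact Or.inr (coeff_ne_zero_of_eq_degree (h ▸ hd))

lemma eval_reflect_ne_zero {f g : ℂ[X]} {d : ℕ} (h : ∀ z, f.eval z ≠ 0 ∨ g.eval z ≠ 0)
    (hd : max f.degree g.degree = (d : ℕ)) (w : ℂ) :
    (reflect d f).eval w ≠ 0 ∨ (reflect d g).eval w ≠ 0 := by
  by_cases hw : w = 0
  · rw [hw, eval_zero_reflect, eval_zero_reflect]
    exact coeff_ne_zero_of_max_degree hd
  · have hf : f.natDegree ≤ d := natDegree_le_of_degree_le (hd ▸ le_max_left _ _)
    have hg : g.natDegree ≤ d := natDegree_le_of_degree_le (hd ▸ le_max_right _ _)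
    rw [eval_reflect f hf hw, eval_reflect g hg hw]
    simpa [hw] using h w⁻¹

lemma eval_zero_wronskian_reflect (f g : ℂ[X]) (e : ℕ) :
    (wronskian (reflect (e + 1) f) (reflect (e + 1) g)).eval 0 =
      f.coeff (e + 1) * g.coeff e - f.coeff e * g.coeff (e + 1) := by
  have h1 : ∀ p : ℂ[X], (derivative (reflect (e + 1) p)).eval 0 = p.coeff e := fun p => by
    rw [← coeff_zero_eq_eval_zero, coeff_derivative, coeff_reflect, revAt_le (by omega)]
    simp
  simp only [wronskian, eval_sub, eval_mul, eval_zero_reflect, h1]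

lemma coeff_wronskian {f g : ℂ[X]} {e : ℕ} (hf : f.natDegree ≤ e + 1) (hg : g.natDegree ≤ e + 1) :
    (wronskian f g).coeff (e + e) =
      f.coeff e * g.coeff (e + 1) - f.coeff (e + 1) * g.coeff e := by
  have key : ∀ p : ℂ[X], p.natDegree ≤ e + 1 → ∃ p' : ℂ[X], p'.natDegree ≤ e ∧
      p = C (p.coeff (e + 1)) * X ^ (e + 1) + p' ∧ p'.coeff e = p.coeff e := fun p hp => by
    refine ⟨p - C (p.coeff (e + 1)) * X ^ (e + 1), ?_, by ring, by simp⟩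
    rw [natDegree_le_iff_coeff_eq_zero]
    intro N hN
    rw [coeff_sub, coeff_C_mul, coeff_X_pow]
    rcases Nat.eq_or_lt_of_le (Nat.succ_le_of_lt hN) with h | h
    · rw [← h]; simp
    · rw [if_neg (by omega), coeff_eq_zero_of_natDegree_lt (by omega)]; simp
  have hlow : ∀ p r : ℂ[X], p.natDegree ≤ e → r.natDegree ≤ e →
      (p * derivative r).coeff (e + e) = 0 := fun p r hp hr => by
    rw [coeff_mul_add_eq_of_natDegree_le hp
      ((natDegree_derivative_le r).trans ((Nat.sub_le _ _).trans hr)), coeff_derivative,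
      coeff_eq_zero_of_natDegree_lt (Nat.lt_succ_of_le hr)]
    simp
  have hX : ∀ r : ℂ[X], r.natDegree ≤ e → (X ^ (e + 1) * derivative r).coeff (e + e) =
      e * r.coeff e := fun r hr => by
    rcases e with - | e
    · rw [natDegree_eq_zero.1 (Nat.le_zero.1 hr) |>.choose_spec.symm]; simp
    · rw [show e + 1 + (e + 1) = e + (e + 1 + 1) by ring, coeff_X_pow_mul, coeff_derivative]
      push_cast; ring
  have hX' : ∀ r : ℂ[X], (X ^ e * r).coeff (e + e) = r.coeff e := fun r => coeff_X_pow_mul r e e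
  obtain ⟨f', hf', hfe, hfc⟩ := key f hf
  obtain ⟨g', hg', hge, hgc⟩ := key g hg
  set a := f.coeff (e + 1)
  set b := g.coeff (e + 1)
  have hw : wronskian f g = C a * (X ^ (e + 1) * derivative g') - C (a * (e + 1)) * (X ^ e * g')
      + C (b * (e + 1)) * (X ^ e * f') - C b * (X ^ (e + 1) * derivative f')
      + (f' * derivative g' - g' * derivative f') := by
    rw [hfe, hge]
    simp only [wronskian, derivative_add, derivative_C_mul, derivative_X_pow, C_mul, C_add, C_1,
      Nat.add_sub_cancel, Nat.cast_add, Nat.cast_one]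
    ring
  rw [hw]
  simp only [coeff_add, coeff_sub, coeff_C_mul, hX _ hf', hX _ hg', hX', hlow _ _ hf' hg',
    hlow _ _ hg' hf', hfc, hgc]
  ring

lemma isCritPt_infty_iff {f g : ℂ[X]} {e : ℕ} (h : ∀ z, f.eval z ≠ 0 ∨ g.eval z ≠ 0)
    (hd : max f.degree g.degree = (e + 1 : ℕ)) (hw0 : wronskian f g ≠ 0) :
    IsCritPt (ratExt f g) ∞ ↔ (wronskian f g).coeff (e + e) = 0 := by
  have hf : f.natDegree ≤ e + 1 := natDegree_le_of_degree_le (hd ▸ le_max_left _ _)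
  have hg : g.natDegree ≤ e + 1 := natDegree_le_of_degree_le (hd ▸ le_max_right _ _)
  have hev := eval_reflect_ne_zero h hd
  have hw0' : wronskian (reflect (e + 1) f) (reflect (e + 1) g) ≠ 0 := by
    intro h0
    have hco : IsCoprime (reflect (e + 1) f) (reflect (e + 1) g) := by
      rw [isCoprime_iff_aeval_ne_zero_of_isAlgClosed ℂ ℂ]
      simpa [coe_aeval_eq_eval] using hev
    obtain ⟨h1, h2⟩ := hco.wronskian_eq_zero_iff.1 h0
    have hC : ∀ p : ℂ[X], derivative (reflect (e + 1) p) = 0 → ∃ c, p = C c * X ^ (e + 1) :=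
      fun p hp => ⟨_, by
        rw [← reflect_C, ← eq_C_of_natDegree_eq_zero
          (derivative_eq_zero.1 hp), reflect_reflect]⟩
    obtain ⟨a, ha⟩ := hC f h1
    obtain ⟨b, hb⟩ := hC g h2
    refine hw0 ?_
    rw [ha, hb]
    simp only [wronskian, derivative_C_mul]
    ring
  rw [IsCritPt, exists_injOn_iff_of_map_nhds chartInf_injective map_chartInf_nhds,
    coeff_wronskian hf hg, ← neg_eq_zero, neg_sub, ← eval_zero_wronskian_reflect,
    ← not_ne_iff, ← locInj_iff (hev 0) hw0', not_iff_not]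
  refine exists_congr fun U => and_congr_right fun _ => ?_
  refine forall₂_congr fun a _ => forall₂_congr fun b _ => ?_
  rw [← homPt_eq_iff (hev a) (hev b), Function.comp, Function.comp, ratExt_chartInf hd,
    ratExt_chartInf hd]

end Gaudin

namespace Gaudin

open Finset

section Map

variable {ι K L : Type*} [Fintype ι] [DecidableEq ι] [Field K] [Field L] (φ : K →+* L)

lemma map_critPoly (x : ι → K) : (critPoly x).map φ = critPoly fun i => φ (x i) := by
  simp [critPoly, Lagrange.nodal, Polynomial.map_prod]

lemma map_wronskian (f g : K[X]) :
    (wronskian f g).map φ = wronskian (f.map φ) (g.map φ) := by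
  simp [wronskian, derivative_map]

lemma map_ode (x q : ι → K) (y : K[X]) :
    (ode x q y).map φ = ode (fun i => φ (x i)) (fun i => φ (q i)) (y.map φ) := by
  simp only [ode, potential, Polynomial.map_add, Polynomial.map_sub, Polynomial.map_mul,
    derivative_map, ← map_critPoly, Polynomial.map_sum, Polynomial.map_prod, map_C, map_X]

end Map

lemma isCoprime_iff_eval_ne_zero {f g : ℂ[X]} :
    IsCoprime f g ↔ ∀ z, f.eval z ≠ 0 ∨ g.eval z ≠ 0 := by
  rw [isCoprime_iff_aeval_ne_zero_of_isAlgClosed ℂ ℂ]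
  simp [coe_aeval_eq_eval]

lemma wronskian_linear_comb (f g : ℂ[X]) (a b c e : ℂ) :
    wronskian (C a * f + C b * g) (C c * f + C e * g) = C (a * e - b * c) * wronskian f g := by
  simp only [wronskian, derivative_add, derivative_C_mul, C_sub, C_mul]
  ring

variable {ι : Type*} [Fintype ι] [DecidableEq ι] {m : ℕ}

lemma wronskian_ne_zero_of_isRatOfDeg {f g : ℂ[X]} (h : IsRatOfDeg (m + 1) f g) :
    wronskian f g ≠ 0 := by
  intro h0
  obtain ⟨h1, h2⟩ := h.1.wronskian_eq_zero_iff.1 h0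
  have h3 : max f.degree g.degree ≤ 0 := max_le
    (natDegree_eq_zero_iff_degree_le_zero.1 (derivative_eq_zero.1 h1))
    (natDegree_eq_zero_iff_degree_le_zero.1 (derivative_eq_zero.1 h2))
  rw [h.2] at h3
  exact Nat.not_succ_le_zero m (by exact_mod_cast h3)

lemma natDegree_wronskian_le {f g : ℂ[X]} (hf : f.natDegree ≤ m + 1) (hg : g.natDegree ≤ m + 1) :
    (wronskian f g).natDegree ≤ m + m := by
  by_cases h0 : wronskian f g = 0
  · simp [h0]
  have h1 := natDegree_wronskian_lt_add h0
  by_contra hlt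
  have h2 : (wronskian f g).natDegree = m + 1 + m := by omega
  refine h0 (leadingCoeff_eq_zero.1 ?_)
  have hd : ∀ p : ℂ[X], p.natDegree ≤ m + 1 → (derivative p).natDegree ≤ m := fun p hp =>
    (natDegree_derivative_le p).trans (by omega)
  have h3 : (derivative f * g).coeff (m + 1 + m) =
      g.coeff (m + 1) * (derivative f).coeff m := by
    rw [mul_comm, coeff_mul_add_eq_of_natDegree_le hg (hd f hf)]
  rw [leadingCoeff, h2, wronskian, coeff_sub, coeff_mul_add_eq_of_natDegree_le hf (hd g hg), h3,
    coeff_derivative, coeff_derivative]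
  ring

/-- The finite simple critical set is encoded in the Wronskian. -/
lemma critSet_eq_range_iff {x : ι → ℂ} (hx : Function.Injective x)
    (hm : Fintype.card ι = 2 * m) {f g : ℂ[X]} (h : IsRatOfDeg (m + 1) f g) :
    {p : OnePoint ℂ | IsCritPt (ratExt f g) p} = Set.range (fun j => (x j : OnePoint ℂ)) ↔
      ∃ c : ℂ, c ≠ 0 ∧ wronskian f g = C c * critPoly x := by
  have hev := isCoprime_iff_eval_ne_zero.1 h.1
  have hw0 := wronskian_ne_zero_of_isRatOfDeg h
  have hdeg : (critPoly x).natDegree = m + m := by rw [natDegree_critPoly, hm]; ring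
  have hf : f.natDegree ≤ m + 1 := natDegree_le_of_degree_le (h.2 ▸ le_max_left _ _)
  have hg : g.natDegree ≤ m + 1 := natDegree_le_of_degree_le (h.2 ▸ le_max_right _ _)
  have hinf := isCritPt_infty_iff hev h.2 hw0
  have hcoe := isCritPt_coe_iff hev hw0
  have hlead : (critPoly x).coeff (m + m) = 1 := by rw [← hdeg]; exact critPoly_monic x
  constructor
  · intro hset
    have hc : (wronskian f g).coeff (m + m) ≠ 0 := fun h0 => by
      have h1 : (∞ : OnePoint ℂ) ∈ Set.range (fun j => (x j : OnePoint ℂ)) := hset ▸ hinf.2 h0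
      obtain ⟨j, hj⟩ := h1
      exact OnePoint.coe_ne_infty _ hj
    refine ⟨_, hc, ?_⟩
    rw [← sub_eq_zero]
    by_contra hne
    have hle := natDegree_wronskian_le hf hg
    have hlt : (wronskian f g - C ((wronskian f g).coeff (m + m)) * critPoly x).natDegree <
        Fintype.card ι := by
      rw [hm]
      have hle' : (wronskian f g - C ((wronskian f g).coeff (m + m)) * critPoly x).natDegree ≤
          m + m := (natDegree_sub_le _ _).trans
        (max_le hle ((natDegree_C_mul_le _ _).trans hdeg.le))
      refine lt_of_le_of_ne (hle'.trans (by omega)) fun heq => hne (leadingCoeff_eq_zero.1 ?_)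
      rw [leadingCoeff, heq, two_mul, coeff_sub, coeff_C_mul, hlead, mul_one, sub_self]
    refine hne (eq_zero_of_natDegree_lt_card_of_eval_eq_zero _ hx (fun i => ?_) hlt)
    have h1 : (x i : OnePoint ℂ) ∈ {p : OnePoint ℂ | IsCritPt (ratExt f g) p} :=
      hset ▸ Set.mem_range_self (f := fun j => (x j : OnePoint ℂ)) i
    rw [eval_sub, (hcoe _).1 h1, eval_mul, eval_critPoly_eq_zero.2 ⟨i, rfl⟩, mul_zero, sub_zero]
  · rintro ⟨c, hc, hw⟩
    ext p
    induction p using OnePoint.rec with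
    | infty =>
      simp only [Set.mem_ofPred_eq, hinf, hw, coeff_C_mul, hlead, mul_one, hc, Set.mem_range,
        OnePoint.coe_ne_infty, exists_false]
    | coe z =>
      rw [Set.mem_ofPred_eq, hcoe, hw, eval_C_mul, mul_eq_zero, or_iff_right hc,
        eval_critPoly_eq_zero, Set.mem_range]
      simp only [OnePoint.coe_eq_coe, eq_comm]

lemma isRatOfDeg_of_wronskian {x : ι → ℂ} (hx : Function.Injective x)
    (hm : Fintype.card ι = 2 * m) {f g : ℂ[X]} (hf : f.natDegree ≤ m + 1)
    (hg : g.natDegree ≤ m + 1) {c : ℂ} (hc : c ≠ 0) (hw : wronskian f g = C c * critPoly x) :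
    IsRatOfDeg (m + 1) f g := by
  have hw0 : wronskian f g ≠ 0 := by
    rw [hw]; exact mul_ne_zero (C_ne_zero.2 hc) (critPoly_monic x).ne_zero
  refine ⟨isCoprime_iff_eval_ne_zero.2 (eval_ne_zero_of_wronskian_critPoly hx hc hw), ?_⟩
  refine le_antisymm (max_le (natDegree_le_iff_degree_le.1 hf) (natDegree_le_iff_degree_le.1 hg)) ?_
  have h1 : 2 * m ≤ (wronskian f g).natDegree := by
    rw [hw, natDegree_C_mul hc, natDegree_critPoly, hm]
  rcases coeff_ne_zero_of_wronskian hf hg h1 hw0 with h | h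
  · exact le_max_of_le_left (le_degree_of_ne_zero h)
  · exact le_max_of_le_right (le_degree_of_ne_zero h)

lemma eq_of_ratEquiv {x q q' : ι → ℂ} (hx : Function.Injective x) {f g f' g' : ℂ[X]}
    {c c' : ℂ} (hc : c ≠ 0) (hw : wronskian f g = C c * critPoly x)
    (hw' : wronskian f' g' = C c' * critPoly x) (hc' : c' ≠ 0)
    (hf : ode x q f = 0) (hg : ode x q g = 0) (hf' : ode x q' f' = 0) (hg' : ode x q' g' = 0)
    (h : RatEquiv f g f' g') : q = q' := by
  obtain ⟨a, b, s, e, hdet, h⟩ := h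
  have hW : critPoly x ≠ 0 := (critPoly_monic x).ne_zero
  have hco : IsCoprime f g :=
    isCoprime_iff_eval_ne_zero.2 (eval_ne_zero_of_wronskian_critPoly hx hc hw)
  have hf0 : f ≠ 0 := fun h0 => by
    rw [h0] at hw
    exact mul_ne_zero (C_ne_zero.2 hc) hW (by rw [← hw]; simp [wronskian])
  simp only [smul_eq_C_mul] at h
  obtain ⟨k, hk⟩ : f ∣ C a * f' + C b * g' :=
    hco.dvd_of_dvd_mul_left ⟨_, h.symm⟩
  have hk' : C s * f' + C e * g' = g * k := mul_left_cancel₀ hf0 (by rw [h, hk]; ring)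
  have hkk : C c * (k * k) = C ((a * e - b * s) * c') := by
    have h1 := wronskian_linear_comb f' g' a b s e
    have h2 : wronskian (f * k) (g * k) = k * k * wronskian f g := by
      simp only [wronskian, derivative_mul]; ring
    rw [hk, hk', h2, hw, hw'] at h1
    refine mul_right_cancel₀ hW ?_
    rw [C_mul]
    linear_combination h1
  have hk0 : k ≠ 0 := by
    rintro rfl
    rw [mul_zero, mul_zero] at hkk
    exact mul_ne_zero hdet hc' (C_eq_zero.1 hkk.symm)
  have hkc : k.natDegree = 0 := by
    have h1 := congrArg natDegree hkk
    rw [natDegree_C_mul hc, natDegree_mul hk0 hk0, natDegree_C] at h1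
    omega
  rw [eq_C_of_natDegree_eq_zero hkc] at hk hk' hk0
  have hκ : k.coeff 0 ≠ 0 := C_ne_zero.1 hk0
  have key : ∀ p : ℂ[X], ode x q' (p * C (k.coeff 0)) = 0 → ode x q' p = 0 := fun p hp => by
    rw [mul_comm, ode_C_mul] at hp
    exact (mul_eq_zero.1 hp).resolve_left (C_ne_zero.2 hκ)
  refine residues_unique hx hc hw hf hg (key f ?_) (key g ?_)
  · rw [← hk, ode_add, ode_C_mul, ode_C_mul, hf', hg']; simp
  · rw [← hk', ode_add, ode_C_mul, ode_C_mul, hf', hg']; simp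

lemma ratEquiv_of_ode {x q : ι → ℂ} (hx : Function.Injective x) {f g f' g' : ℂ[X]}
    {c c' : ℂ} (hc : c ≠ 0) (hw : wronskian f g = C c * critPoly x)
    (hw' : wronskian f' g' = C c' * critPoly x) (hc' : c' ≠ 0)
    (hf : ode x q f = 0) (hg : ode x q g = 0) (hf' : ode x q f' = 0) (hg' : ode x q g' = 0) :
    RatEquiv f g f' g' := by
  obtain ⟨a, b, hab⟩ := exists_eq_linear_comb hx hc' hw' hf' hg' hf
  obtain ⟨s, e, hse⟩ := exists_eq_linear_comb hx hc' hw' hf' hg' hg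
  refine ⟨a, b, s, e, fun h0 => ?_, ?_⟩
  · have h1 := wronskian_linear_comb f' g' a b s e
    rw [← hab, ← hse, h0, C_0, zero_mul, hw] at h1
    exact mul_ne_zero (C_ne_zero.2 hc) (critPoly_monic x).ne_zero h1
  · simp only [smul_eq_C_mul]
    rw [← hab, ← hse, mul_comm]

end Gaudin

/-- **Theorems A and 2 combined.** For distinct real numbers `x₁ < … < x_{2d−2}`, the number
of equivalence classes of rational functions of degree `d` with critical set exactly
`{x₁, …, x_{2d−2}}` equals `u_d`, and every class contains a function with real
coefficients: there are `u_d` pairwise nonequivalent such rational functions, each given by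
a ratio of real polynomials, such that every rational function of degree `d` with this
critical set is equivalent to one of them. -/
theorem exactly_catalan_classes_all_real
    (d : ℕ) (hd : 2 ≤ d) (x : Fin (2 * d - 2) → ℝ) (hx : StrictMono x) :
    ∃ F : Fin (ud d) → ℂ[X] × ℂ[X],
      (∀ i, IsRatOfDeg d (F i).1 (F i).2 ∧
        (∃ g₁ g₀ : ℝ[X], (F i).1 = g₁.map (algebraMap ℝ ℂ) ∧
          (F i).2 = g₀.map (algebraMap ℝ ℂ)) ∧
        {p : OnePoint ℂ | IsCritPt (ratExt (F i).1 (F i).2) p} =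
          Set.range fun j => (((x j : ℂ)) : OnePoint ℂ)) ∧
      (∀ i j, i ≠ j → ¬ RatEquiv (F i).1 (F i).2 (F j).1 (F j).2) ∧
      (∀ g₁ g₀ : ℂ[X], IsRatOfDeg d g₁ g₀ →
        {p : OnePoint ℂ | IsCritPt (ratExt g₁ g₀) p} =
          Set.range (fun j => (((x j : ℂ)) : OnePoint ℂ)) →
        ∃ i, RatEquiv g₁ g₀ (F i).1 (F i).2) := by
  classical
  obtain ⟨m, rfl⟩ : ∃ m, d = m + 1 := ⟨d - 1, by omega⟩
  have hm0 : 1 ≤ m := by omega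
  have hn : 2 * (m + 1) - 2 = 2 * m := by omega
  have hm : Fintype.card (Fin (2 * (m + 1) - 2)) = 2 * m := by rw [Fintype.card_fin, hn]
  have hN : Module.finrank ℂ (Gaudin.vacSpace (Fin (2 * (m + 1) - 2)) m) = ud (m + 1) := by
    rw [Gaudin.finrank_vacSpace hm0 hm, ud, hn, Nat.add_sub_cancel]
  obtain ⟨b, q, hD, hq⟩ := Gaudin.hasSimpleSpectrum hm0 hn hN hx
  have hspec := fun a => Gaudin.isSpectral_of_eigenvector hx.injective hm (hD.vac a)
    (hD.ne_zero a) (hD.eig a)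
  have hsol := fun a => Gaudin.exists_solutions hx.injective hm0 hm (hspec a).sum_eq
    (hspec a).sum_mul_eq (hspec a).sq_eq
  choose f g hf hg hfd hgd c hc hw using hsol
  set xC : Fin (2 * (m + 1) - 2) → ℂ := fun j => (x j : ℂ) with hxC
  have hxi : Function.Injective xC := Complex.ofReal_injective.comp hx.injective
  have hwC : ∀ a, wronskian ((f a).map (algebraMap ℝ ℂ)) ((g a).map (algebraMap ℝ ℂ)) =
      C (c a : ℂ) * Gaudin.critPoly xC := fun a => by
    rw [← Gaudin.map_wronskian, hw, Polynomial.map_mul, Gaudin.map_critPoly, map_C]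
    rfl
  have hcC : ∀ a, (c a : ℂ) ≠ 0 := fun a => Complex.ofReal_ne_zero.2 (hc a)
  have hode : ∀ a (y : ℝ[X]), Gaudin.ode x (q a) y = 0 →
      Gaudin.ode xC (fun i => (q a i : ℂ)) (y.map (algebraMap ℝ ℂ)) = 0 := fun a y hy => by
    have := Gaudin.map_ode (algebraMap ℝ ℂ) x (q a) y
    rw [hy, Polynomial.map_zero] at this
    exact this.symm
  have hrat := fun a => Gaudin.isRatOfDeg_of_wronskian hxi hm (natDegree_map_le.trans (hfd a))
    (natDegree_map_le.trans (hgd a)) (hcC a) (hwC a)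
  refine ⟨fun a => ((f a).map (algebraMap ℝ ℂ), (g a).map (algebraMap ℝ ℂ)), fun a =>
    ⟨hrat a, ⟨f a, g a, rfl, rfl⟩,
      (Gaudin.critSet_eq_range_iff hxi hm (hrat a)).2 ⟨_, hcC a, hwC a⟩⟩, ?_, ?_⟩
  · intro a e hae hR
    have := Gaudin.eq_of_ratEquiv hxi (hcC a) (hwC a) (hwC e) (hcC e) (hode a _ (hf a))
      (hode a _ (hg a)) (hode e _ (hf e)) (hode e _ (hg e)) hR
    exact hae (hq (funext fun i => Complex.ofReal_injective (congrFun this i)))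
  · intro g₁ g₀ hr hset
    obtain ⟨κ, hκ, hwκ⟩ := (Gaudin.critSet_eq_range_iff hxi hm hr).1 hset
    have h1 : g₁.natDegree ≤ m + 1 := natDegree_le_of_degree_le (hr.2 ▸ le_max_left _ _)
    have h0 : g₀.natDegree ≤ m + 1 := natDegree_le_of_degree_le (hr.2 ▸ le_max_right _ _)
    obtain ⟨z, hz1, hz0⟩ := Gaudin.exists_ode_of_wronskian hxi hm0 hm h1 h0 hκ hwκ
    obtain ⟨ψ, hψ, hψ0, heig⟩ :=
      Gaudin.exists_eigenvector hx.injective hm h1 h0 hκ hwκ hz1 hz0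
    obtain ⟨a, ha⟩ := hD.complete hN hψ hψ0 heig
    obtain rfl : z = fun i => (q a i : ℂ) := funext ha
    exact ⟨a, Gaudin.ratEquiv_of_ode hxi hκ hwκ (hwC a) (hcC a) hz1 hz0 (hode a _ (hf a))
      (hode a _ (hg a))⟩
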